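/- Let p₁,…,p_s be polynomials with integer coefficients and zero constant term that are linearly independent over ℚ. Let (X,ℬ,μ,T) be a system and f₀, f₁, …, f_s ∈ L^∞(μ). If one of the functions f_i (0 ≤ i ≤ s) is orthogonal in L²(μ) to every eigenfunction of T, then lim_{N→∞} (1/N)·Σ_{n=1}^N |∫ f₀ · (f₁∘T^{p₁(n)}) · … · (f_s∘T^{p_s(n)}) dμ| = 0. -/

import Mathlib

open Filter MeasureTheory

/-- An eigenfunction of the system `(X, ℬ, μ, T)`: a bounded measurable function `g`
with `g ∘ T = e(a)·g` almost everywhere, for some `a ∈ ℝ`. -/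
def IsEigenfunction {X : Type} [MeasurableSpace X] (μ : Measure X) (T : X → X)
    (g : X → ℂ) : Prop :=
  Measurable g ∧ (∃ C, ∀ x, ‖g x‖ ≤ C) ∧
    ∃ a : ℝ, ∀ᵐ x ∂μ, g (T x) = Complex.exp (2 * Real.pi * Complex.I * a) * g x

namespace PolyAvg

/-! ### Bounded functions and states -/

/-- Bounded real functions. -/
def Bd {Ω : Type*} (φ : Ω → ℝ) : Prop := ∃ C, ∀ x, |φ x| ≤ C

/-- Functions bounded by one in absolute value. -/
def Bd1 {Ω : Type*} (u : Ω → ℂ) : Prop := ∀ x, ‖u x‖ ≤ 1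

/-- The submodule of bounded real functions. -/
def bddSub (Ω : Type*) : Submodule ℝ (Ω → ℝ) where
  carrier := {φ | Bd φ}
  add_mem' := by
    rintro a b ⟨C, hC⟩ ⟨D, hD⟩
    exact ⟨C + D, fun x => (abs_add_le _ _).trans (add_le_add (hC x) (hD x))⟩
  zero_mem' := ⟨0, fun x => by simp⟩
  smul_mem' := by
    rintro c a ⟨C, hC⟩
    refine ⟨|c| * C, fun x => ?_⟩
    simpa [abs_mul] using mul_le_mul_of_nonneg_left (hC x) (abs_nonneg c)

section Bd
variable {Ω Ω' : Type*} {φ ψ : Ω → ℝ} {u v : Ω → ℂ}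

theorem Bd.add (h : Bd φ) (k : Bd ψ) : Bd (fun x => φ x + ψ x) := (bddSub Ω).add_mem h k
theorem Bd.sub (h : Bd φ) (k : Bd ψ) : Bd (fun x => φ x - ψ x) := (bddSub Ω).sub_mem h k
theorem Bd.const (c : ℝ) : Bd (fun _ : Ω => c) := ⟨|c|, fun _ => le_rfl⟩
theorem Bd.mul (h : Bd φ) (k : Bd ψ) : Bd (fun x => φ x * ψ x) := by
  obtain ⟨C, hC⟩ := h
  obtain ⟨D, hD⟩ := k
  refine ⟨C * D, fun x => ?_⟩
  rw [abs_mul]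
  exact mul_le_mul (hC x) (hD x) (abs_nonneg _) ((abs_nonneg _).trans (hC x))
theorem Bd.pow (h : Bd φ) (n : ℕ) : Bd (fun x => φ x ^ n) := by
  induction n with
  | zero => simpa using Bd.const 1
  | succ n ih => simpa [pow_succ] using ih.mul h
theorem Bd.comp (h : Bd φ) (g : Ω' → Ω) : Bd (fun x => φ (g x)) := by
  obtain ⟨C, hC⟩ := h
  exact ⟨C, fun x => hC _⟩
theorem Bd.of_le {c : ℝ} (h0 : ∀ x, 0 ≤ φ x) (h1 : ∀ x, φ x ≤ c) : Bd φ :=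
  ⟨c, fun x => by rw [abs_of_nonneg (h0 x)]; exact h1 x⟩
theorem Bd.sum {ι : Type*} (s : Finset ι) {f : ι → Ω → ℝ} (h : ∀ i ∈ s, Bd (f i)) :
    Bd (fun x => ∑ i ∈ s, f i x) := by
  have := (bddSub Ω).sum_mem (t := s) (f := f) h
  rwa [Finset.sum_fn] at this

theorem Bd1.mul (h : Bd1 u) (k : Bd1 v) : Bd1 (u * v) := fun x => by
  rw [Pi.mul_apply, norm_mul]
  exact mul_le_one₀ (h x) (norm_nonneg _) (k x)
theorem Bd1.star (h : Bd1 u) : Bd1 (star u) := fun x => by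
  rw [Pi.star_apply, norm_star]
  exact h x
theorem Bd1.one : Bd1 (1 : Ω → ℂ) := fun x => by simp
theorem Bd1.comp (h : Bd1 u) (g : Ω' → Ω) : Bd1 (fun x => u (g x)) := fun _ => h _
theorem Bd1.norm (h : Bd1 u) : Bd (fun x => ‖u x‖) := Bd.of_le (fun _ => norm_nonneg _) h
theorem Bd1.prod {ι : Type*} (s : Finset ι) {f : ι → Ω → ℂ} (h : ∀ i ∈ s, Bd1 (f i)) :
    Bd1 (∏ i ∈ s, f i) := Finset.prod_induction f Bd1 (fun _ _ => Bd1.mul) Bd1.one h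

end Bd

/-- A state: a linear functional on all real functions which is positive on the bounded ones
and maps `1` to `1`. -/
structure St (Ω : Type*) where
  R : (Ω → ℝ) →ₗ[ℝ] ℝ
  pos' : ∀ φ : Ω → ℝ, Bd φ → (∀ x, 0 ≤ φ x) → 0 ≤ R φ
  one' : R (fun _ => 1) = 1

namespace St
variable {Ω Ω' : Type*} (M : St Ω)

/-- The complexification of a state. -/
def C : (Ω → ℂ) →ₗ[ℂ] ℂ where
  toFun u := ⟨M.R (fun x => (u x).re), M.R (fun x => (u x).im)⟩
  map_add' u v := by
    apply Complex.ext <;> simp [← map_add, ← Pi.add_def]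
  map_smul' c u := by
    have h (a b : ℝ) (f g : Ω → ℝ) : M.R (fun x => a * f x + b * g x) = a * M.R f + b * M.R g := by
      rw [← smul_eq_mul, ← smul_eq_mul, ← map_smul, ← map_smul, ← map_add]
      rfl
    apply Complex.ext
    · simpa [sub_eq_add_neg] using h c.re (-c.im) (fun x => (u x).re) (fun x => (u x).im)
    · simpa using h c.re c.im (fun x => (u x).im) (fun x => (u x).re)

theorem C_re (u : Ω → ℂ) : (M.C u).re = M.R (fun x => (u x).re) := rfl
theorem C_im (u : Ω → ℂ) : (M.C u).im = M.R (fun x => (u x).im) := rfl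

theorem C_star (u : Ω → ℂ) : M.C (star u) = star (M.C u) := by
  apply Complex.ext
  · simp [C_re]
  · have : (fun x => -(u x).im) = -(fun x => (u x).im) := rfl
    simp [C_im, this]

theorem C_ofReal (φ : Ω → ℝ) : M.C (fun x => (φ x : ℂ)) = M.R φ := by
  apply Complex.ext
  · simp [C_re]
  · have : (fun _ => (0 : ℝ)) = (0 : Ω → ℝ) := rfl
    simp [C_im, this]

theorem C_one : M.C 1 = 1 := by
  have := M.C_ofReal (fun _ => 1)
  rw [M.one'] at this
  exact (by simpa using this : M.C (fun _ => 1) = 1)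

theorem R_add (φ ψ : Ω → ℝ) : M.R (fun x => φ x + ψ x) = M.R φ + M.R ψ := M.R.map_add φ ψ
theorem R_sub (φ ψ : Ω → ℝ) : M.R (fun x => φ x - ψ x) = M.R φ - M.R ψ := M.R.map_sub φ ψ
theorem R_mul (c : ℝ) (φ : Ω → ℝ) : M.R (fun x => c * φ x) = c * M.R φ := M.R.map_smul c φ
theorem R_const (c : ℝ) : M.R (fun _ => c) = c := by
  simpa [M.one'] using M.R_mul c (fun _ => 1)
theorem R_sum {ι : Type*} (s : Finset ι) (f : ι → Ω → ℝ) :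
    M.R (fun x => ∑ i ∈ s, f i x) = ∑ i ∈ s, M.R (f i) := by
  rw [← map_sum]
  congr 1
  ext x
  simp
theorem C_mul (c : ℂ) (u : Ω → ℂ) : M.C (fun x => c * u x) = c * M.C u := M.C.map_smul c u
theorem C_sum {ι : Type*} (s : Finset ι) (f : ι → Ω → ℂ) :
    M.C (fun x => ∑ i ∈ s, f i x) = ∑ i ∈ s, M.C (f i) := by
  rw [← map_sum]
  congr 1
  ext x
  simp
theorem C_const (c : ℂ) : M.C (fun _ => c) = c := by
  simpa [← Pi.one_def, C_one] using M.C_mul c 1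

theorem mono {φ ψ : Ω → ℝ} (hφ : Bd φ) (hψ : Bd ψ) (h : ∀ x, φ x ≤ ψ x) : M.R φ ≤ M.R ψ := by
  have := M.pos' _ (hψ.sub hφ) (fun x => sub_nonneg.2 (h x))
  rw [R_sub] at this
  linarith

theorem R_le {φ : Ω → ℝ} (hφ : Bd φ) {c : ℝ} (h : ∀ x, φ x ≤ c) : M.R φ ≤ c := by
  simpa [R_const] using M.mono hφ (Bd.const c) h

theorem le_R {φ : Ω → ℝ} (hφ : Bd φ) {c : ℝ} (h : ∀ x, c ≤ φ x) : c ≤ M.R φ := by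
  simpa [R_const] using M.mono (Bd.const c) hφ h

theorem sq_R_le {φ : Ω → ℝ} (hφ : Bd φ) : M.R φ ^ 2 ≤ M.R (fun x => φ x ^ 2) := by
  have h := M.pos' (fun x => (φ x - M.R φ) ^ 2) ((hφ.sub (Bd.const _)).pow 2)
    (fun x => sq_nonneg _)
  have e : (fun x => (φ x - M.R φ) ^ 2)
      = fun x => φ x ^ 2 + ((-2 * M.R φ) * φ x + M.R φ ^ 2) := by
    ext x
    ring
  rw [e, R_add, R_add, R_mul, R_const] at h
  linarith

theorem pow_R_le {φ : Ω → ℝ} (hφ : Bd φ) (h0 : ∀ x, 0 ≤ φ x) (k : ℕ) :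
    M.R φ ^ (2 ^ k) ≤ M.R (fun x => φ x ^ (2 ^ k)) := by
  induction k with
  | zero => simp
  | succ k ih =>
    rw [pow_succ, pow_mul]
    refine (pow_le_pow_left₀ (pow_nonneg (M.pos' φ hφ h0) _) ih 2).trans ?_
    refine (M.sq_R_le (hφ.pow _)).trans (le_of_eq ?_)
    congr 1
    ext x
    rw [pow_mul]

theorem bd_re {u : Ω → ℂ} (h : Bd (fun x => ‖u x‖)) : Bd (fun x => (u x).re) := by
  obtain ⟨c, hc⟩ := h
  exact ⟨c, fun x => (Complex.abs_re_le_norm _).trans ((le_abs_self _).trans (hc x))⟩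

theorem norm_C_le_R {u : Ω → ℂ} (h : Bd (fun x => ‖u x‖)) : ‖M.C u‖ ≤ M.R (fun x => ‖u x‖) := by
  obtain ⟨z, hz, hz'⟩ : ∃ z : ℂ, ‖z‖ = 1 ∧ z * M.C u = ‖M.C u‖ := by
    by_cases h0 : M.C u = 0
    · exact ⟨1, by simp [h0]⟩
    · have : (‖M.C u‖ : ℂ) ≠ 0 := by simpa using h0
      refine ⟨star (M.C u) / ‖M.C u‖, by simp [h0], ?_⟩
      rw [div_mul_eq_mul_div, div_eq_iff this, Complex.star_def, ← Complex.normSq_eq_conj_mul_self,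
        Complex.normSq_eq_norm_sq]
      push_cast
      ring
  have h1 : ‖M.C u‖ = (M.C (fun x => z * u x)).re := by rw [C_mul, hz', Complex.ofReal_re]
  have h2 : (fun x => ‖z * u x‖) = fun x => ‖u x‖ := by
    ext x
    simp [hz]
  rw [h1, C_re]
  refine M.mono (bd_re (u := fun x => z * u x) (by rwa [h2])) h (fun x => ?_)
  exact (Complex.re_le_norm _).trans (congrFun h2 x).le

theorem norm_C_le {u : Ω → ℂ} {c : ℝ} (h : ∀ x, ‖u x‖ ≤ c) : ‖M.C u‖ ≤ c :=
  (M.norm_C_le_R (Bd.of_le (fun _ => norm_nonneg _) h)).trans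
    (M.R_le (Bd.of_le (fun _ => norm_nonneg _) h) h)

theorem norm_C_le_one {u : Ω → ℂ} (h : Bd1 u) : ‖M.C u‖ ≤ 1 := M.norm_C_le h

theorem norm_C_sq_le {u : Ω → ℂ} (h : Bd (fun x => ‖u x‖)) :
    ‖M.C u‖ ^ 2 ≤ M.R (fun x => ‖u x‖ ^ 2) :=
  (pow_le_pow_left₀ (norm_nonneg _) (M.norm_C_le_R h) 2).trans (M.sq_R_le h)

/-- The product of two states, the left one being the outer one. -/
def prod (A : St Ω') (M : St Ω) : St (Ω' × Ω) where
  R :=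
    { toFun := fun φ => A.R (fun a => M.R (fun x => φ (a, x)))
      map_add' := fun φ ψ => by
        rw [← A.R_add]
        congr 1
        ext a
        exact M.R_add _ _
      map_smul' := fun c φ => by
        refine Eq.trans ?_ (A.R_mul c _)
        congr 1
        ext a
        exact M.R_mul _ _ }
  pos' φ hφ h := by
    obtain ⟨c, hc⟩ := hφ
    exact A.pos' _ (Bd.of_le (c := c) (fun a => M.pos' _ ⟨c, fun x => hc _⟩ (fun x => h _))
      (fun a => M.R_le ⟨c, fun x => hc _⟩ fun x => (le_abs_self _).trans (hc _)))
      (fun a => M.pos' _ ⟨c, fun x => hc _⟩ (fun x => h _))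
  one' := by
    simp [M.R_const, A.R_const]

theorem prod_C (A : St Ω') (M : St Ω) (u : Ω' × Ω → ℂ) :
    (A.prod M).C u = A.C (fun a => M.C (fun x => u (a, x))) := rfl

theorem bd_R {φ : Ω' → Ω → ℝ} {c : ℝ} (h : ∀ a x, |φ a x| ≤ c) : Bd (fun a => M.R (φ a)) :=
  ⟨c, fun a => abs_le.2 ⟨M.le_R ⟨c, h a⟩ fun x => (abs_le.1 (h a x)).1,
    M.R_le ⟨c, h a⟩ fun x => (abs_le.1 (h a x)).2⟩⟩

theorem C_congr {u v : Ω → ℂ} (h : ∀ x, u x = v x) : M.C u = M.C v := by rw [funext h]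

/-- A bounded positive normalised functional on a subspace of bounded functions containing the
constants extends to a state. -/
theorem exists_extend (V : Submodule ℝ (Ω → ℝ)) (hV : V ≤ bddSub Ω) (h1 : (fun _ => 1) ∈ V)
    (f : V →ₗ[ℝ] ℝ) (hpos : ∀ φ : V, (∀ x, 0 ≤ (φ : Ω → ℝ) x) → 0 ≤ f φ)
    (hone : f ⟨fun _ => 1, h1⟩ = 1) : ∃ M : St Ω, ∀ φ : V, M.R φ = f φ := by
  let W : Submodule ℝ (bddSub Ω) := V.comap (bddSub Ω).subtype
  let g : bddSub Ω →ₗ.[ℝ] ℝ := ⟨W, f.comp (((bddSub Ω).subtype).restrict fun x hx => hx)⟩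
  let s : PointedCone ℝ (bddSub Ω) :=
    { carrier := {φ | ∀ x, 0 ≤ (φ : Ω → ℝ) x}
      add_mem' := fun {a b} ha hb x => add_nonneg (ha x) (hb x)
      zero_mem' := fun x => le_rfl
      smul_mem' := fun c a ha x => mul_nonneg c.2 (ha x) }
  obtain ⟨G, hG, hG'⟩ := riesz_extension s g (fun x hx => hpos _ hx) (by
    rintro ⟨y, c, hc⟩
    refine ⟨⟨⟨fun _ => c, Bd.const c⟩, ?_⟩, fun x => ?_⟩
    · have : (fun _ : Ω => c) = c • (fun _ => (1 : ℝ)) := by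
        ext
        simp
      exact (this ▸ V.smul_mem c h1 : (fun _ : Ω => c) ∈ V)
    · have := (abs_le.1 (hc x)).1
      change 0 ≤ c + y x
      linarith)
  obtain ⟨H, hH⟩ := LinearMap.exists_extend G
  have key : ∀ φ : bddSub Ω, H φ = G φ := fun φ => by rw [← hH]; rfl
  have key2 : ∀ φ : V, H φ = f φ := fun φ =>
    (key ⟨φ, hV φ.2⟩).trans (hG ⟨⟨φ, hV φ.2⟩, φ.2⟩)
  exact ⟨⟨H, fun φ hφ h => by rw [key ⟨φ, hφ⟩]; exact hG' _ h,
    (key2 ⟨_, h1⟩).trans hone⟩, key2⟩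

/-- Ultrafilter limits of states. -/
theorem exists_ultralimit {ι : Type*} (𝒰 : Ultrafilter ι) (M : ι → St Ω) :
    ∃ S : St Ω, ∀ φ, Bd φ → Tendsto (fun i => (M i).R φ) 𝒰 (nhds (S.R φ)) := by
  have hlim : ∀ φ : bddSub Ω, ∃ y, Tendsto (fun i => (M i).R φ) 𝒰 (nhds y) := by
    rintro ⟨φ, c, hc⟩
    have hmem : ∀ i, (M i).R φ ∈ Set.Icc (-c) c := fun i =>
      ⟨(M i).le_R ⟨c, hc⟩ fun x => (abs_le.1 (hc x)).1,
        (M i).R_le ⟨c, hc⟩ fun x => (abs_le.1 (hc x)).2⟩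
    obtain ⟨y, -, hy⟩ := (isCompact_Icc (a := -c) (b := c)).ultrafilter_le_nhds
      (𝒰.map fun i => (M i).R φ) (by
        simp only [Ultrafilter.coe_map, le_principal_iff, mem_map]
        exact Filter.univ_mem' hmem)
    exact ⟨y, hy⟩
  choose L hL using hlim
  let f : bddSub Ω →ₗ[ℝ] ℝ :=
    { toFun := L
      map_add' := fun φ ψ => tendsto_nhds_unique (hL (φ + ψ)) (by
        simpa using (hL φ).add (hL ψ))
      map_smul' := fun c φ => tendsto_nhds_unique (hL (c • φ)) (by
        simpa using (hL φ).const_mul c) }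
  obtain ⟨S, hS⟩ := exists_extend (bddSub Ω) le_rfl (Bd.const 1) f
    (fun φ hφ => ge_of_tendsto' (hL φ) fun i => (M i).pos' _ φ.2 hφ)
    (tendsto_nhds_unique (hL ⟨_, Bd.const 1⟩) (by simp [one']))
  refine ⟨S, fun φ hφ => ?_⟩
  rw [hS ⟨φ, hφ⟩]
  exact hL ⟨φ, hφ⟩

/-- Point evaluation. -/
def dirac (x : Ω) : St Ω where
  R := LinearMap.proj x
  pos' _ _ h := h x
  one' := rfl

/-- Push-forward of a state. -/
def map (g : Ω → Ω') : St Ω' where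
  R := M.R.comp (LinearMap.funLeft ℝ ℝ g)
  pos' _ hφ h := M.pos' _ (hφ.comp g) fun _ => h _
  one' := M.one'

/-- The average of finitely many states. -/
noncomputable def avg {ι : Type*} (s : Finset ι) (hs : s.Nonempty) (M : ι → St Ω) : St Ω where
  R := (s.card : ℝ)⁻¹ • ∑ i ∈ s, (M i).R
  pos' φ hφ h := by
    simp only [LinearMap.smul_apply, LinearMap.sum_apply, smul_eq_mul]
    exact mul_nonneg (by positivity) (Finset.sum_nonneg fun i _ => (M i).pos' φ hφ h)
  one' := by
    have : (s.card : ℝ) ≠ 0 := by exact_mod_cast hs.card_pos.ne'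
    simp [one', this]

theorem avg_R {ι : Type*} (s : Finset ι) (hs : s.Nonempty) (M : ι → St Ω) (φ : Ω → ℝ) :
    (avg s hs M).R φ = (s.card : ℝ)⁻¹ * ∑ i ∈ s, (M i).R φ := by
  simp [avg]

end St

/-! ### Invariant means on the integers -/

/-- A shift invariant mean on the integers. -/
structure Mean extends St ℤ where
  inv1 : ∀ φ : ℤ → ℝ, Bd φ → R (fun n => φ (n + 1)) = R φ

namespace Mean
variable (Λ : Mean)

theorem inv {φ : ℤ → ℝ} (hφ : Bd φ) (k : ℤ) : Λ.R (fun n => φ (n + k)) = Λ.R φ := by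
  induction k using Int.induction_on with
  | zero => simp
  | succ k ih =>
    rw [← ih, ← Λ.inv1 (fun n => φ (n + k)) (hφ.comp _)]
    congr 1
    ext n
    congr 1
    ring
  | pred k ih =>
    rw [← ih, ← Λ.inv1 (fun n => φ (n + (-k - 1))) (hφ.comp _)]
    congr 1
    ext n
    congr 1
    ring

theorem invC {u : ℤ → ℂ} (hu : Bd (fun n => ‖u n‖)) (k : ℤ) :
    Λ.C (fun n => u (n + k)) = Λ.C u := by
  have him : Bd (fun n => (u n).im) := by
    obtain ⟨c, hc⟩ := hu
    exact ⟨c, fun x => (Complex.abs_im_le_norm _).trans ((le_abs_self _).trans (hc x))⟩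
  apply Complex.ext
  · exact Λ.inv (St.bd_re hu) k
  · exact Λ.inv him k

/-- The mean dilated by a non-zero integer. -/
theorem exists_dilate (b : ℤ) (hb : b ≠ 0) : ∃ Λ' : Mean, ∀ φ : ℤ → ℝ, Bd φ → (∀ n, 0 ≤ φ n) →
    Λ.R (fun h => φ (b * h)) ≤ |b| * Λ'.R φ := by
  have hne : (Finset.range b.natAbs).Nonempty := by simpa using hb
  let S := St.avg (Finset.range b.natAbs) hne fun j => Λ.map fun h => b * h + j
  have hS : ∀ φ, S.R φ = (b.natAbs : ℝ)⁻¹ *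
      ∑ j ∈ Finset.range b.natAbs, Λ.R (fun h => φ (b * h + j)) := fun φ => by
    simp only [S, St.avg_R, Finset.card_range]
    rfl
  have hb' : (b.natAbs : ℝ) ≠ 0 := by exact_mod_cast Int.natAbs_ne_zero.2 hb
  have hb'' : ((|b| : ℤ) : ℝ) = (b.natAbs : ℝ) := by
    rw [Int.abs_eq_natAbs]
    simp
  refine ⟨⟨S, fun φ hφ => ?_⟩, fun φ hφ h => ?_⟩
  · rw [hS, hS]
    congr 1
    have h1 := Finset.sum_range_succ' (fun j : ℕ => Λ.R (fun h => φ (b * h + j))) b.natAbs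
    have h2 := Finset.sum_range_succ (fun j : ℕ => Λ.R (fun h => φ (b * h + j))) b.natAbs
    have h3 : Λ.R (fun h => φ (b * h + b.natAbs)) = Λ.R (fun h => φ (b * h + (0 : ℕ))) := by
      rcases Int.natAbs_eq b with hbb | hbb
      · rw [← Λ.inv (φ := fun h => φ (b * h + (0 : ℕ))) (hφ.comp _) 1]
        congr 1
        ext n
        congr 1
        rw [mul_add, ← hbb]
        simp
      · rw [← Λ.inv (φ := fun h => φ (b * h + (0 : ℕ))) (hφ.comp _) (-1)]
        congr 1
        ext n
        congr 1
        have : (b.natAbs : ℤ) = -b := by omega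
        rw [this]
        push_cast
        ring
    have h4 : ∑ j ∈ Finset.range b.natAbs, Λ.R (fun h => φ (b * h + j + 1))
        = ∑ j ∈ Finset.range b.natAbs, Λ.R (fun h => φ (b * h + (j + 1 : ℕ))) := by
      refine Finset.sum_congr rfl fun j _ => ?_
      congr 1
      ext h
      push_cast
      rw [add_assoc]
    rw [h4]
    linarith
  · have hz : Λ.R (fun h => φ (b * h)) = Λ.R (fun h => φ (b * h + (0 : ℕ))) := by simp
    change _ ≤ ((|b| : ℤ) : ℝ) * S.R φ
    rw [hS, hb'', mul_inv_cancel_left₀ hb', hz]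
    refine Finset.single_le_sum (f := fun j : ℕ => Λ.R (fun h => φ (b * h + j)))
      (fun j _ => Λ.pos' _ (hφ.comp _) fun n => h _) ?_
    simpa using Nat.pos_of_ne_zero (Int.natAbs_ne_zero.2 hb)

end Mean

/-! ### The van der Corput inequality -/

/-- The Fejér mean dominates lower bounds for all Fejér averages. -/
theorem exists_fejer : ∃ Λ : Mean, ∀ φ : ℤ → ℝ, Bd φ → ∀ c : ℝ,
    (∀ H : ℕ, 0 < H →
      c ≤ ((H : ℝ) ^ 2)⁻¹ * ∑ h ∈ Finset.range H, ∑ h' ∈ Finset.range H, φ (h - h')) →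
    c ≤ Λ.R φ := by
  let ne (N : ℕ) : (Finset.range (N + 1) ×ˢ Finset.range (N + 1)).Nonempty :=
    ⟨(0, 0), by simp⟩
  let S (N : ℕ) : St ℤ := St.avg _ (ne N) fun q => St.dirac ((q.1 : ℤ) - q.2)
  have hS (N : ℕ) (φ : ℤ → ℝ) : (S N).R φ = (((N + 1 : ℕ) : ℝ) ^ 2)⁻¹ *
      ∑ h ∈ Finset.range (N + 1), ∑ h' ∈ Finset.range (N + 1), φ (h - h') := by
    simp only [S, St.avg_R, Finset.card_product, Finset.card_range, Finset.sum_product]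
    push_cast
    rw [sq]
    rfl
  obtain ⟨L, hL⟩ := St.exists_ultralimit (Ultrafilter.of (atTop : Filter ℕ)) S
  have hle : (Ultrafilter.of (atTop : Filter ℕ) : Filter ℕ) ≤ atTop := Ultrafilter.of_le _
  refine ⟨⟨L, fun φ hφ => ?_⟩, fun φ hφ c h => ?_⟩
  · obtain ⟨C, hC⟩ := id hφ
    have h1 := (hL (fun n => φ (n + 1)) (hφ.comp _)).sub (hL φ hφ)
    have h2 : Tendsto (fun N : ℕ => (S N).R (fun n => φ (n + 1)) - (S N).R φ) atTop
        (nhds 0) := by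
      have hlim : Tendsto (fun N : ℕ => 2 * C * (((N + 1 : ℕ) : ℝ))⁻¹) atTop (nhds 0) := by
        have := ((tendsto_inv_atTop_zero.comp tendsto_natCast_atTop_atTop).comp
          (tendsto_add_atTop_nat 1)).const_mul (2 * C)
        simpa using this
      refine squeeze_zero_norm (fun N => ?_) hlim
      have hpos : (0 : ℝ) < ((N + 1 : ℕ) : ℝ) := by positivity
      rw [hS, hS, ← mul_sub, Real.norm_eq_abs, abs_mul, Finset.sum_comm,
        Finset.sum_comm (f := fun h h' : ℕ => φ (h - h')), ← Finset.sum_sub_distrib]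
      have h3 : |∑ x ∈ Finset.range (N + 1),
          (∑ h ∈ Finset.range (N + 1), φ ((h : ℤ) - x + 1)
            - ∑ h ∈ Finset.range (N + 1), φ ((h : ℤ) - x))| ≤ ((N + 1 : ℕ) : ℝ) * (2 * C) := by
        refine (Finset.abs_sum_le_sum_abs _ _).trans ?_
        rw [← nsmul_eq_mul]
        have := Finset.sum_le_card_nsmul (Finset.range (N + 1)) (fun x : ℕ =>
          |∑ h ∈ Finset.range (N + 1), φ ((h : ℤ) - x + 1)
            - ∑ h ∈ Finset.range (N + 1), φ ((h : ℤ) - x)|) (2 * C) (fun x _ => ?_)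
        · simpa using this
        · rw [← Finset.sum_sub_distrib]
          have := Finset.sum_range_sub (fun h : ℕ => φ ((h : ℤ) - x)) (N + 1)
          have e : ∀ h : ℕ, φ ((h : ℤ) - x + 1) = φ (((h + 1 : ℕ) : ℤ) - x) := fun h => by
            congr 1
            push_cast
            ring
          simp only [e]
          rw [this]
          refine (abs_sub _ _).trans ?_
          linarith [hC (((N + 1 : ℕ) : ℤ) - x), hC (((0 : ℕ) : ℤ) - x)]
      rw [abs_of_nonneg (by positivity)]
      refine (mul_le_mul_of_nonneg_left h3 (by positivity)).trans (le_of_eq ?_)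
      field_simp
    exact sub_eq_zero.1 (tendsto_nhds_unique h1 (h2.mono_left hle))
  · refine ge_of_tendsto' (hL φ hφ) fun N => ?_
    rw [hS]
    exact h (N + 1) N.succ_pos

section vdC
variable {Ω : Type*} (Λ : Mean) (M : St Ω)

/-- The correlation sequence of a sequence of functions. -/
noncomputable def corr (u : ℤ → Ω → ℂ) (h : ℤ) : ℂ :=
  Λ.C (fun n => M.C (u (n + h) * star (u n)))

variable {Λ M}

theorem corr_sub {u : ℤ → Ω → ℂ} (hu : ∀ n, Bd1 (u n)) (h h' : ℤ) :
    corr Λ M u (h - h') = Λ.C (fun n => M.C (u (n + h) * star (u (n + h')))) := by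
  have hb : Bd (fun n => ‖M.C (u (n + (h - h')) * star (u n))‖) :=
    Bd.of_le (fun _ => norm_nonneg _) fun n => M.norm_C_le_one ((hu _).mul (hu _).star)
  rw [corr, ← Λ.invC hb h']
  congr 1
  ext n
  rw [add_assoc, add_sub_cancel]

theorem norm_corr_le {u : ℤ → Ω → ℂ} (hu : ∀ n, Bd1 (u n)) (h : ℤ) : ‖corr Λ M u h‖ ≤ 1 :=
  Λ.norm_C_le fun _ => M.norm_C_le_one ((hu _).mul (hu _).star)

/-- Finite form of the van der Corput inequality. -/
theorem vdc_finite {v : Ω → ℂ} (hv : Bd1 v) {u : ℤ → Ω → ℂ} (hu : ∀ n, Bd1 (u n))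
    {H : ℕ} (hH : 0 < H) :
    ‖Λ.C (fun n => M.C (v * u n))‖ ^ 2 ≤
      ((H : ℝ) ^ 2)⁻¹ * ∑ h ∈ Finset.range H, ∑ h' ∈ Finset.range H,
        (corr Λ M u (h - h')).re := by
  have hH' : (H : ℂ) ≠ 0 := by exact_mod_cast hH.ne'
  have hH0 : (0 : ℝ) < H := by exact_mod_cast hH
  let N := Λ.toSt.prod M
  let w : ℤ × Ω → ℂ := fun q => ∑ h ∈ Finset.range H, (H : ℂ)⁻¹ * u (q.1 + h) q.2
  have hw : Bd1 w := fun q => by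
    refine (norm_sum_le _ _).trans ?_
    have := Finset.sum_le_card_nsmul (Finset.range H)
      (fun h : ℕ => ‖(H : ℂ)⁻¹ * u (q.1 + h) q.2‖) (H : ℝ)⁻¹ (fun h _ => by
        rw [norm_mul]
        simpa using mul_le_mul_of_nonneg_left (hu (q.1 + h) q.2) (inv_nonneg.2 hH0.le))
    simpa [hH0.ne'] using this
  have e1 : Λ.C (fun n => M.C (v * u n)) = N.C (fun q => v q.2 * w q) := by
    have : ∀ h : ℕ, N.C (fun q => (H : ℂ)⁻¹ * (v q.2 * u (q.1 + h) q.2))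
        = (H : ℂ)⁻¹ * Λ.C (fun n => M.C (v * u n)) := fun h => by
      rw [N.C_mul, St.prod_C, ← Λ.invC (u := fun n => M.C (v * u n))
        (Bd.of_le (fun _ => norm_nonneg _) fun n => M.norm_C_le_one (hv.mul (hu _))) h]
      rfl
    have e : (fun q => v q.2 * w q)
        = fun q => ∑ h ∈ Finset.range H, (H : ℂ)⁻¹ * (v q.2 * u (q.1 + h) q.2) := by
      ext q
      simp only [w, Finset.mul_sum]
      exact Finset.sum_congr rfl fun _ _ => by ring
    rw [e, N.C_sum, Finset.sum_congr rfl fun h _ => this h]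
    simp [hH']
  have hvw : Bd1 (fun q : ℤ × Ω => v q.2 * w q) := Bd1.mul (hv.comp Prod.snd) hw
  rw [e1]
  refine (N.norm_C_sq_le hvw.norm).trans ?_
  refine (N.mono (hvw.norm.pow 2) (hw.norm.pow 2) fun q => ?_).trans (le_of_eq ?_)
  · refine pow_le_pow_left₀ (norm_nonneg _) ?_ 2
    rw [norm_mul]
    exact mul_le_of_le_one_left (norm_nonneg _) (hv _)
  · have e2 : (fun q => ‖w q‖ ^ 2) = fun q => (∑ h ∈ Finset.range H, ∑ h' ∈ Finset.range H,
        (((H : ℝ) ^ 2)⁻¹ : ℝ) * (u (q.1 + h) q.2 * star (u (q.1 + h') q.2)) : ℂ).re := by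
      ext q
      have : ((‖w q‖ ^ 2 : ℝ) : ℂ) = w q * star (w q) := by
        rw [Complex.star_def, Complex.mul_conj, Complex.normSq_eq_norm_sq]
      rw [← Complex.ofReal_re (‖w q‖ ^ 2), this]
      simp only [w, star_sum, Finset.sum_mul_sum]
      congr 1
      refine Finset.sum_congr rfl fun h _ => Finset.sum_congr rfl fun h' _ => ?_
      push_cast
      simp only [star_mul', star_inv₀, star_natCast]
      field_simp
    rw [e2, ← St.C_re, N.C_sum, Complex.re_sum, Finset.mul_sum]
    refine Finset.sum_congr rfl fun h _ => ?_
    rw [N.C_sum, Complex.re_sum, Finset.mul_sum]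
    refine Finset.sum_congr rfl fun h' _ => ?_
    rw [N.C_mul, Complex.re_ofReal_mul, corr_sub hu]
    rfl

/-- If an average is large then some correlation with small non-zero non-exceptional shift
is large. -/
theorem exists_shift_corr {δ : ℝ} (hδ : 0 < δ) (b : ℕ) : ∃ H : ℕ, ∀ {Ω : Type} {Λ : Mean}
    {M : St Ω} {v : Ω → ℂ} (_ : Bd1 v) {u : ℤ → Ω → ℂ} (_ : ∀ n, Bd1 (u n)),
    δ ≤ ‖Λ.C (fun n => M.C (v * u n))‖ → ∀ bad : Finset ℤ, bad.card ≤ b →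
    ∃ h : ℤ, |h| ≤ H ∧ h ∉ bad ∧ δ ^ 2 / 2 ≤ ‖corr Λ M u h‖ := by
  obtain ⟨H, hH⟩ := exists_nat_gt (b * (2 / δ ^ 2))
  have hH0 : 0 < H := by
    have : (0 : ℝ) < H := lt_of_le_of_lt (by positivity) hH
    exact_mod_cast this
  have hHr : (0 : ℝ) < H := by exact_mod_cast hH0
  refine ⟨H, fun {Ω Λ M v} hv {u} hu h bad hbad => ?_⟩
  by_contra! hcon
  have h1 := vdc_finite (Λ := Λ) (M := M) hv hu hH0
  have h2 : ∀ h ∈ Finset.range H, ∀ h' ∈ Finset.range H, (corr Λ M u (h - h')).re ≤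
      δ ^ 2 / 2 + if ((h : ℤ) - h') ∈ bad then 1 else 0 := by
    intro h hh h' hh'
    rw [Finset.mem_range] at hh hh'
    split_ifs with hb
    · have := (Complex.re_le_norm _).trans (norm_corr_le (Λ := Λ) (M := M) hu (h - h'))
      have : 0 ≤ δ ^ 2 / 2 := by positivity
      linarith
    · have := hcon (h - h') (by rw [abs_le]; omega) hb
      linarith [Complex.re_le_norm (corr Λ M u (h - h'))]
  have h3 : ∀ h' ∈ Finset.range H, (∑ h ∈ Finset.range H,
      if ((h : ℤ) - h') ∈ bad then (1 : ℝ) else 0) ≤ b := by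
    intro h' _
    rw [Finset.sum_boole]
    refine le_trans ?_ (Nat.cast_le.2 hbad)
    refine Nat.cast_le.2 (Finset.card_le_card_of_injOn (fun h : ℕ => (h : ℤ) - h')
      (fun x hx => ?_) (fun x _ y _ hxy => ?_))
    · simpa using (Finset.mem_filter.1 hx).2
    · simpa using hxy
  have h4 : ∑ h ∈ Finset.range H, ∑ h' ∈ Finset.range H, (corr Λ M u (h - h')).re
      ≤ H * (H * (δ ^ 2 / 2)) + H * b := by
    refine (Finset.sum_le_sum fun h hh => Finset.sum_le_sum fun h' hh' => h2 h hh h' hh').trans ?_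
    simp only [Finset.sum_add_distrib, Finset.sum_const, Finset.card_range, nsmul_eq_mul]
    rw [Finset.sum_comm]
    have := Finset.sum_le_sum h3
    simp only [Finset.sum_const, Finset.card_range, nsmul_eq_mul] at this
    linarith
  have h5 : ((H : ℝ) ^ 2)⁻¹ * (H * (H * (δ ^ 2 / 2)) + H * b) = δ ^ 2 / 2 + b / H := by
    field_simp
  have h6 : (b : ℝ) / H < δ ^ 2 / 2 := by
    rw [div_lt_iff₀ hHr]
    rw [mul_div_assoc', div_lt_iff₀ (by positivity)] at hH
    linarith
  have h7 := h1.trans (mul_le_mul_of_nonneg_left h4 (by positivity))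
  rw [h5] at h7
  have := pow_le_pow_left₀ hδ.le h 2
  linarith

end vdC

/-! ### A Cauchy–Schwarz inequality for means of functions -/

theorem exists_unit_mul (z : ℂ) : ∃ c : ℂ, ‖c‖ = 1 ∧ c * z = ‖z‖ := by
  by_cases h0 : z = 0
  · exact ⟨1, by simp [h0]⟩
  · have : (‖z‖ : ℂ) ≠ 0 := by simpa using h0
    refine ⟨star z / ‖z‖, by simp [h0], ?_⟩
    rw [div_mul_eq_mul_div, div_eq_iff this, Complex.star_def, ← Complex.normSq_eq_conj_mul_self,
      Complex.normSq_eq_norm_sq]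
    push_cast
    ring

theorem norm_add_real_mul_sq (b g : ℂ) (t : ℝ) :
    ‖b + t * g‖ ^ 2 = ‖b‖ ^ 2 + (2 * t * (g * star b).re + t ^ 2 * ‖g‖ ^ 2) := by
  simp only [← Complex.normSq_eq_norm_sq, Complex.normSq_apply, Complex.star_def, Complex.add_re,
    Complex.add_im, Complex.mul_re, Complex.mul_im, Complex.ofReal_re, Complex.ofReal_im,
    Complex.conj_re, Complex.conj_im]
  ring

theorem weak_cauchy_schwarz {Ω : Type*} (Λ : St ℤ) (M : St Ω) {v : Ω → ℂ} (hv : Bd1 v)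
    {a : ℤ → Ω → ℂ} (ha : ∀ h, Bd1 (a h)) :
    ‖Λ.C (fun h => M.C (v * a h))‖ ^ 2 ≤
      (Λ.C (fun h' => Λ.C (fun h => M.C (a h * star (a h'))))).re := by
  let ℓ (b : Ω → ℂ) : ℂ := Λ.C (fun h => M.C (b * a h))
  have ℓadd (b g : Ω → ℂ) (t : ℂ) : ℓ (fun x => b x + t * g x) = ℓ b + t * ℓ g := by
    simp only [ℓ]
    rw [← Λ.C_mul, ← map_add]
    congr 1
    ext h
    simp only [Pi.add_apply]
    rw [← M.C_mul, ← map_add]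
    congr 1
    ext x
    simp only [Pi.mul_apply, Pi.add_apply]
    ring
  let q (b : Ω → ℂ) : ℝ := M.R (fun x => ‖b x‖ ^ 2)
  have q0 (b : Ω → ℂ) (hb : Bd (fun x => ‖b x‖)) : 0 ≤ q b :=
    M.pos' _ (hb.pow 2) fun x => by positivity
  have ℓq (b : Ω → ℂ) (hb : Bd (fun x => ‖b x‖)) : ‖ℓ b‖ ^ 2 ≤ q b := by
    have h1 : ∀ h, ‖M.C (b * a h)‖ ^ 2 ≤ q b := fun h => by
      have hle : ∀ x, ‖b x * a h x‖ ≤ ‖b x‖ := fun x => by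
        rw [norm_mul]
        exact mul_le_of_le_one_right (norm_nonneg _) (ha h x)
      have hb' : Bd (fun x => ‖b x * a h x‖) := by
        obtain ⟨c, hc⟩ := hb
        exact Bd.of_le (fun _ => norm_nonneg _) fun x =>
          (hle x).trans ((le_abs_self _).trans (hc x))
      exact (M.norm_C_sq_le hb').trans (M.mono (hb'.pow 2) (hb.pow 2)
        fun x => pow_le_pow_left₀ (norm_nonneg _) (hle x) 2)
    have h2 : ‖ℓ b‖ ≤ Real.sqrt (q b) := Λ.norm_C_le fun h => Real.le_sqrt_of_sq_le (h1 h)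
    calc ‖ℓ b‖ ^ 2 ≤ Real.sqrt (q b) ^ 2 := pow_le_pow_left₀ (norm_nonneg _) h2 2
      _ = q b := Real.sq_sqrt (q0 b hb)
  let Ψ (b : {b : Ω → ℂ // Bd (fun x => ‖b x‖)}) : ℝ := q b - 2 * (ℓ b).re
  have Ψlb (b) : -1 ≤ Ψ b := by
    have h1 := ℓq b b.2
    have h2 := Complex.re_le_norm (ℓ b)
    simp only [Ψ]
    nlinarith [sq_nonneg (‖ℓ b‖ - 1)]
  have key : ∀ η : ℝ, 0 < η → η ≤ 1 → ‖ℓ v‖ ^ 2 ≤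
      (Λ.C (fun h' => Λ.C (fun h => M.C (a h * star (a h'))))).re + 13 * η := by
    intro η hη hη1
    have hbdd : BddBelow (Set.range Ψ) := ⟨-1, by rintro _ ⟨b, rfl⟩; exact Ψlb b⟩
    have hne : (Set.range Ψ).Nonempty := ⟨_, ⟨⟨0, by simpa using Bd.const 0⟩, rfl⟩⟩
    obtain ⟨_, ⟨b, rfl⟩, hb⟩ := exists_lt_of_csInf_lt hne
      (lt_add_of_pos_right (sInf (Set.range Ψ)) (pow_pos hη 2))
    have hmin (g : Ω → ℂ) (hg : Bd (fun x => ‖g x‖)) (t : ℝ) :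
        -η ^ 2 ≤ 2 * t * ((M.C (g * star (b : Ω → ℂ))).re - (ℓ g).re) + t ^ 2 * q g := by
      have hbg : Bd (fun x => ‖(b : Ω → ℂ) x + t * g x‖) := by
        obtain ⟨c, hc⟩ := b.2
        obtain ⟨d, hd⟩ := hg
        refine ⟨c + |t| * d, fun x => ?_⟩
        have h1 := hc x
        have h2 := hd x
        rw [abs_norm] at h1 h2 ⊢
        refine (norm_add_le _ _).trans (add_le_add h1 ?_)
        rw [norm_mul, Complex.norm_real, Real.norm_eq_abs]
        exact mul_le_mul_of_nonneg_left h2 (abs_nonneg _)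
      have h1 : sInf (Set.range Ψ) ≤ Ψ ⟨_, hbg⟩ := csInf_le hbdd ⟨_, rfl⟩
      have h2 : q (fun x => (b : Ω → ℂ) x + t * g x)
          = q b + (2 * t * (M.C (g * star (b : Ω → ℂ))).re + t ^ 2 * q g) := by
        simp only [q]
        rw [funext fun x => norm_add_real_mul_sq ((b : Ω → ℂ) x) (g x) t, M.R_add, M.R_add,
          M.R_mul, M.R_mul]
        rfl
      have h3 := congrArg Complex.re (ℓadd b g t)
      simp only [Complex.add_re, Complex.re_ofReal_mul] at h3
      simp only [Ψ] at h1 hb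
      rw [h2, h3] at h1
      linarith
    have happ (g : Ω → ℂ) (hg : Bd1 g) : ‖ℓ g - M.C (g * star (b : Ω → ℂ))‖ ≤ η := by
      obtain ⟨c, hc, hc'⟩ := exists_unit_mul (ℓ g - M.C (g * star (b : Ω → ℂ)))
      have hcg : Bd1 (fun x => c * g x) := fun x => by
        rw [norm_mul, hc, one_mul]
        exact hg x
      have h1 := hmin _ hcg.norm η
      have h2 : q (fun x => c * g x) ≤ 1 :=
        M.R_le (hcg.norm.pow 2) fun x => pow_le_one₀ (norm_nonneg _) (hcg x)
      have h3 : ℓ (fun x => c * g x) = c * ℓ g := by simpa using ℓadd 0 g c |>.trans (by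
        simp [ℓ, show (fun _ : ℤ => (0 : ℂ)) = 0 from rfl])
      have h4 : M.C ((fun x => c * g x) * star (b : Ω → ℂ)) = c * M.C (g * star (b : Ω → ℂ)) := by
        rw [← M.C_mul]
        congr 1
        ext x
        simp only [Pi.mul_apply]
        ring
      have h5 : ‖ℓ g - M.C (g * star (b : Ω → ℂ))‖
          = (c * ℓ g).re - (c * M.C (g * star (b : Ω → ℂ))).re := by
        rw [← Complex.sub_re, ← mul_sub, hc', Complex.ofReal_re]
      rw [h3, h4] at h1
      nlinarith
    have hΨ0 : q b - 2 * (ℓ b).re ≤ η ^ 2 := by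
      have := hmin b b.2 (-1)
      have e : (M.C ((b : Ω → ℂ) * star (b : Ω → ℂ))).re = q b := by
        rw [M.C_re]
        congr 1
        ext x
        simp [Complex.mul_conj, Complex.normSq_eq_norm_sq, -Complex.ofReal_pow]
      rw [e] at this
      linarith
    have hq9 : q b ≤ 9 := by
      have h1 := ℓq b b.2
      have h2 := Complex.re_le_norm (ℓ b)
      have h3 : ‖ℓ b‖ ≤ 3 := by nlinarith [norm_nonneg (ℓ b)]
      nlinarith
    have hqb : q b ≤ (ℓ b).re + 5 * η := by
      have := hmin b b.2 (-η)
      have e : (M.C ((b : Ω → ℂ) * star (b : Ω → ℂ))).re = q b := by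
        rw [M.C_re]
        congr 1
        ext x
        simp [Complex.mul_conj, Complex.normSq_eq_norm_sq, -Complex.ofReal_pow]
      rw [e] at this
      have h2 : 2 * η * q b ≤ 2 * η * ((ℓ b).re + 5 * η) := by nlinarith
      exact le_of_mul_le_mul_left h2 (by positivity)
    have hQ : (ℓ b).re - η ≤
        (Λ.C (fun h' => Λ.C (fun h => M.C (a h * star (a h'))))).re := by
      have h1 : star (ℓ b) = Λ.C (fun h' => M.C (star (a h') * star (b : Ω → ℂ))) := by
        simp only [ℓ]
        rw [← Λ.C_star]
        congr 1
        ext h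
        rw [Pi.star_apply, ← M.C_star, star_mul', mul_comm]
      have h2 : Λ.C (fun h' => Λ.C (fun h => M.C (a h * star (a h')))) - star (ℓ b)
          = Λ.C (fun h' => ℓ (star (a h')) - M.C (star (a h') * star (b : Ω → ℂ))) := by
        rw [h1, ← map_sub]
        congr 1
        ext h'
        simp only [ℓ, Pi.sub_apply]
        simp_rw [mul_comm (star (a h'))]
      have h3 := Λ.norm_C_le (fun h' => happ _ (ha h').star)
      rw [← h2] at h3
      have h4 := (abs_le.1 ((Complex.abs_re_le_norm _).trans h3)).1
      simp only [Complex.sub_re, Complex.star_def, Complex.conj_re] at h4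
      linarith
    have hv1 := happ v hv
    have hv2 : ‖M.C (v * star (b : Ω → ℂ))‖ ^ 2 ≤ q b := by
      have hle : ∀ x, ‖v x * star ((b : Ω → ℂ) x)‖ ≤ ‖(b : Ω → ℂ) x‖ := fun x => by
        rw [norm_mul, norm_star]
        exact mul_le_of_le_one_left (norm_nonneg _) (hv x)
      have hb' : Bd (fun x => ‖v x * star ((b : Ω → ℂ) x)‖) := by
        obtain ⟨c, hc⟩ := b.2
        exact Bd.of_le (fun _ => norm_nonneg _) fun x =>
          (hle x).trans ((le_abs_self _).trans (hc x))
      exact (M.norm_C_sq_le hb').trans (M.mono (hb'.pow 2) (b.2.pow 2)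
        fun x => pow_le_pow_left₀ (norm_nonneg _) (hle x) 2)
    have hv3 : ‖ℓ v‖ ≤ ‖M.C (v * star (b : Ω → ℂ))‖ + η := by
      have := norm_le_norm_add_norm_sub' (ℓ v) (M.C (v * star (b : Ω → ℂ)))
      linarith
    have hv4 : ‖M.C (v * star (b : Ω → ℂ))‖ ≤ 3 := by
      nlinarith [norm_nonneg (M.C (v * star (b : Ω → ℂ)))]
    have hv5 : ‖ℓ v‖ ^ 2 ≤ (‖M.C (v * star (b : Ω → ℂ))‖ + η) ^ 2 :=
      pow_le_pow_left₀ (norm_nonneg _) hv3 2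
    nlinarith [norm_nonneg (M.C (v * star (b : Ω → ℂ)))]
  refine le_of_forall_pos_le_add fun ε hε => ?_
  have := key (min 1 (ε / 13)) (lt_min one_pos (by positivity)) (min_le_left _ _)
  have h2 := min_le_right 1 (ε / 13)
  linarith

/-! ### Iterated means and the box inequality -/

/-- Iterated mean along a list of means. -/
noncomputable def IM : List Mean → St (List ℤ)
  | [] => St.dirac []
  | Λ :: Ls => (Λ.toSt.prod (IM Ls)).map fun q => q.1 :: q.2

/-- Iterated mean in which every mean is doubled; the first component is the outer one. -/
noncomputable def IM₂ : List Mean → St (List (ℤ × ℤ))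
  | [] => St.dirac []
  | Λ :: Ls => ((Λ.toSt.prod Λ.toSt).prod (IM₂ Ls)).map fun q => q.1 :: q.2

theorem IM_nil (φ : List ℤ → ℝ) : (IM []).R φ = φ [] := rfl
theorem IM_cons (Λ : Mean) (Ls : List Mean) (φ : List ℤ → ℝ) :
    (IM (Λ :: Ls)).R φ = Λ.R (fun h => (IM Ls).R (fun t => φ (h :: t))) := rfl
theorem IM₂_nil (φ : List (ℤ × ℤ) → ℝ) : (IM₂ []).R φ = φ [] := rfl
theorem IM₂_cons (Λ : Mean) (Ls : List Mean) (φ : List (ℤ × ℤ) → ℝ) :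
    (IM₂ (Λ :: Ls)).R φ = Λ.R (fun h' => Λ.R (fun h => (IM₂ Ls).R (fun t => φ ((h', h) :: t)))) :=
  rfl

theorem IM_congr (Ls : List Mean) {φ ψ : List ℤ → ℝ} (h : ∀ s, s.length = Ls.length → φ s = ψ s) :
    (IM Ls).R φ = (IM Ls).R ψ := by
  induction Ls generalizing φ ψ with
  | nil => exact h [] rfl
  | cons Λ Ls ih =>
    rw [IM_cons, IM_cons]
    congr 1
    ext k
    exact ih fun s hs => h _ (by simp [hs])

theorem IM_append (Ls : List Mean) (Λ : Mean) (φ : List ℤ → ℝ) :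
    (IM (Ls ++ [Λ])).R φ = (IM Ls).R (fun s => Λ.R (fun k => φ (s ++ [k]))) := by
  induction Ls generalizing φ with
  | nil => rfl
  | cons Λ' Ls ih =>
    rw [List.cons_append, IM_cons, IM_cons]
    congr 1
    ext h
    exact ih _

section Box
variable {Ω : Type*}

/-- The multiplicative cube of a family of functions along a list of pairs. -/
def cube : List (ℤ × ℤ) → (List ℤ → Ω → ℂ) → Ω → ℂ
  | [], A => A []
  | q :: t, A => cube t (fun s => A (q.2 :: s) * star (A (q.1 :: s)))

/-- Products of functions each of which misses at least one of the first `r` variables. -/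
def Lower : ℕ → (List ℤ → Ω → ℂ) → Prop
  | 0, B => (∀ s, Bd1 (B s)) ∧ B [] = 1
  | r + 1, B => (∀ s, Bd1 (B s)) ∧ ∃ (b : List ℤ → Ω → ℂ) (B' : ℤ → List ℤ → Ω → ℂ),
      (∀ t, Bd1 (b t)) ∧ (∀ h t, B (h :: t) = b t * B' h t) ∧ ∀ h, Lower r (B' h)

theorem Lower.bd {r : ℕ} {B : List ℤ → Ω → ℂ} (h : Lower r B) (s : List ℤ) : Bd1 (B s) := by
  cases r with
  | zero => exact h.1 s
  | succ r => exact h.1 s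

theorem Lower.mul {r : ℕ} {B B' : List ℤ → Ω → ℂ} (h : Lower r B) (h' : Lower r B') :
    Lower r (fun s => B s * B' s) := by
  induction r generalizing B B' with
  | zero => exact ⟨fun s => (h.1 s).mul (h'.1 s), by simp [h.2, h'.2]⟩
  | succ r ih =>
    obtain ⟨h0, b, C, hb, e, hC⟩ := h
    obtain ⟨h0', b', C', hb', e', hC'⟩ := h'
    exact ⟨fun s => (h0 s).mul (h0' s), fun t => b t * b' t, fun k t => C k t * C' k t,
      fun t => (hb t).mul (hb' t), fun k t => by beta_reduce; rw [e, e']; ring, fun k => ih (hC k) (hC' k)⟩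

theorem Lower.star {r : ℕ} {B : List ℤ → Ω → ℂ} (h : Lower r B) :
    Lower r (fun s => star (B s)) := by
  induction r generalizing B with
  | zero => exact ⟨fun s => (h.1 s).star, by simp [h.2]⟩
  | succ r ih =>
    obtain ⟨h0, b, C, hb, e, hC⟩ := h
    exact ⟨fun s => (h0 s).star, fun t => Star.star (b t), fun k t => Star.star (C k t),
      fun t => (hb t).star, fun k t => by beta_reduce; rw [e, star_mul'], fun k => ih (hC k)⟩

theorem Lower.comp {Ω' : Type*} {r : ℕ} {B : List ℤ → Ω → ℂ} (h : Lower r B) (g : Ω' → Ω) :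
    Lower r (fun s x => B s (g x)) := by
  induction r generalizing B with
  | zero => exact ⟨fun s => (h.1 s).comp g, by beta_reduce; rw [h.2]; rfl⟩
  | succ r ih =>
    obtain ⟨h0, b, C, hb, e, hC⟩ := h
    exact ⟨fun s => (h0 s).comp g, fun t x => b t (g x), fun k t x => C k t (g x),
      fun t => (hb t).comp g, fun k t => by beta_reduce; rw [e]; rfl, fun k => ih (hC k)⟩

theorem Lower.one (r : ℕ) : Lower r (fun _ => (1 : Ω → ℂ)) := by
  induction r with
  | zero => exact ⟨fun _ => Bd1.one, rfl⟩
  | succ r ih => exact ⟨fun _ => Bd1.one, 1, fun _ _ => 1, fun _ => Bd1.one, fun _ _ => by simp,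
      fun _ => ih⟩

theorem Lower.const {r : ℕ} (hr : 0 < r) {b : Ω → ℂ} (hb : Bd1 b) : Lower r (fun _ => b) := by
  obtain ⟨r, rfl⟩ := Nat.exists_eq_succ_of_ne_zero hr.ne'
  exact ⟨fun _ => hb, fun _ => b, fun _ _ => 1, fun _ => hb, fun _ _ => by simp,
    fun _ => Lower.one r⟩

theorem cube_bd {A : List ℤ → Ω → ℂ} (hA : ∀ s, Bd1 (A s)) (ps : List (ℤ × ℤ)) :
    Bd1 (cube ps A) := by
  induction ps generalizing A with
  | nil => exact hA []
  | cons q t ih => exact ih fun s => (hA _).mul (hA _).star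

theorem cube_mul (A B : List ℤ → Ω → ℂ) (ps : List (ℤ × ℤ)) :
    cube ps (fun s => A s * B s) = cube ps A * cube ps B := by
  induction ps generalizing A B with
  | nil => rfl
  | cons q t ih =>
    simp only [cube]
    rw [← ih]
    congr 1
    ext s x
    simp only [Pi.mul_apply, Pi.star_apply, star_mul']
    ring

theorem box_inequality (Ls : List Mean) (M : St Ω) {A B : List ℤ → Ω → ℂ}
    (hA : ∀ s, Bd1 (A s)) (hB : Lower Ls.length B) :
    (IM Ls).R (fun s => ‖M.C (A s * B s)‖) ^ 2 ^ Ls.length ≤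
      (IM₂ Ls).R (fun ps => ‖M.C (cube ps A)‖) := by
  induction Ls generalizing A B with
  | nil => simp [IM_nil, IM₂_nil, cube, hB.2]
  | cons Λ Ls ih =>
    obtain ⟨hB0, b, B', hb, hBb, hB'⟩ := hB
    choose c hc hc' using fun s => exists_unit_mul (M.C (A s * B s))
    let N := (IM Ls).prod M
    let a (h : ℤ) (q : List ℤ × Ω) : ℂ := c (h :: q.1) * (A (h :: q.1) * B' h q.1) q.2
    have ha : ∀ h, Bd1 (a h) := fun h q => by
      simp only [a, norm_mul, hc, one_mul]
      exact ((hA _).mul ((hB' h).bd _)) q.2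
    have hle : ∀ s, ‖M.C (A s * B s)‖ ≤ 1 := fun s => M.norm_C_le_one ((hA s).mul (hB0 s))
    let y (q : ℤ × ℤ) : ℝ := (IM Ls).R (fun t => ‖M.C ((A (q.2 :: t) * star (A (q.1 :: t))) *
      (B' q.2 t * star (B' q.1 t)))‖)
    have hy1 (q : ℤ × ℤ) (t : List ℤ) : ‖M.C ((A (q.2 :: t) * star (A (q.1 :: t))) *
        (B' q.2 t * star (B' q.1 t)))‖ ≤ 1 :=
      M.norm_C_le_one (((hA _).mul (hA _).star).mul (((hB' _).bd _).mul ((hB' _).bd _).star))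
    have hy0 (q : ℤ × ℤ) : 0 ≤ y q :=
      (IM Ls).pos' _ (Bd.of_le (fun _ => norm_nonneg _) (hy1 q)) fun _ => norm_nonneg _
    have hyb : Bd y := Bd.of_le hy0 fun q =>
      (IM Ls).R_le (Bd.of_le (fun _ => norm_nonneg _) (hy1 q)) (hy1 q)
    have hsq : (IM (Λ :: Ls)).R (fun s => ‖M.C (A s * B s)‖) ^ 2 ≤ (Λ.toSt.prod Λ.toSt).R y := by
      have e1 : (((IM (Λ :: Ls)).R (fun s => ‖M.C (A s * B s)‖) : ℝ) : ℂ)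
          = Λ.C (fun h => N.C ((fun q : List ℤ × Ω => b q.1 q.2) * a h)) := by
        rw [← St.C_ofReal]
        change Λ.C (fun h => (IM Ls).C (fun t => ((‖M.C (A (h :: t) * B (h :: t))‖ : ℝ) : ℂ))) = _
        congr 1
        ext h
        rw [St.prod_C]
        congr 1
        ext t
        rw [← hc', ← M.C_mul]
        congr 1
        ext x
        simp only [hBb, Pi.mul_apply, a]
        ring
      have h1 := weak_cauchy_schwarz Λ.toSt N (v := fun q : List ℤ × Ω => b q.1 q.2)
        (fun q => hb q.1 q.2) ha
      rw [← e1, Complex.norm_real, Real.norm_eq_abs, sq_abs] at h1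
      refine h1.trans ?_
      change (Λ.toSt.prod Λ.toSt).R (fun q => (N.C (a q.2 * star (a q.1))).re) ≤ _
      have hNb : ∀ q : ℤ × ℤ, ‖N.C (a q.2 * star (a q.1))‖ ≤ 1 := fun q =>
        N.norm_C_le_one ((ha _).mul (ha _).star)
      refine St.mono _ ⟨1, fun q => (Complex.abs_re_le_norm _).trans (hNb q)⟩ hyb fun q => ?_
      refine (Complex.re_le_norm _).trans ?_
      rw [St.prod_C]
      have e2 : ∀ t, ‖M.C (fun x => (a q.2 * star (a q.1)) (t, x))‖ =
          ‖M.C ((A (q.2 :: t) * star (A (q.1 :: t))) * (B' q.2 t * star (B' q.1 t)))‖ := by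
        intro t
        have : M.C (fun x => (a q.2 * star (a q.1)) (t, x)) =
            (c (q.2 :: t) * star (c (q.1 :: t))) *
            M.C ((A (q.2 :: t) * star (A (q.1 :: t))) * (B' q.2 t * star (B' q.1 t))) := by
          rw [← M.C_mul]
          congr 1
          ext x
          simp only [a, Pi.mul_apply, Pi.star_apply, star_mul']
          ring
        rw [this, norm_mul, norm_mul, norm_star, hc, hc, one_mul, one_mul]
      refine ((IM Ls).norm_C_le_R ?_).trans (le_of_eq ?_)
      · simp_rw [e2]
        exact Bd.of_le (fun _ => norm_nonneg _) (hy1 q)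
      · simp_rw [e2]
        rfl
    rw [List.length_cons, pow_succ', pow_mul]
    refine (pow_le_pow_left₀ (sq_nonneg _) hsq _).trans ?_
    refine (St.pow_R_le _ hyb hy0 _).trans ?_
    have hz (q : ℤ × ℤ) (t : List (ℤ × ℤ)) : |‖M.C (cube (q :: t) A)‖| ≤ 1 := by
      rw [abs_norm]
      exact M.norm_C_le_one (cube_bd hA _)
    refine St.mono _ (hyb.pow _) (St.bd_R (IM₂ Ls) (φ := fun (q : ℤ × ℤ) t =>
      ‖M.C (cube (q :: t) A)‖) hz) fun q => ?_
    exact ih (A := fun t => A (q.2 :: t) * star (A (q.1 :: t)))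
      (fun s => (hA _).mul (hA _).star) ((hB' q.2).mul (hB' q.1).star)

/-- Selections: maps sending a list of integers to a list of pairs in such a way that the first
entry of each pair only depends on the previous variables. -/
def Sel : ℕ → (List ℤ → List (ℤ × ℤ)) → Prop
  | 0, π => π [] = []
  | r + 1, π => ∃ (k : ℤ) (π' : ℤ → List ℤ → List (ℤ × ℤ)),
      (∀ h s, π (h :: s) = (k, h) :: π' h s) ∧ ∀ h, Sel r (π' h)

theorem exists_sel (Ls : List Mean) {Φ : List (ℤ × ℤ) → ℝ} (hΦ : Bd Φ) (h0 : ∀ ps, 0 ≤ Φ ps) :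
    ∃ π, Sel Ls.length π ∧
      (1 / 2) ^ Ls.length * (IM₂ Ls).R Φ ≤ (IM Ls).R (fun s => Φ (π s)) := by
  induction Ls generalizing Φ with
  | nil => exact ⟨fun _ => [], rfl, by simp [IM_nil, IM₂_nil]⟩
  | cons Λ Ls ih =>
    obtain ⟨C, hC⟩ := id hΦ
    let z (k h : ℤ) : ℝ := (IM₂ Ls).R (fun t => Φ ((k, h) :: t))
    have hz0 (k h : ℤ) : 0 ≤ z k h := (IM₂ Ls).pos' _ (hΦ.comp _) fun _ => h0 _
    have hzC (k h : ℤ) : |z k h| ≤ C := by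
      rw [abs_of_nonneg (hz0 k h)]
      exact (IM₂ Ls).R_le (hΦ.comp _) fun t => (le_abs_self _).trans (hC _)
    let y (k : ℤ) : ℝ := Λ.R (z k)
    have hyb : Bd y := St.bd_R _ hzC
    obtain ⟨k, hk⟩ : ∃ k, Λ.R y / 2 ≤ y k := by
      by_contra! hcon
      have h1 := Λ.R_le hyb fun k => (hcon k).le
      have h2 := hcon 0
      have h3 : 0 ≤ y 0 := Λ.pos' _ ⟨C, hzC 0⟩ (hz0 0)
      linarith
    choose π hπ hle using fun h : ℤ => ih (Φ := fun t => Φ ((k, h) :: t)) (hΦ.comp _) fun _ => h0 _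
    refine ⟨fun s => match s with
      | [] => []
      | h :: s => (k, h) :: π h s, ⟨k, π, fun _ _ => rfl, hπ⟩, ?_⟩
    rw [IM_cons]
    have e : (IM₂ (Λ :: Ls)).R Φ = Λ.R y := rfl
    rw [e]
    have h1 : (1 / 2) ^ (Λ :: Ls).length * Λ.R y ≤ (1 / 2) ^ Ls.length * y k := by
      rw [List.length_cons, pow_succ, mul_assoc]
      refine mul_le_mul_of_nonneg_left ?_ (by positivity)
      linarith
    refine h1.trans ?_
    rw [← Λ.R_mul]
    refine Λ.mono ((Bd.const _).mul ⟨C, hzC k⟩) ?_ hle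
    exact St.bd_R (IM Ls) (φ := fun h s => Φ ((k, h) :: π h s)) fun _ _ => hC _

theorem cube_sel {r : ℕ} {π : List ℤ → List (ℤ × ℤ)} (hπ : Sel r π) {A : List ℤ → Ω → ℂ}
    (hA : ∀ s, Bd1 (A s)) :
    ∃ B, Lower r B ∧ ∀ s, s.length = r → cube (π s) A = A s * B s := by
  induction r generalizing π A with
  | zero =>
    refine ⟨fun _ => 1, ⟨fun _ => Bd1.one, rfl⟩, fun s hs => ?_⟩
    rw [List.length_eq_zero_iff.1 hs, show π [] = [] from hπ]
    simp [cube]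
  | succ r ih =>
    obtain ⟨k, π', hπ', hsel⟩ := hπ
    choose B hB hBe using fun h : ℤ => ih (hsel h) (A := fun s => A (h :: s)) fun _ => hA _
    choose D hD hDe using fun h : ℤ => ih (hsel h) (A := fun s => star (A (k :: s)))
      fun _ => (hA _).star
    refine ⟨fun s => match s with
      | [] => 1
      | h :: s => star (A (k :: s)) * (B h s * D h s), ⟨fun s => ?_, fun s => star (A (k :: s)),
        fun h s => B h s * D h s, fun s => (hA _).star, fun h s => rfl,
        fun h => (hB h).mul (hD h)⟩, fun s hs => ?_⟩
    · cases s with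
      | nil => exact Bd1.one
      | cons h s => exact (hA _).star.mul (((hB h).bd s).mul ((hD h).bd s))
    · cases s with
      | nil => simp at hs
      | cons h s =>
        simp only [List.length_cons, Nat.add_right_cancel_iff] at hs
        rw [hπ', cube, cube_mul, hBe h s hs, hDe h s hs]
        ring

end Box

/-! ### Invariant states, multiplicative derivatives -/

/-- An invertible map together with an invariant state on bounded functions. -/
structure Dyn (X : Type) where
  /-- the state -/
  E : St X
  /-- the transformation -/
  T : Equiv.Perm X
  inv1 : ∀ φ : X → ℝ, Bd φ → E.R (fun x => φ (T x)) = E.R φ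

section Shift
variable {X : Type} (T : Equiv.Perm X)

/-- The function `u ∘ T ^ k`. -/
def sh (k : ℤ) (u : X → ℂ) : X → ℂ := fun x => u ((T ^ k) x)

@[simp] theorem sh_zero (u : X → ℂ) : sh T 0 u = u := rfl

theorem sh_sh (k l : ℤ) (u : X → ℂ) : sh T k (sh T l u) = sh T (k + l) u := by
  ext x
  simp only [sh]
  rw [← Equiv.Perm.mul_apply, ← zpow_add, add_comm]

@[simp] theorem sh_mul (k : ℤ) (u v : X → ℂ) : sh T k (u * v) = sh T k u * sh T k v := rfl
@[simp] theorem sh_star (k : ℤ) (u : X → ℂ) : sh T k (star u) = star (sh T k u) := rfl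
@[simp] theorem sh_one (k : ℤ) : sh T k (1 : X → ℂ) = 1 := rfl
variable {T} in
theorem Bd1.sh {u : X → ℂ} (h : Bd1 u) (k : ℤ) : Bd1 (sh T k u) := fun _ => h _

theorem sh_list_prod (k : ℤ) (L : List (X → ℂ)) : sh T k L.prod = (L.map (sh T k)).prod := by
  induction L with
  | nil => rfl
  | cons a L ih => simp [ih]

/-- Iterated multiplicative derivative. -/
def Δ : List ℤ → (X → ℂ) → X → ℂ
  | [], f => f
  | h :: t, f => Δ t (sh T h f * star f)

theorem Δ_mul (s : List ℤ) (f g : X → ℂ) : Δ T s (f * g) = Δ T s f * Δ T s g := by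
  induction s generalizing f g with
  | nil => rfl
  | cons h t ih =>
    simp only [Δ]
    rw [← ih]
    congr 1
    simp only [sh_mul, star_mul']
    ring

theorem Δ_star (s : List ℤ) (f : X → ℂ) : Δ T s (star f) = star (Δ T s f) := by
  induction s generalizing f with
  | nil => rfl
  | cons h t ih =>
    simp only [Δ]
    rw [← ih]
    simp [mul_comm]

theorem Δ_sh (s : List ℤ) (k : ℤ) (f : X → ℂ) : Δ T s (sh T k f) = sh T k (Δ T s f) := by
  induction s generalizing f with
  | nil => rfl
  | cons h t ih =>
    simp only [Δ]
    rw [← ih]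
    simp [sh_sh, add_comm]

theorem Δ_append (s : List ℤ) (k : ℤ) (f : X → ℂ) :
    Δ T (s ++ [k]) f = sh T k (Δ T s f) * star (Δ T s f) := by
  induction s generalizing f with
  | nil => rfl
  | cons h t ih => exact ih _

variable {T} in
theorem Bd1.Δ {f : X → ℂ} (hf : Bd1 f) (s : List ℤ) : Bd1 (Δ T s f) := by
  induction s generalizing f with
  | nil => exact hf
  | cons h t ih => exact ih ((hf.sh h).mul hf.star)

theorem measurable_star_comp {Y : Type*} [MeasurableSpace Y] {f : Y → ℂ} (hf : Measurable f) :
    Measurable (star f) := (continuous_star (R := ℂ)).measurable.comp hf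

theorem measurable_sh [MeasurableSpace X] {T : Equiv.Perm X} (hT : ∀ k : ℤ, Measurable ⇑(T ^ k))
    {f : X → ℂ} (hf : Measurable f) (k : ℤ) : Measurable (sh T k f) := hf.comp (hT k)

theorem measurable_Δ [MeasurableSpace X] {T : Equiv.Perm X} (hT : ∀ k : ℤ, Measurable ⇑(T ^ k))
    {f : X → ℂ} (hf : Measurable f) (s : List ℤ) : Measurable (Δ T s f) := by
  induction s generalizing f with
  | nil => exact hf
  | cons h t ih => exact ih ((measurable_sh hT hf h).mul (measurable_star_comp hf))

theorem exists_lower_Δ [MeasurableSpace X] (hT : ∀ k : ℤ, Measurable ⇑(T ^ k)) (r : ℕ)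
    {f : X → ℂ} (hf : Bd1 f) (hfm : Measurable f) :
    ∃ B, Lower r B ∧ (∀ s, Measurable (B s)) ∧
      ∀ s, s.length = r → Δ T s f = sh T s.sum f * B s := by
  induction r generalizing f with
  | zero =>
    refine ⟨fun _ => 1, Lower.one 0, fun _ => measurable_one, fun s hs => ?_⟩
    rw [List.length_eq_zero_iff.1 hs]
    simp [Δ]
  | succ r ih =>
    choose B hB hBm hBe using fun h : ℤ => ih (hf.sh (T := T) h) (measurable_sh hT hfm h)
    refine ⟨fun s => match s with
      | [] => 1
      | h :: t => PolyAvg.Δ T t (star f) * B h t, ⟨fun s => ?_, fun t => PolyAvg.Δ T t (star f), B,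
        fun t => hf.star.Δ t, fun _ _ => rfl, hB⟩, fun s => ?_, fun s hs => ?_⟩
    · cases s with
      | nil => exact Bd1.one
      | cons h t => exact (hf.star.Δ t).mul ((hB h).bd t)
    · cases s with
      | nil => exact measurable_one
      | cons h t => exact (measurable_Δ hT (measurable_star_comp hfm) t).mul (hBm h t)
    · cases s with
      | nil => simp at hs
      | cons h t =>
        simp only [List.length_cons, Nat.add_right_cancel_iff] at hs
        simp only [PolyAvg.Δ]
        rw [Δ_mul, hBe h t hs, sh_sh, List.sum_cons, add_comm h]
        ring

end Shift

namespace Dyn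
variable {X : Type} (D : Dyn X)

theorem inv {φ : X → ℝ} (hφ : Bd φ) (k : ℤ) : D.E.R (fun x => φ ((D.T ^ k) x)) = D.E.R φ := by
  induction k using Int.induction_on with
  | zero => simp
  | succ k ih =>
    rw [← ih, ← D.inv1 (fun x => φ ((D.T ^ (k : ℤ)) x)) (hφ.comp _)]
    congr 1
  | pred k ih =>
    rw [← ih, ← D.inv1 (fun x => φ ((D.T ^ (-(k : ℤ) - 1)) x)) (hφ.comp _)]
    congr 1
    ext x
    rw [← Equiv.Perm.mul_apply, ← zpow_add_one, sub_add_cancel]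

theorem C_sh {u : X → ℂ} (hu : Bd1 u) (k : ℤ) : D.E.C (sh D.T k u) = D.E.C u := by
  have h1 : Bd (fun x => (u x).re) := St.bd_re hu.norm
  have h2 : Bd (fun x => (u x).im) := ⟨1, fun x => (Complex.abs_im_le_norm _).trans (hu x)⟩
  apply Complex.ext
  · rw [St.C_re, St.C_re]
    exact D.inv h1 k
  · rw [St.C_im, St.C_im]
    exact D.inv h2 k

/-- Averages of squares of correlations of multiplicative derivatives. -/
noncomputable def V (Ls : List Mean) (F : X → ℂ) : ℝ :=
  (IM Ls).R fun s => ‖D.E.C (Δ D.T s F)‖ ^ 2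

/-! ### Linear families -/

theorem exists_linear (cs : List ℤ) (hcs : ∀ b ∈ cs, b ≠ 0) :
    ∃ Ls : List Mean, Ls.length = cs.length ∧ ∃ P : ℝ, 0 < P ∧
    ∀ (X : Type) (D : Dyn X) (Λ : Mean) (c : ℤ) (f : X → ℂ) (S : List (ℤ × (X → ℂ))), Bd1 f →
    (∀ a ∈ S, Bd1 a.2) → S.map (fun a => c - a.1) = cs →
    ‖Λ.C (fun n => D.E.C (sh D.T (c * n) f * (S.map fun a => sh D.T (a.1 * n) a.2).prod))‖
      ^ 2 ^ cs.length ≤ P * (IM Ls).R fun s => ‖D.E.C (Δ D.T s f)‖ := by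
  induction cs with
  | nil =>
    refine ⟨[], rfl, 1, one_pos, fun X D Λ c f S hf _ hS => ?_⟩
    rw [List.map_eq_nil_iff.1 hS]
    simp [D.C_sh hf, St.C_const, IM_nil, Δ]
  | cons b cs ih =>
    obtain ⟨Ls, hlen, P, hP, hmain⟩ := ih fun a ha => hcs a (List.mem_cons_of_mem _ ha)
    obtain ⟨ΛF, hΛF⟩ := exists_fejer
    obtain ⟨Λ', hΛ'⟩ := ΛF.exists_dilate b (hcs b List.mem_cons_self)
    have hb : (0 : ℝ) < |(b : ℝ)| := abs_pos.2 (by exact_mod_cast hcs b List.mem_cons_self)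
    refine ⟨Λ' :: Ls, by simp [hlen], P * |(b : ℝ)|, by positivity,
      fun X D Λ c f S hf hS hScs => ?_⟩
    obtain ⟨a, S', rfl, hab, hS'⟩ : ∃ a S', S = a :: S' ∧ c - a.1 = b ∧
        S'.map (fun a => c - a.1) = cs := by
      cases S with
      | nil => simp at hScs
      | cons a S' => exact ⟨a, S', rfl, by simpa using hScs⟩
    have ha1 : Bd1 a.2 := hS a List.mem_cons_self
    have hS1 : ∀ a ∈ S', Bd1 a.2 := fun a ha => hS a (List.mem_cons_of_mem _ ha)
    have hprod : ∀ (L : List (ℤ × (X → ℂ))) (n : ℤ), (∀ a ∈ L, Bd1 a.2) →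
        Bd1 (L.map fun a => sh D.T (a.1 * n) a.2).prod := by
      intro L n hL
      induction L with
      | nil => exact Bd1.one
      | cons a L ih =>
        rw [List.map_cons, List.prod_cons]
        exact ((hL a List.mem_cons_self).sh _).mul
          (ih fun a ha => hL a (List.mem_cons_of_mem _ ha))
    let S₁ : List (ℤ × (X → ℂ)) := S'.map fun d => (d.1 - a.1, d.2)
    have hS₁ : ∀ a ∈ S₁, Bd1 a.2 := by
      intro d hd
      obtain ⟨d', hd', rfl⟩ := List.mem_map.1 hd
      exact hS1 d' hd'
    let u (n : ℤ) : X → ℂ := sh D.T (b * n) f * (S₁.map fun d => sh D.T (d.1 * n) d.2).prod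
    have hu : ∀ n, Bd1 (u n) := fun n => (hf.sh _).mul (hprod _ _ hS₁)
    have e1 : (fun n => D.E.C (sh D.T (c * n) f *
        ((a :: S').map fun a => sh D.T (a.1 * n) a.2).prod)) = fun n => D.E.C (a.2 * u n) := by
      ext n
      rw [← D.C_sh (ha1.mul (hu n)) (a.1 * n)]
      congr 1
      simp only [u, S₁, sh_mul, sh_sh, sh_list_prod, List.map_map, List.map_cons, List.prod_cons]
      have e2 : a.1 * n + b * n = c * n := by rw [← hab]; ring
      have e3 : (sh D.T (a.1 * n) ∘ (fun d => sh D.T (d.1 * n) d.2) ∘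
          fun d : ℤ × (X → ℂ) => (d.1 - a.1, d.2)) = fun d => sh D.T (d.1 * n) d.2 := by
        ext d x
        simp only [Function.comp_apply, sh_sh]
        congr 2
        ring
      rw [e2, e3]
      ring
    rw [e1]
    have hcorr (h : ℤ) : ‖corr Λ D.E u h‖ ^ 2 ^ cs.length ≤
        P * (IM Ls).R fun s => ‖D.E.C (Δ D.T s (sh D.T (b * h) f * star f))‖ := by
      let S₂ : List (ℤ × (X → ℂ)) := S₁.map fun d => (d.1, sh D.T (d.1 * h) d.2 * star d.2)
      have h1 := hmain X D Λ b (sh D.T (b * h) f * star f) S₂ ((hf.sh _).mul hf.star) (by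
        intro d hd
        obtain ⟨d', hd', rfl⟩ := List.mem_map.1 hd
        exact ((hS₁ d' hd').sh _).mul (hS₁ d' hd').star) (by
        rw [← hS', ← hab]
        simp [S₂, S₁])
      refine le_trans (le_of_eq ?_) h1
      congr 2
      simp only [corr]
      congr 1
      ext n
      congr 1
      simp only [u, S₂, List.map_map, star_mul', sh_mul, sh_sh, sh_star, mul_add]
      have e4 (L : List (ℤ × (X → ℂ))) : (L.map fun d => sh D.T (d.1 * n + d.1 * h) d.2).prod *
          star (L.map fun d => sh D.T (d.1 * n) d.2).prod = (L.map ((fun d => sh D.T (d.1 * n) d.2) ∘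
            fun d : ℤ × (X → ℂ) => (d.1, sh D.T (d.1 * h) d.2 * star d.2))).prod := by
        induction L with
        | nil => simp
        | cons d L ih =>
          simp only [List.map_cons, List.prod_cons, star_mul', Function.comp_apply, sh_mul, sh_sh,
            sh_star, ← ih]
          ring
      rw [← e4]
      ring
    have hcb : Bd fun h => ‖corr Λ D.E u h‖ :=
      Bd.of_le (fun _ => norm_nonneg _) fun h => norm_corr_le hu h
    have hre : Bd fun h => (corr Λ D.E u h).re := St.bd_re hcb
    have hvdc : ‖Λ.C (fun n => D.E.C (a.2 * u n))‖ ^ 2 ≤ ΛF.R fun h => ‖corr Λ D.E u h‖ :=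
      (hΛF _ hre _ fun H hH => vdc_finite ha1 hu hH).trans
        (ΛF.mono hre hcb fun h => Complex.re_le_norm _)
    have hz1 (g : X → ℂ) (hg : Bd1 g) (s : List ℤ) : ‖D.E.C (Δ D.T s g)‖ ≤ 1 :=
      D.E.norm_C_le_one (hg.Δ s)
    let y (k : ℤ) : ℝ := (IM Ls).R fun s => ‖D.E.C (Δ D.T s (sh D.T k f * star f))‖
    have hk (k : ℤ) : Bd1 (sh D.T k f * star f) := (hf.sh k).mul hf.star
    have hy0 (k : ℤ) : 0 ≤ y k :=
      (IM Ls).pos' _ (Bd.of_le (fun _ => norm_nonneg _) (hz1 _ (hk k))) fun _ => norm_nonneg _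
    have hyb : Bd y := Bd.of_le hy0 fun k =>
      (IM Ls).R_le (Bd.of_le (fun _ => norm_nonneg _) (hz1 _ (hk k))) (hz1 _ (hk k))
    rw [List.length_cons, pow_succ', pow_mul]
    calc (‖Λ.C (fun n => D.E.C (a.2 * u n))‖ ^ 2) ^ 2 ^ cs.length
        ≤ (ΛF.R fun h => ‖corr Λ D.E u h‖) ^ 2 ^ cs.length :=
          pow_le_pow_left₀ (sq_nonneg _) hvdc _
      _ ≤ ΛF.R fun h => ‖corr Λ D.E u h‖ ^ 2 ^ cs.length :=
          ΛF.pow_R_le hcb (fun _ => norm_nonneg _) _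
      _ ≤ ΛF.R fun h => P * y (b * h) :=
          ΛF.mono (hcb.pow _) ((Bd.const P).mul (hyb.comp _)) hcorr
      _ = P * ΛF.R fun h => y (b * h) := ΛF.R_mul _ _
      _ ≤ P * (|(b : ℝ)| * Λ'.R y) := by
          have := hΛ' y hyb hy0
          push_cast at this
          exact mul_le_mul_of_nonneg_left this hP.le
      _ = P * |(b : ℝ)| * (IM (Λ' :: Ls)).R fun s => ‖D.E.C (Δ D.T s f)‖ := by
          rw [IM_cons, mul_assoc]
          rfl

end Dyn

/-! ### Polynomial families -/

section Poly
open Polynomial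

theorem natDegree_taylor_sub_self {p : ℤ[X]} (hp : 1 ≤ p.natDegree) {h : ℤ} (hh : h ≠ 0) :
    (taylor h p - p).natDegree = p.natDegree - 1 := by
  obtain ⟨d, hd⟩ : ∃ d, p.natDegree = d + 1 := ⟨p.natDegree - 1, by omega⟩
  have hp0 : p ≠ 0 := by
    rintro rfl
    simp at hp
  refine natDegree_eq_of_le_of_coeff_ne_zero ?_ ?_
  · rw [natDegree_le_iff_coeff_eq_zero]
    intro N hN
    rcases eq_or_lt_of_le (show p.natDegree ≤ N by omega) with h1 | h1
    · rw [← h1, coeff_sub, coeff_taylor_natDegree, coeff_natDegree, sub_self]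
    · rw [coeff_sub, coeff_eq_zero_of_natDegree_lt h1,
        coeff_eq_zero_of_natDegree_lt (by rwa [natDegree_taylor]), sub_self]
  · rw [hd, Nat.add_sub_cancel, coeff_sub, taylor_coeff]
    have h1 : (hasseDeriv d p).natDegree ≤ 1 := (natDegree_hasseDeriv_le p d).trans (by omega)
    rw [eval_eq_sum_range' (Nat.lt_succ_of_le h1), Finset.sum_range_succ, Finset.sum_range_one,
      hasseDeriv_coeff, hasseDeriv_coeff]
    simp only [zero_add, pow_zero, mul_one, pow_one, Nat.choose_self, Nat.cast_one, one_mul,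
      add_sub_cancel_left]
    refine mul_ne_zero (mul_ne_zero ?_ ?_) hh
    · exact_mod_cast (Nat.choose_pos (by omega)).ne'
    · rw [add_comm 1 d, ← hd, coeff_natDegree]
      exact leadingCoeff_ne_zero.2 hp0

theorem natDegree_taylor_sub_taylor {p : ℤ[X]} (hp : 1 ≤ p.natDegree) {h h' : ℤ} (hh : h ≠ h') :
    (taylor h p - taylor h' p).natDegree = p.natDegree - 1 := by
  have : taylor h p - taylor h' p = taylor h' (taylor (h - h') p - p) := by
    rw [map_sub, taylor_taylor, add_sub_cancel]
  rw [this, natDegree_taylor, natDegree_taylor_sub_self hp (sub_ne_zero.2 hh)]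

theorem exists_bad {p : ℤ[X]} (hp : 2 ≤ p.natDegree) (S : List ℤ[X]) :
    ∃ bad : Finset ℤ, bad.card ≤ S.length + 1 ∧ ∀ h ∉ bad, h ≠ 0 ∧
      ∀ a ∈ S, 1 ≤ (taylor h p - a).natDegree := by
  classical
  induction S with
  | nil => exact ⟨{0}, by simp, by simp⟩
  | cons a S ih =>
    obtain ⟨bad, hc, hbad⟩ := ih
    by_cases hex : ∃ k, (taylor k p - a).natDegree = 0
    · obtain ⟨k, hk⟩ := hex
      refine ⟨insert k bad, (Finset.card_insert_le _ _).trans (by simpa using hc), fun h hh => ?_⟩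
      simp only [Finset.mem_insert, not_or] at hh
      refine ⟨(hbad h hh.2).1, ?_⟩
      rintro b (_ | ⟨_, hb⟩)
      · by_contra! hlt
        have h1 := natDegree_taylor_sub_taylor (by omega : 1 ≤ p.natDegree) hh.1
        have h2 := natDegree_sub_le (taylor h p - a) (taylor k p - a)
        rw [sub_sub_sub_cancel_right, h1, hk] at h2
        have := le_max_iff.1 h2
        omega
      · exact (hbad h hh.2).2 b hb
    · push Not at hex
      refine ⟨bad, hc.trans (by simp), fun h hh => ⟨(hbad h hh).1, ?_⟩⟩
      rintro b (_ | ⟨_, hb⟩)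
      · exact Nat.one_le_iff_ne_zero.2 (hex h)
      · exact (hbad h hh).2 b hb

/-- The leading coefficients of the members of degree `j` of a family. -/
noncomputable def lcs (j : ℕ) (Q : List ℤ[X]) : Finset ℤ :=
  ((Q.filter fun a => a.natDegree = j).map leadingCoeff).toFinset

theorem mem_lcs {j : ℕ} {Q : List ℤ[X]} {l : ℤ} :
    l ∈ lcs j Q ↔ ∃ a ∈ Q, a.natDegree = j ∧ a.leadingCoeff = l := by
  simp [lcs, and_assoc]

theorem sub_of_natDegree_lt {a q : ℤ[X]} (h : q.natDegree < a.natDegree) :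
    (a - q).natDegree = a.natDegree ∧ (a - q).leadingCoeff = a.leadingCoeff := by
  have h1 := natDegree_sub_eq_left_of_natDegree_lt h
  refine ⟨h1, ?_⟩
  rw [leadingCoeff, h1, coeff_sub, coeff_eq_zero_of_natDegree_lt h, sub_zero, leadingCoeff]

theorem natDegree_sub_le_of_eq {a q : ℤ[X]} (h : a.natDegree = q.natDegree) :
    (a - q).natDegree ≤ q.natDegree := by
  simpa [h] using natDegree_sub_le a q

theorem leadingCoeff_sub_of_natDegree_eq {a q : ℤ[X]} (h : a.natDegree = q.natDegree)
    (h' : (a - q).natDegree = q.natDegree) :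
    (a - q).leadingCoeff = a.leadingCoeff - q.leadingCoeff := by
  simp only [leadingCoeff, h', coeff_sub, h]

/-- The nonconstant members of a family. -/
noncomputable def nonconst (S : List ℤ[X]) : List ℤ[X] := S.filter fun a => 1 ≤ a.natDegree

theorem mem_nonconst {S : List ℤ[X]} {a : ℤ[X]} :
    a ∈ nonconst S ↔ a ∈ S ∧ 1 ≤ a.natDegree := by
  simp [nonconst]

/-- The family obtained from one differencing step. -/
noncomputable def diffFam (p q : ℤ[X]) (S : List ℤ[X]) (h : ℤ) : List ℤ[X] :=
  (p - q) :: ((nonconst S).map (fun a => taylor h a - q) ++ (nonconst S).map fun a => a - q)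

theorem mem_diffFam {p q : ℤ[X]} {S : List ℤ[X]} {h : ℤ} {b : ℤ[X]} :
    b ∈ diffFam p q S h ↔ b = p - q ∨ (∃ a ∈ nonconst S, taylor h a - q = b) ∨
      ∃ a ∈ nonconst S, a - q = b := by
  simp [diffFam]

/-- The tracked polynomial has maximal positive degree and differs from all others. -/
structure Good (p : ℤ[X]) (S : List ℤ[X]) : Prop where
  one_le : 1 ≤ p.natDegree
  max : ∀ a ∈ S, a.natDegree ≤ p.natDegree
  ne : ∀ a ∈ S, 1 ≤ (p - a).natDegree

theorem exists_pivot {p : ℤ[X]} {S : List ℤ[X]} (hg : Good p S) :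
    ∃ q ∈ p :: nonconst S, (∀ a ∈ p :: nonconst S, q.natDegree ≤ a.natDegree) ∧
      (q.natDegree = p.natDegree → q.leadingCoeff = p.leadingCoeff →
        q = p ∧ ∀ a ∈ nonconst S, a.leadingCoeff = p.leadingCoeff) := by
  classical
  obtain ⟨q, hq, hmin⟩ := (p :: nonconst S).toFinset.exists_min_image natDegree
    ⟨p, by simp⟩
  simp only [List.mem_toFinset] at hq hmin
  rcases lt_or_ge q.natDegree p.natDegree with hlt | hge
  · exact ⟨q, hq, hmin, fun h => absurd h hlt.ne⟩
  · by_cases hex : ∃ a ∈ nonconst S, a.leadingCoeff ≠ p.leadingCoeff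
    · obtain ⟨a, ha, hne⟩ := hex
      refine ⟨a, List.mem_cons_of_mem _ ha, fun b hb => ?_, fun _ h => absurd h hne⟩
      exact ((hg.max a (mem_nonconst.1 ha).1).trans hge).trans (hmin b hb)
    · push Not at hex
      exact ⟨p, List.mem_cons_self, fun b hb => hge.trans (hmin b hb),
        fun _ _ => ⟨rfl, hex⟩⟩

theorem Good.diffFam {p q : ℤ[X]} {S : List ℤ[X]} (hg : Good p S) (hp : 2 ≤ p.natDegree)
    (hq : q ∈ p :: nonconst S)
    (hqmin : ∀ a ∈ p :: nonconst S, q.natDegree ≤ a.natDegree)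
    (hqp : q.natDegree = p.natDegree → q.leadingCoeff = p.leadingCoeff →
        q = p ∧ ∀ a ∈ nonconst S, a.leadingCoeff = p.leadingCoeff)
    {h : ℤ} (h0 : h ≠ 0) (hbad : ∀ a ∈ S, 1 ≤ (taylor h p - a).natDegree) :
    Good (taylor h p - q) (diffFam p q S h) := by
  have hqle : q.natDegree ≤ p.natDegree := hqmin p List.mem_cons_self
  have hle : ∀ a b : ℤ[X], a.natDegree ≤ p.natDegree → b.natDegree ≤ p.natDegree →
      (a - b).natDegree ≤ p.natDegree := fun a b ha hb =>
    (natDegree_sub_le a b).trans (max_le ha hb)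
  have hmaxS : ∀ a ∈ nonconst S, a.natDegree ≤ p.natDegree := fun a ha =>
    hg.max a (mem_nonconst.1 ha).1
  have hdeg : (1 ≤ (taylor h p - q).natDegree) ∧
      ∀ b ∈ PolyAvg.diffFam p q S h, b.natDegree ≤ (taylor h p - q).natDegree := by
    by_cases hcase : q.natDegree = p.natDegree ∧ q.leadingCoeff = p.leadingCoeff
    · obtain ⟨rfl, hlc⟩ := hqp hcase.1 hcase.2
      have key : ∀ a : ℤ[X], a.natDegree = q.natDegree → a.leadingCoeff = q.leadingCoeff →
          (a - q).natDegree ≤ q.natDegree - 1 := by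
        intro a h1 h2
        have h3 := natDegree_sub_le_of_eq h1
        by_contra! hcon
        have h4 : (a - q).natDegree = q.natDegree := by omega
        have h5 := leadingCoeff_sub_of_natDegree_eq h1 h4
        rw [h2, sub_self, leadingCoeff_eq_zero] at h5
        rw [h5, natDegree_zero] at h4
        omega
      rw [natDegree_taylor_sub_self hg.one_le h0]
      refine ⟨by omega, fun b hb => ?_⟩
      rcases mem_diffFam.1 hb with rfl | ⟨a, ha, rfl⟩ | ⟨a, ha, rfl⟩
      · simp
      · refine key _ ?_ ?_
        · rw [natDegree_taylor]
          exact (hmaxS a ha).antisymm (hqmin a (List.mem_cons_of_mem _ ha))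
        · rw [leadingCoeff_taylor, hlc a ha]
      · exact key _ ((hmaxS a ha).antisymm (hqmin a (List.mem_cons_of_mem _ ha))) (hlc a ha)
    · have h1 : (taylor h p - q).natDegree = p.natDegree := by
        rcases hqle.lt_or_eq with hlt | heq
        · rw [(sub_of_natDegree_lt (by rwa [natDegree_taylor])).1, natDegree_taylor]
        · refine natDegree_eq_of_le_of_coeff_ne_zero (hle _ _ (natDegree_taylor p h).le hqle) ?_
          rw [coeff_sub, coeff_taylor_natDegree, ← heq, coeff_natDegree]
          exact sub_ne_zero.2 fun h => hcase ⟨heq, h.symm⟩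
      rw [h1]
      refine ⟨by omega, fun b hb => ?_⟩
      rcases mem_diffFam.1 hb with rfl | ⟨a, ha, rfl⟩ | ⟨a, ha, rfl⟩
      · exact hle _ _ le_rfl hqle
      · exact hle _ _ (by rw [natDegree_taylor]; exact hmaxS a ha) hqle
      · exact hle _ _ (hmaxS a ha) hqle
  refine ⟨hdeg.1, hdeg.2, fun b hb => ?_⟩
  rcases mem_diffFam.1 hb with rfl | ⟨a, ha, rfl⟩ | ⟨a, ha, rfl⟩
  · rw [sub_sub_sub_cancel_right, natDegree_taylor_sub_self hg.one_le h0]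
    omega
  · rw [sub_sub_sub_cancel_right, ← map_sub, natDegree_taylor]
    exact hg.ne a (mem_nonconst.1 ha).1
  · rw [sub_sub_sub_cancel_right]
    exact hbad a (mem_nonconst.1 ha).1

/-- The type of a family: the number of leading coefficients in each positive degree. -/
noncomputable def ftype (d : ℕ) (Q : List ℤ[X]) (i : Fin d) : ℕ := (lcs (i + 1) Q).card

theorem ftype_diffFam_lt {d : ℕ} {p q : ℤ[X]} {S : List ℤ[X]} (hg : Good p S)
    (hd : p.natDegree ≤ d) (hq : q ∈ p :: nonconst S)
    (hqmin : ∀ a ∈ p :: nonconst S, q.natDegree ≤ a.natDegree) (h : ℤ) :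
    Pi.Lex (· > ·) (· < ·) (ftype d ((taylor h p - q) :: diffFam p q S h)) (ftype d (p :: S)) := by
  classical
  have hqle : q.natDegree ≤ p.natDegree := hqmin p List.mem_cons_self
  have hq1 : 1 ≤ q.natDegree := by
    rcases List.mem_cons.1 hq with rfl | hq
    · exact hg.one_le
    · exact (mem_nonconst.1 hq).2
  have hqS : q ∈ p :: S := by
    rcases List.mem_cons.1 hq with rfl | hq
    · exact List.mem_cons_self
    · exact List.mem_cons_of_mem _ (mem_nonconst.1 hq).1
  have hmem : ∀ b ∈ (taylor h p - q) :: diffFam p q S h, ∃ a ∈ p :: S, ∃ a' : ℤ[X],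
      q.natDegree ≤ a.natDegree ∧ a'.natDegree = a.natDegree ∧
        a'.leadingCoeff = a.leadingCoeff ∧ b = a' - q := by
    intro b hb
    have hS : ∀ a ∈ nonconst S, a ∈ p :: S := fun a ha =>
      List.mem_cons_of_mem _ (mem_nonconst.1 ha).1
    rcases List.mem_cons.1 hb with rfl | hb
    · exact ⟨p, List.mem_cons_self, _, hqle, natDegree_taylor _ _, leadingCoeff_taylor _ _, rfl⟩
    · rcases mem_diffFam.1 hb with rfl | ⟨a, ha, rfl⟩ | ⟨a, ha, rfl⟩
      · exact ⟨p, List.mem_cons_self, _, hqle, rfl, rfl, rfl⟩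
      · exact ⟨a, hS a ha, _, hqmin a (List.mem_cons_of_mem _ ha), natDegree_taylor _ _,
          leadingCoeff_taylor _ _, rfl⟩
      · exact ⟨a, hS a ha, _, hqmin a (List.mem_cons_of_mem _ ha), rfl, rfl, rfl⟩
  refine ⟨⟨q.natDegree - 1, by omega⟩, fun j hj => ?_, ?_⟩
  · have hj : q.natDegree < j + 1 := by
      have : q.natDegree - 1 < j := hj
      omega
    simp only [ftype]
    congr 1
    ext l
    rw [mem_lcs, mem_lcs]
    constructor
    · rintro ⟨b, hb, hbj, rfl⟩
      obtain ⟨a, ha, a', hqa, h1, h2, rfl⟩ := hmem b hb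
      rcases hqa.lt_or_eq with hlt | heq
      · have h3 := sub_of_natDegree_lt (hlt.trans_eq h1.symm)
        exact ⟨a, ha, by rw [← hbj, h3.1, h1], by rw [h3.2, h2]⟩
      · have := natDegree_sub_le_of_eq (h1.trans heq.symm)
        omega
    · rintro ⟨a, ha, haj, rfl⟩
      have h3 := sub_of_natDegree_lt (show q.natDegree < a.natDegree by omega)
      refine ⟨a - q, List.mem_cons_of_mem _ ?_, by rw [h3.1, haj], h3.2⟩
      rw [mem_diffFam]
      rcases List.mem_cons.1 ha with rfl | ha
      · exact Or.inl rfl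
      · exact Or.inr (Or.inr ⟨a, mem_nonconst.2 ⟨ha, by omega⟩, rfl⟩)
  · simp only [ftype, Nat.sub_add_cancel hq1]
    have hsub : lcs q.natDegree ((taylor h p - q) :: diffFam p q S h) ⊆
        ((lcs q.natDegree (p :: S)).erase q.leadingCoeff).image (· - q.leadingCoeff) := by
      intro l hl
      obtain ⟨b, hb, hbj, rfl⟩ := mem_lcs.1 hl
      obtain ⟨a, ha, a', hqa, h1, h2, rfl⟩ := hmem b hb
      rcases hqa.lt_or_eq with hlt | heq
      · have h3 := sub_of_natDegree_lt (hlt.trans_eq h1.symm)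
        omega
      · have h3 := leadingCoeff_sub_of_natDegree_eq (h1.trans heq.symm) hbj
        rw [Finset.mem_image]
        refine ⟨a.leadingCoeff, Finset.mem_erase.2 ⟨fun hl => ?_, mem_lcs.2 ⟨a, ha, heq.symm, rfl⟩⟩,
          by rw [h3, h2]⟩
        rw [h2, hl, sub_self, leadingCoeff_eq_zero] at h3
        rw [h3, natDegree_zero] at hbj
        omega
    have hqm : q.leadingCoeff ∈ lcs q.natDegree (p :: S) := mem_lcs.2 ⟨q, hqS, rfl, rfl⟩
    calc _ ≤ _ := Finset.card_le_card hsub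
      _ ≤ _ := Finset.card_image_le
      _ < _ := Finset.card_erase_lt_of_mem hqm

end Poly

section PET
open Polynomial
variable {X : Type}

/-- The product of the functions `a.2 ∘ T ^ a.1(n)`. -/
noncomputable def fam (T : Equiv.Perm X) (L : List (ℤ[X] × (X → ℂ))) (n : ℤ) : X → ℂ :=
  (L.map fun a => sh T (a.1.eval n) a.2).prod

variable (T : Equiv.Perm X)

@[simp] theorem fam_nil (n : ℤ) : fam T [] n = 1 := rfl
@[simp] theorem fam_cons (a : ℤ[X] × (X → ℂ)) (L : List (ℤ[X] × (X → ℂ))) (n : ℤ) :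
    fam T (a :: L) n = sh T (a.1.eval n) a.2 * fam T L n := by
  simp [fam]
@[simp] theorem fam_append (L L' : List (ℤ[X] × (X → ℂ))) (n : ℤ) :
    fam T (L ++ L') n = fam T L n * fam T L' n := by
  simp [fam]

variable {T} in
theorem fam_bd {L : List (ℤ[X] × (X → ℂ))} (hL : ∀ a ∈ L, Bd1 a.2) (n : ℤ) :
    Bd1 (fam T L n) := by
  induction L with
  | nil => exact Bd1.one
  | cons a L ih =>
    rw [fam_cons]
    exact ((hL a List.mem_cons_self).sh _).mul (ih fun a ha => hL a (List.mem_cons_of_mem _ ha))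

theorem fam_sub (q : ℤ[X]) (L : List (ℤ[X] × (X → ℂ))) (n : ℤ) :
    sh T (q.eval n) (fam T (L.map fun a => (a.1 - q, a.2)) n) = fam T L n := by
  induction L with
  | nil => rfl
  | cons a L ih => simp [ih, sh_sh]

theorem fam_taylor (h : ℤ) (L : List (ℤ[X] × (X → ℂ))) (n : ℤ) :
    fam T (L.map fun a => (taylor h a.1, a.2)) n = fam T L (n + h) := by
  induction L with
  | nil => rfl
  | cons a L ih => simp [ih, taylor_eval]

theorem fam_star (L : List (ℤ[X] × (X → ℂ))) (n : ℤ) :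
    fam T (L.map fun a => (a.1, star a.2)) n = star (fam T L n) := by
  induction L with
  | nil => simp
  | cons a L ih => simp [ih]

theorem exists_fam_split {L : List (ℤ[X] × (X → ℂ))} (hL : ∀ a ∈ L, Bd1 a.2) :
    ∃ v : X → ℂ, Bd1 v ∧ ∀ n, fam T L n = v * fam T (L.filter fun a => 1 ≤ a.1.natDegree) n := by
  induction L with
  | nil => exact ⟨1, Bd1.one, by simp⟩
  | cons a L ih =>
    obtain ⟨v, hv, e⟩ := ih fun a ha => hL a (List.mem_cons_of_mem _ ha)
    by_cases ha : 1 ≤ a.1.natDegree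
    · refine ⟨v, hv, fun n => ?_⟩
      rw [List.filter_cons_of_pos (by simpa using ha), fam_cons, fam_cons, e]
      ring
    · refine ⟨sh T (a.1.eval 0) a.2 * v, ((hL a List.mem_cons_self).sh _).mul hv, fun n => ?_⟩
      have h0 : a.1.eval n = a.1.eval 0 := by
        rw [eq_C_of_natDegree_eq_zero (by omega : a.1.natDegree = 0)]
        simp
      rw [List.filter_cons_of_neg (by simpa using ha), fam_cons, e, h0]
      ring

/-- The averages of a polynomial family are controlled by the function attached to `p`. -/
def Ctrl (p : ℤ[X]) (S : List ℤ[X]) : Prop :=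
  ∀ δ : ℝ, 0 < δ → ∃ c : ℝ, 0 < c ∧ ∃ N : ℕ, ∀ (X : Type) (D : Dyn X) (Λ : Mean) (f : X → ℂ)
    (L : List (ℤ[X] × (X → ℂ))), Bd1 f → (∀ a ∈ L, Bd1 a.2) → L.map Prod.fst = S →
    δ ≤ ‖Λ.C fun n => D.E.C (sh D.T (p.eval n) f * fam D.T L n)‖ →
    ∃ Ls : List Mean, 1 ≤ Ls.length ∧ Ls.length ≤ N ∧ c ≤ D.V Ls f

theorem ctrl_of_natDegree_eq_one {p : ℤ[X]} {S : List ℤ[X]} (hg : Good p S)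
    (hp : p.natDegree = 1) : Ctrl p S := by
  intro δ hδ
  have hlin : ∀ a : ℤ[X], a.natDegree ≤ 1 → ∀ n, a.eval n = a.coeff 1 * n + a.coeff 0 := by
    intro a ha n
    conv_lhs => rw [eq_X_add_C_of_natDegree_le_one ha]
    simp
  have hp1 : p.coeff 1 ≠ 0 := by
    rw [← hp, coeff_natDegree, Ne, leadingCoeff_eq_zero]
    rintro rfl
    simp at hp
  let cs : List ℤ := p.coeff 1 :: S.map fun a => p.coeff 1 - a.coeff 1
  have hcs : ∀ b ∈ cs, b ≠ 0 := by
    intro b hb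
    rcases List.mem_cons.1 hb with rfl | hb
    · exact hp1
    · obtain ⟨a, ha, rfl⟩ := List.mem_map.1 hb
      intro h0
      have h1 := hg.ne a ha
      have h2 : (p - a).natDegree ≤ 1 :=
        (natDegree_sub_le p a).trans (max_le hp.le ((hg.max a ha).trans hp.le))
      have h3 : (p - a).leadingCoeff = 0 := by
        rw [leadingCoeff, show (p - a).natDegree = 1 by omega, coeff_sub, h0]
      rw [leadingCoeff_eq_zero] at h3
      rw [h3] at h1
      simp at h1
  obtain ⟨Ls, hlen, P, hP, hmain⟩ := Dyn.exists_linear cs hcs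
  refine ⟨(δ ^ 2 ^ cs.length / P) ^ 2, by positivity, cs.length, fun X D Λ f L hf hL hLS hδ' => ?_⟩
  refine ⟨Ls, by simp [hlen, cs], hlen.le, ?_⟩
  let S' : List (ℤ × (X → ℂ)) := (0, 1) :: L.map fun a => (a.1.coeff 1, sh D.T (a.1.coeff 0) a.2)
  have h1 := hmain X D Λ (p.coeff 1) (sh D.T (p.coeff 0) f) S' (hf.sh _) (by
    intro a ha
    rcases List.mem_cons.1 ha with rfl | ha
    · exact Bd1.one
    · obtain ⟨b, hb, rfl⟩ := List.mem_map.1 ha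
      exact (hL b hb).sh _) (by simp [S', cs, ← hLS])
  have hLdeg : ∀ a ∈ L, a.1.natDegree ≤ 1 := fun a ha =>
    (hg.max a.1 (hLS ▸ List.mem_map_of_mem ha)).trans hp.le
  have e : ∀ n : ℤ, sh D.T (p.coeff 1 * n) (sh D.T (p.coeff 0) f) *
      (S'.map fun a => sh D.T (a.1 * n) a.2).prod = sh D.T (p.eval n) f * fam D.T L n := by
    intro n
    rw [sh_sh, ← hlin p hp.le]
    congr 1
    simp only [S', fam, List.map_cons, List.prod_cons, sh_one, one_mul, List.map_map]
    congr 1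
    refine List.map_congr_left fun a ha => ?_
    simp only [Function.comp_apply, sh_sh, ← hlin a.1 (hLdeg a ha)]
  simp_rw [e, Δ_sh, D.C_sh (hf.Δ _)] at h1
  have hb : Bd fun s => ‖D.E.C (Δ D.T s f)‖ :=
    Bd.of_le (fun _ => norm_nonneg _) fun s => D.E.norm_C_le_one (hf.Δ s)
  have h2 : δ ^ 2 ^ cs.length / P ≤ (IM Ls).R fun s => ‖D.E.C (Δ D.T s f)‖ := by
    rw [div_le_iff₀' hP]
    exact (pow_le_pow_left₀ hδ.le hδ' _).trans h1
  exact (pow_le_pow_left₀ (by positivity) h2 2).trans ((IM Ls).sq_R_le hb)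

theorem ctrl_of_diffFam {p q : ℤ[X]} {S : List ℤ[X]} {bad : Finset ℤ}
    (hctrl : ∀ h ∉ bad, Ctrl (taylor h p - q) (diffFam p q S h)) : Ctrl p S := by
  intro δ hδ
  obtain ⟨H, hH⟩ := exists_shift_corr hδ bad.card
  have hall : ∀ h : ℤ, ∃ c : ℝ, 0 < c ∧ ∃ N : ℕ, h ∉ bad → ∀ (X : Type) (D : Dyn X) (Λ : Mean)
      (f : X → ℂ) (L : List (ℤ[X] × (X → ℂ))), Bd1 f → (∀ a ∈ L, Bd1 a.2) →
      L.map Prod.fst = diffFam p q S h →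
      δ ^ 2 / 2 ≤ ‖Λ.C fun n => D.E.C (sh D.T ((taylor h p - q).eval n) f * fam D.T L n)‖ →
      ∃ Ls : List Mean, 1 ≤ Ls.length ∧ Ls.length ≤ N ∧ c ≤ D.V Ls f := by
    intro h
    by_cases hh : h ∈ bad
    · exact ⟨1, one_pos, 0, fun h' => absurd hh h'⟩
    · obtain ⟨c, hc, N, hN⟩ := hctrl h hh (δ ^ 2 / 2) (by positivity)
      exact ⟨c, hc, N, fun _ => hN⟩
  choose c hc N hN using hall
  let I : Finset ℤ := Finset.Icc (-(H : ℤ)) H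
  have hI : I.Nonempty := ⟨0, by simp [I]⟩
  refine ⟨I.inf' hI c, (Finset.lt_inf'_iff _).2 fun h _ => hc h, I.sup N,
    fun X D Λ f L hf hL hLS hδ' => ?_⟩
  obtain ⟨v, hv, hsplit⟩ := exists_fam_split D.T hL
  set L' := L.filter fun a => 1 ≤ a.1.natDegree with hL'
  have hL'bd : ∀ a ∈ L', Bd1 a.2 := fun a ha => hL a (List.mem_filter.1 ha).1
  have hL'S : L'.map Prod.fst = nonconst S := by
    rw [← hLS, nonconst, List.filter_map]
    rfl
  let u (n : ℤ) : X → ℂ := sh D.T (p.eval n) f * fam D.T L' n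
  have hu : ∀ n, Bd1 (u n) := fun n => (hf.sh _).mul (fam_bd hL'bd n)
  have e1 : (fun n => D.E.C (sh D.T (p.eval n) f * fam D.T L n)) = fun n => D.E.C (v * u n) := by
    ext n
    congr 1
    rw [hsplit]
    ring
  rw [e1] at hδ'
  obtain ⟨h, hhH, hhbad, hcorr⟩ := hH hv hu hδ' bad le_rfl
  let L₀ : List (ℤ[X] × (X → ℂ)) := (p, star f) ::
    ((L'.map fun a => (taylor h a.1, a.2)) ++ L'.map fun a => (a.1, star a.2))
  let L₁ := L₀.map fun a => (a.1 - q, a.2)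
  have hL₀ : ∀ a ∈ L₀, Bd1 a.2 := by
    intro a ha
    rcases List.mem_cons.1 ha with rfl | ha
    · exact hf.star
    · rcases List.mem_append.1 ha with ha | ha
      · obtain ⟨b, hb, rfl⟩ := List.mem_map.1 ha
        exact hL'bd b hb
      · obtain ⟨b, hb, rfl⟩ := List.mem_map.1 ha
        exact (hL'bd b hb).star
  have hL₁ : ∀ a ∈ L₁, Bd1 a.2 := by
    intro a ha
    obtain ⟨b, hb, rfl⟩ := List.mem_map.1 ha
    exact hL₀ b hb
  have hL₁S : L₁.map Prod.fst = diffFam p q S h := by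
    simp only [L₁, L₀, diffFam, ← hL'S, List.map_cons, List.map_append, List.map_map]
    rfl
  have e2 : corr Λ D.E u h =
      Λ.C fun n => D.E.C (sh D.T ((taylor h p - q).eval n) f * fam D.T L₁ n) := by
    simp only [corr]
    congr 1
    ext n
    rw [← D.C_sh ((hf.sh _).mul (fam_bd hL₁ n)) (q.eval n), sh_mul, fam_sub, sh_sh]
    congr 1
    simp only [u, L₀, fam_cons, fam_append, fam_taylor, fam_star, eval_sub, taylor_eval,
      add_sub_cancel, star_mul', sh_star]
    ring
  rw [e2] at hcorr
  obtain ⟨Ls, h1, h2, h3⟩ := hN h hhbad X D Λ f L₁ hf hL₁ hL₁S hcorr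
  have hhI : h ∈ I := by
    simp only [I, Finset.mem_Icc]
    exact abs_le.1 hhH
  exact ⟨Ls, h1, h2.trans (Finset.le_sup hhI), (Finset.inf'_le _ hhI).trans h3⟩

theorem Good.ctrl {p : ℤ[X]} {S : List ℤ[X]} (hg : Good p S) : Ctrl p S := by
  suffices h : ∀ d : ℕ, ∀ w : Fin d → ℕ, ∀ p S, Good p S → p.natDegree ≤ d →
      ftype d (p :: S) = w → Ctrl p S from h _ _ p S hg le_rfl rfl
  intro d w
  induction w using (Pi.Lex.wellFounded (ι := Fin d) (α := fun _ => ℕ) (· > ·)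
    (s := fun _ => (· < ·)) fun _ => wellFounded_lt).induction with
  | _ w ih =>
    intro p S hg hd hw
    rcases hg.one_le.eq_or_lt with h1 | h2
    · exact ctrl_of_natDegree_eq_one hg h1.symm
    obtain ⟨q, hq, hqmin, hqp⟩ := exists_pivot hg
    obtain ⟨bad, -, hbad⟩ := exists_bad h2 S
    refine ctrl_of_diffFam (q := q) (bad := bad) fun h hh => ?_
    have hg' := hg.diffFam h2 hq hqmin hqp (hbad h hh).1 (hbad h hh).2
    refine ih _ ?_ _ _ hg' ?_ rfl
    · rw [← hw]
      exact ftype_diffFam_lt hg hd hq hqmin h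
    · refine (natDegree_sub_le _ _).trans (max_le ?_ ((hqmin p List.mem_cons_self).trans hd))
      rwa [natDegree_taylor]

/-- Control of the averages of an essentially distinct family by each of its functions. -/
theorem exists_ctrl {ι : Type} [Fintype ι] [DecidableEq ι] [Nontrivial ι] (P : ι → ℤ[X])
    (hP : ∀ i j, i ≠ j → 1 ≤ (P i - P j).natDegree) (m : ι) {δ : ℝ} (hδ : 0 < δ) :
    ∃ c : ℝ, 0 < c ∧ ∃ N : ℕ, ∀ (X : Type) (D : Dyn X) (Λ : Mean) (f : ι → X → ℂ),
      (∀ i, Bd1 (f i)) → δ ≤ ‖Λ.C fun n => D.E.C (∏ i, sh D.T ((P i).eval n) (f i))‖ →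
      ∃ Ls : List Mean, 1 ≤ Ls.length ∧ Ls.length ≤ N ∧ c ≤ D.V Ls (f m) := by
  obtain ⟨k, -, hk⟩ := Finset.univ.exists_max_image (fun i => (P i).natDegree) ⟨m, by simp⟩
  obtain ⟨r, hr1, hr2⟩ : ∃ r : ℤ[X], 1 ≤ (P m - r).natDegree ∧
      ∀ i, (P i - r).natDegree ≤ (P m - r).natDegree := by
    rcases (hk m (Finset.mem_univ m)).lt_or_eq with hlt | heq
    · have h1 : (P m - P k).natDegree = (P k).natDegree := by
        rw [← neg_sub, natDegree_neg]
        exact (sub_of_natDegree_lt hlt).1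
      refine ⟨P k, by omega, fun i => ?_⟩
      rw [h1]
      exact (natDegree_sub_le _ _).trans (max_le (hk i (Finset.mem_univ i)) le_rfl)
    · refine ⟨0, ?_, fun i => ?_⟩
      · obtain ⟨j, hj⟩ := exists_ne m
        have h1 := hP m j hj.symm
        have h2 := natDegree_sub_le (P m) (P j)
        have h3 := hk j (Finset.mem_univ j)
        rw [sub_zero]
        have := le_max_iff.1 (h1.trans h2)
        omega
      · rw [sub_zero, sub_zero, heq]
        exact hk i (Finset.mem_univ i)
  let l : List ι := (Finset.univ.erase m).toList
  have hg : Good (P m - r) (l.map fun i => P i - r) := by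
    refine ⟨hr1, fun a ha => ?_, fun a ha => ?_⟩
    · obtain ⟨i, hi, rfl⟩ := List.mem_map.1 ha
      exact hr2 i
    · obtain ⟨i, hi, rfl⟩ := List.mem_map.1 ha
      rw [sub_sub_sub_cancel_right]
      refine hP m i ?_
      simp only [l, Finset.mem_toList, Finset.mem_erase] at hi
      exact hi.1.symm
  obtain ⟨c, hc, N, hN⟩ := hg.ctrl δ hδ
  refine ⟨c, hc, N, fun X D Λ f hf hδ' => ?_⟩
  let L₀ : List (ℤ[X] × (X → ℂ)) := l.map fun i => (P i, f i)
  let L := L₀.map fun a => (a.1 - r, a.2)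
  have hL : ∀ a ∈ L, Bd1 a.2 := by
    intro a ha
    simp only [L, L₀, List.map_map] at ha
    obtain ⟨i, -, rfl⟩ := List.mem_map.1 ha
    exact hf i
  refine hN X D Λ (f m) L (hf m) hL (by simp only [L, L₀, List.map_map]; rfl)
    (hδ'.trans (le_of_eq ?_))
  congr 2
  ext n
  rw [← D.C_sh (((hf m).sh _).mul (fam_bd hL n)) (r.eval n), sh_mul, fam_sub, sh_sh, eval_sub,
    add_sub_cancel]
  congr 1
  rw [← Finset.mul_prod_erase Finset.univ _ (Finset.mem_univ m)]
  congr 1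
  rw [fam, List.map_map, ← Finset.prod_map_toList]
  rfl

end PET

/-! ### Weyl sums -/

section Weyl
open Polynomial

/-- The exponential `x ↦ exp(2πix)`. -/
noncomputable def ee (x : ℝ) : ℂ := Complex.exp (2 * Real.pi * Complex.I * x)

theorem ee_add (x y : ℝ) : ee (x + y) = ee x * ee y := by
  simp only [ee]
  rw [← Complex.exp_add]
  congr 1
  push_cast
  ring

@[simp] theorem norm_ee (x : ℝ) : ‖ee x‖ = 1 := by
  rw [ee, show (2 * Real.pi * Complex.I * x : ℂ) = ((2 * Real.pi * x : ℝ) : ℂ) * Complex.I by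
    push_cast; ring]
  exact Complex.norm_exp_ofReal_mul_I _

theorem ee_eq_one_iff {x : ℝ} : ee x = 1 ↔ ∃ z : ℤ, x = z := by
  rw [ee, Complex.exp_eq_one_iff]
  refine exists_congr fun z => ?_
  have h : (2 * Real.pi * Complex.I : ℂ) ≠ 0 := Complex.two_pi_I_ne_zero
  rw [mul_comm (z : ℂ), mul_right_inj' h]
  exact_mod_cast Iff.rfl

@[simp] theorem ee_int (z : ℤ) : ee z = 1 := ee_eq_one_iff.2 ⟨z, rfl⟩
@[simp] theorem ee_zero : ee 0 = 1 := by simpa using ee_int 0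

theorem star_ee (x : ℝ) : star (ee x) = ee (-x) := by
  have h : ee (-x) * ee x = 1 := by rw [← ee_add]; simp
  have h2 : star (ee x) * ee x = 1 := by
    rw [Complex.star_def, ← Complex.normSq_eq_conj_mul_self, Complex.normSq_eq_norm_sq]
    simp
  exact mul_right_cancel₀ (by rw [← norm_ne_zero_iff]; simp) (h2.trans h.symm)

theorem ee_sum {ι : Type*} (s : Finset ι) (g : ι → ℝ) : ee (∑ i ∈ s, g i) = ∏ i ∈ s, ee (g i) := by
  classical
  induction s using Finset.induction_on with
  | empty => simp
  | insert a s ha ih => rw [Finset.sum_insert ha, Finset.prod_insert ha, ee_add, ih]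

theorem exists_antidifference {h : ℤ} (hh : h ≠ 0) (d : ℕ) : ∃ N : ℤ, N ≠ 0 ∧
    ∀ Z : ℤ[X], (∀ k, d ≤ k → Z.coeff k = 0) → ∃ W : ℤ[X], taylor h W - W = C N * Z := by
  induction d with
  | zero =>
    refine ⟨1, one_ne_zero, fun Z hZ => ⟨0, ?_⟩⟩
    have : Z = 0 := by
      ext k
      exact hZ k (Nat.zero_le k)
    simp [this]
  | succ d ih =>
    obtain ⟨N, hN, hW⟩ := ih
    refine ⟨N * ((d + 1) * h), mul_ne_zero hN (mul_ne_zero (by positivity) hh), fun Z hZ => ?_⟩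
    obtain ⟨W, hW⟩ := hW (C ((d + 1) * h) * Z - C (Z.coeff d) *
      (taylor h (X ^ (d + 1)) - X ^ (d + 1))) (by
      intro k hk
      rw [coeff_sub, coeff_C_mul, coeff_C_mul, coeff_sub, taylor_X_pow, coeff_X_add_C_pow,
        coeff_X_pow]
      rcases hk.eq_or_lt with rfl | hk
      · simp
        ring
      · rw [hZ k hk]
        rcases (Nat.succ_le_of_lt hk).eq_or_lt with rfl | hk
        · simp
        · rw [Nat.choose_eq_zero_of_lt hk, if_neg (by omega)]
          simp)
    refine ⟨W + C (N * Z.coeff d) * X ^ (d + 1), ?_⟩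
    have e : taylor h (C (N * Z.coeff d) * X ^ (d + 1)) =
        C (N * Z.coeff d) * taylor h (X ^ (d + 1)) := by
      rw [taylor_mul, taylor_C]
    rw [map_add, e]
    have : taylor h W = W + C N * (C ((d + 1) * h) * Z - C (Z.coeff d) *
      (taylor h (X ^ (d + 1)) - X ^ (d + 1))) := by
      rw [← hW]
      ring
    rw [this]
    simp only [map_mul]
    ring

theorem natDegree_le_one_of_taylor_sub {g : ℝ[X]} {h : ℝ} (hh : h ≠ 0) {c : ℝ}
    (hg : taylor h g - g = C c) : g.natDegree ≤ 1 := by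
  by_contra! hlt
  obtain ⟨d, hd⟩ : ∃ d, g.natDegree = d + 1 := ⟨g.natDegree - 1, by omega⟩
  have h1 : (hasseDeriv d g).natDegree ≤ 1 := (natDegree_hasseDeriv_le g d).trans (by omega)
  have h2 := congrArg (coeff · d) hg
  simp only [coeff_sub, taylor_coeff] at h2
  rw [coeff_C_of_ne_zero (by omega), eval_eq_sum_range' (Nat.lt_succ_of_le h1), Finset.sum_range_succ,
    Finset.sum_range_one, hasseDeriv_coeff, hasseDeriv_coeff] at h2
  simp only [zero_add, pow_zero, mul_one, pow_one, Nat.choose_self, Nat.cast_one, one_mul,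
      add_sub_cancel_left] at h2
  have h3 : ((1 + d).choose d : ℝ) ≠ 0 := by
    exact_mod_cast (Nat.choose_pos (by omega)).ne'
  have h4 : g.coeff (1 + d) ≠ 0 := by
    rw [add_comm 1 d, ← hd, coeff_natDegree, Ne, leadingCoeff_eq_zero]
    rintro rfl
    simp at hlt
  exact mul_ne_zero (mul_ne_zero h3 h4) hh h2

theorem natDegree_taylor_sub_le {q : ℝ[X]} {d : ℕ} (hq : q.natDegree ≤ d + 1) (h : ℝ) :
    (taylor h q - q).natDegree ≤ d := by
  rw [natDegree_le_iff_coeff_eq_zero]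
  intro N hN
  rcases eq_or_lt_of_le (show q.natDegree ≤ N by omega) with h1 | h1
  · rw [← h1, coeff_sub, coeff_taylor_natDegree, coeff_natDegree, sub_self]
  · rw [coeff_sub, coeff_eq_zero_of_natDegree_lt h1,
      coeff_eq_zero_of_natDegree_lt (by rwa [natDegree_taylor]), sub_self]

theorem weyl_step {q : ℝ[X]} {Λ : Mean} (hne : Λ.C (fun n => ee (q.eval (n : ℝ))) ≠ 0)
    {h : ℤ} (hh : h ≠ 0) {N : ℤ} {R : ℕ} (hN : N ≠ 0) (hR : 0 < R) {W Z : ℤ[X]} {c : ℝ}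
    (hW : taylor h W - W = C N * Z)
    (hZ : C (R : ℝ) * (taylor (h : ℝ) q - q) = Z.map (Int.castRingHom ℝ) + C c) :
    ∃ Z' : ℤ[X], ∃ c' : ℝ, C (((N.natAbs * R : ℕ) : ℝ)) * q = Z'.map (Int.castRingHom ℝ) + C c' := by
  have key : ∃ Z' : ℤ[X], ∃ c' : ℝ, C ((N : ℝ) * R) * q = Z'.map (Int.castRingHom ℝ) + C c' := by
    set g := C ((N : ℝ) * R) * q - W.map (Int.castRingHom ℝ) with hg
    have h1 : taylor (h : ℝ) g - g = C (N * c) := by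
      have h2 := congrArg (Polynomial.map (Int.castRingHom ℝ)) hW
      simp only [Polynomial.map_sub, map_taylor, Polynomial.map_mul, Polynomial.map_C] at h2
      simp only [Int.coe_castRingHom] at h2
      rw [hg, map_sub, taylor_mul, taylor_C]
      have h3 : taylor (h : ℝ) (W.map (Int.castRingHom ℝ)) =
        W.map (Int.castRingHom ℝ) + C (N : ℝ) * Z.map (Int.castRingHom ℝ) := by
        rw [← h2]
        ring
      have h4 : C (R : ℝ) * taylor (h : ℝ) q =
          C (R : ℝ) * q + Z.map (Int.castRingHom ℝ) + C c := by
        rw [add_assoc, ← hZ]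
        ring
      rw [h3, map_mul, mul_assoc, h4, map_mul]
      ring
    have hg1 := natDegree_le_one_of_taylor_sub (by exact_mod_cast hh : (h : ℝ) ≠ 0) h1
    set β := g.coeff 1 with hβ
    set γ := g.coeff 0 with hγ
    have hgX : g = C β * X + C γ := eq_X_add_C_of_natDegree_le_one hg1
    have hq : ∀ x : ℝ, N * R * q.eval x = (W.map (Int.castRingHom ℝ)).eval x + β * x + γ := by
      intro x
      have := congrArg (eval x) (hg.symm.trans hgX)
      simp only [eval_sub, eval_mul, eval_C, eval_add, eval_X] at this
      linarith
    have hWi : ∀ n : ℤ, (W.map (Int.castRingHom ℝ)).eval (n : ℝ) = ((W.eval n : ℤ) : ℝ) := by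
      intro n
      exact eval_intCast_map (Int.castRingHom ℝ) W n
    have hNR : (N : ℝ) * R ≠ 0 := mul_ne_zero (by exact_mod_cast hN) (by exact_mod_cast hR.ne')
    have hshift : ∀ n : ℤ, ee (q.eval ((n + N * R : ℤ) : ℝ)) = ee β * ee (q.eval (n : ℝ)) := by
      intro n
      obtain ⟨z, hz⟩ : (N * R : ℤ) ∣ W.eval (n + N * R) - W.eval n := by
        simpa using W.sub_dvd_eval_sub (n + N * R) n
      have h2 : q.eval ((n + N * R : ℤ) : ℝ) = (z : ℝ) + β + q.eval (n : ℝ) := by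
        apply mul_left_cancel₀ hNR
        have hz' : ((W.eval (n + N * R) : ℤ) : ℝ) = (W.eval n : ℤ) + N * R * z := by
          rw [← sub_eq_iff_eq_add']
          exact_mod_cast hz
        rw [hq, hWi, hz', mul_add, hq, hWi]
        push_cast
        ring
      rw [h2, ee_add, ee_add, ee_int, one_mul]
    have hinv := Λ.invC (u := fun n => ee (q.eval (n : ℝ))) ⟨1, fun n => by simp⟩ (N * R)
    simp_rw [hshift] at hinv
    rw [Λ.C_mul] at hinv
    obtain ⟨z, hz⟩ := ee_eq_one_iff.1 (mul_right_cancel₀ hne (hinv.trans (one_mul _).symm))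
    refine ⟨W + C z * X, γ, ?_⟩
    have : C ((N : ℝ) * R) * q = g + W.map (Int.castRingHom ℝ) := by rw [hg]; ring
    rw [this, hgX, hz]
    simp only [Polynomial.map_add, Polynomial.map_mul, Polynomial.map_C, map_X, Int.coe_castRingHom]
    ring
  obtain ⟨Z', c', hkey⟩ := key
  rcases Int.natAbs_eq N with hN' | hN'
  · refine ⟨Z', c', ?_⟩
    rw [← hkey, hN']
    simp
  · refine ⟨-Z', -c', ?_⟩
    rw [Polynomial.map_neg, map_neg, ← neg_add, ← hkey, hN']
    simp

theorem weyl (d : ℕ) {ε : ℝ} (hε : 0 < ε) : ∃ R : ℕ, 0 < R ∧ ∀ q : ℝ[X], q.natDegree ≤ d →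
    ∀ Λ : Mean, ε ≤ ‖Λ.C (fun n => ee (q.eval (n : ℝ)))‖ →
    ∃ Z : ℤ[X], ∃ c : ℝ, C (R : ℝ) * q = Z.map (Int.castRingHom ℝ) + C c := by
  induction d generalizing ε with
  | zero =>
    refine ⟨1, one_pos, fun q hq Λ _ => ⟨0, q.coeff 0, ?_⟩⟩
    simpa using eq_C_of_natDegree_le_zero hq
  | succ d ih =>
    obtain ⟨H, hH⟩ := exists_shift_corr hε 1
    obtain ⟨R, hR, hweyl⟩ := ih (show 0 < ε ^ 2 / 2 by positivity)
    have hant : ∀ h : ℤ, ∃ N : ℤ, N ≠ 0 ∧ (h ≠ 0 → ∀ Z : ℤ[X],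
        (∀ k, d + 1 ≤ k → Z.coeff k = 0) → ∃ W : ℤ[X], taylor h W - W = C N * Z) := by
      intro h
      by_cases hh : h = 0
      · exact ⟨1, one_ne_zero, fun h' => absurd hh h'⟩
      · obtain ⟨N, hN, hW⟩ := exists_antidifference hh (d + 1)
        exact ⟨N, hN, fun _ => hW⟩
    choose N hN hant using hant
    let I : Finset ℤ := Finset.Icc (-(H : ℤ)) H
    refine ⟨∏ h ∈ I, (N h).natAbs * R, Finset.prod_pos fun h _ =>
      Nat.mul_pos (Int.natAbs_pos.2 (hN h)) hR, fun q hq Λ hΛ => ?_⟩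
    obtain ⟨h, hhH, hh0, hcorr⟩ := hH (Ω := Unit) (Λ := Λ) (M := St.dirac ()) (v := 1) Bd1.one
      (u := fun n _ => ee (q.eval (n : ℝ))) (fun n _ => by simp) (by
        convert hΛ using 4
        apply Complex.ext
        · rw [St.C_re]
          simp [St.dirac]
        · rw [St.C_im]
          simp [St.dirac]) {0} (by simp)
    have hh : h ≠ 0 := by simpa using hh0
    obtain ⟨Z, c, hZ⟩ := hweyl (taylor (h : ℝ) q - q) (natDegree_taylor_sub_le hq _) Λ (by
      refine hcorr.trans (le_of_eq ?_)
      simp only [corr]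
      congr 2
      ext n
      have e : ee ((taylor (h : ℝ) q - q).eval (n : ℝ)) =
          ee (q.eval ((n + h : ℤ) : ℝ)) * star (ee (q.eval (n : ℝ))) := by
        rw [star_ee, ← ee_add, eval_sub, taylor_eval]
        push_cast
        congr 1
      rw [e]
      apply Complex.ext
      · rw [St.C_re]
        rfl
      · rw [St.C_im]
        rfl)
    have hZdeg : ∀ k, d + 1 ≤ k → Z.coeff k = 0 := by
      intro k hk
      have h1 := congrArg (coeff · k) hZ
      simp only [coeff_C_mul, coeff_add, coeff_map, eq_intCast] at h1
      rw [coeff_C_of_ne_zero (by omega), coeff_eq_zero_of_natDegree_lt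
        (lt_of_le_of_lt (natDegree_taylor_sub_le hq _) (Nat.lt_of_succ_le hk))] at h1
      simp only [mul_zero, add_zero] at h1
      exact_mod_cast h1.symm
    obtain ⟨W, hW⟩ := hant h hh Z hZdeg
    have hne : Λ.C (fun n => ee (q.eval (n : ℝ))) ≠ 0 := by
      rw [← norm_pos_iff]
      exact hε.trans_le hΛ
    obtain ⟨Z', c', h1⟩ := weyl_step hne hh (hN h) hR hW hZ
    have hhI : h ∈ I := by
      simp only [I, Finset.mem_Icc]
      exact abs_le.1 hhH
    obtain ⟨k, hk⟩ := Finset.dvd_prod_of_mem (fun h => (N h).natAbs * R) hhI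
    refine ⟨C (k : ℤ) * Z', k * c', ?_⟩
    rw [hk, Nat.cast_mul, mul_comm, ← mul_comm (k : ℝ), map_mul, mul_comm q, mul_assoc, h1]
    simp only [Polynomial.map_mul, Polynomial.map_C, Int.coe_castRingHom, Int.cast_natCast,
      map_mul]
    ring

/-- The family of polynomials with an additional zero polynomial. -/
noncomputable def optPoly {s : ℕ} (p : Fin s → ℤ[X]) : Option (Fin s) → ℤ[X]
  | none => 0
  | some i => p i

/-- Quantitative independence: large exponential averages force rational frequencies. -/
def WeylGood {ι : Type} [Fintype ι] (P : ι → ℤ[X]) : Prop :=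
  ∀ ε : ℝ, 0 < ε → ∃ R : ℕ, 0 < R ∧ ∀ (α : ι → ℝ) (Λ : Mean), ∑ i, α i = 0 →
    ε ≤ ‖Λ.C (fun n => ee (∑ i, α i * ((P i).eval n : ℤ)))‖ → ∀ i, ∃ z : ℤ, R * α i = z

theorem weylGood_optPoly {s : ℕ} {p : Fin s → ℤ[X]} (hp0 : ∀ i, (p i).coeff 0 = 0)
    (hpind : LinearIndependent ℚ fun i => (p i).map (Int.castRingHom ℚ)) :
    WeylGood (optPoly p) := by
  intro ε hε
  obtain ⟨d, hd⟩ : ∃ d, ∀ i, (p i).natDegree ≤ d :=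
    ⟨Finset.univ.sup fun i => (p i).natDegree, fun i =>
      Finset.le_sup (f := fun i => (p i).natDegree) (Finset.mem_univ i)⟩
  obtain ⟨R, hR, hweyl⟩ := weyl d hε
  have hdual : ∀ l, ∃ w : ℕ → ℚ, w 0 = 0 ∧ ∀ i, ∑ k ∈ Finset.range (d + 1),
      w k * ((p i).coeff k : ℚ) = if i = l then 1 else 0 := by
    intro l
    obtain ⟨φ, hφ⟩ := LinearMap.exists_extend ((Finsupp.lapply l).comp hpind.repr : _ →ₗ[ℚ] ℚ)
    refine ⟨fun k => if k = 0 then 0 else φ (X ^ k), by simp, fun i => ?_⟩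
    have h1 : φ ((p i).map (Int.castRingHom ℚ)) = if i = l then 1 else 0 := by
      have h2 := LinearMap.congr_fun hφ ⟨_, Submodule.subset_span ⟨i, rfl⟩⟩
      simp only [LinearMap.comp_apply, Submodule.subtype_apply] at h2
      rw [h2, LinearIndependent.repr_eq_single hpind i _ rfl]
      simp [Finsupp.single_apply]
    rw [← h1, as_sum_range_C_mul_X_pow' ((p i).map (Int.castRingHom ℚ)) (n := d + 1)
      (Nat.lt_succ_of_le (natDegree_map_le.trans (hd i))), map_sum]
    refine Finset.sum_congr rfl fun k _ => ?_
    rw [← smul_eq_C_mul, map_smul, smul_eq_mul, coeff_map]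
    by_cases hk : k = 0
    · subst hk
      simp [hp0 i]
    · simp [hk, mul_comm]
  choose w hw0 hw using hdual
  let M : ℕ := ∏ l, ∏ k ∈ Finset.range (d + 1), (w l k).den
  have hM : 0 < M := Finset.prod_pos fun l _ => Finset.prod_pos fun k _ => (w l k).den_pos
  have hMw : ∀ l, ∀ k ∈ Finset.range (d + 1), ∃ z : ℤ, (M : ℚ) * w l k = z := by
    intro l k hk
    obtain ⟨m, hm⟩ : (w l k).den ∣ M :=
      (Finset.dvd_prod_of_mem (fun k => (w l k).den) hk).trans
        (Finset.dvd_prod_of_mem (fun l => ∏ k ∈ Finset.range (d + 1), (w l k).den)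
          (Finset.mem_univ l))
    refine ⟨m * (w l k).num, ?_⟩
    rw [hm]
    push_cast
    rw [mul_comm ((w l k).den : ℚ), mul_assoc, Rat.den_mul_eq_num]
  refine ⟨M * R, Nat.mul_pos hM hR, fun α Λ hsum hlarge => ?_⟩
  let q : ℝ[X] := ∑ i, C (α (some i)) * (p i).map (Int.castRingHom ℝ)
  obtain ⟨Z, c, hZ⟩ := hweyl q (natDegree_sum_le_of_forall_le _ _ fun i _ =>
    (natDegree_C_mul_le _ _).trans (natDegree_map_le.trans (hd i))) Λ (by
      refine hlarge.trans (le_of_eq ?_)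
      congr 3
      ext n
      rw [Fintype.sum_option]
      simp only [optPoly, q, eval_zero, Int.cast_zero, mul_zero, zero_add, eval_finsetSum,
        eval_mul, eval_C]
      congr 2
      ext i
      rw [eval_intCast_map]
      rfl)
  have hsome : ∀ l, ∃ z : ℤ, ((M * R : ℕ) : ℝ) * α (some l) = z := by
    intro l
    have h1 : α (some l) = ∑ k ∈ Finset.range (d + 1), (w l k : ℝ) * q.coeff k := by
      have hq : ∀ k, q.coeff k = ∑ i, α (some i) * (p i).coeff k := by
        intro k
        simp only [q, finsetSum_coeff, coeff_C_mul, coeff_map, eq_intCast]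
      simp only [hq, Finset.mul_sum]
      rw [Finset.sum_comm]
      have h2 : ∀ i, ∑ k ∈ Finset.range (d + 1), (w l k : ℝ) * (α (some i) * (p i).coeff k) =
          α (some i) * ((if i = l then 1 else 0 : ℚ) : ℝ) := by
        intro i
        rw [← hw l i]
        push_cast
        rw [Finset.mul_sum]
        exact Finset.sum_congr rfl fun k _ => by ring
      rw [Finset.sum_congr rfl fun i _ => h2 i]
      rw [Finset.sum_eq_single l (fun i _ hi => by rw [if_neg hi]; simp)
        (fun h => absurd (Finset.mem_univ l) h)]
      simp
    choose z hz using hMw l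
    have h3 : ∀ k ∈ Finset.range (d + 1), ∃ y : ℤ,
        ((M * R : ℕ) : ℝ) * ((w l k : ℝ) * q.coeff k) = y := by
      intro k hk
      by_cases hk0 : k = 0
      · subst hk0
        exact ⟨0, by simp [hw0]⟩
      · refine ⟨z k hk * Z.coeff k, ?_⟩
        have h4 := congrArg (coeff · k) hZ
        simp only [coeff_C_mul, coeff_add, coeff_map, eq_intCast, coeff_C_of_ne_zero hk0,
          add_zero] at h4
        have h5 : (M : ℝ) * (w l k : ℝ) = z k hk := by exact_mod_cast hz k hk
        push_cast
        rw [← h4, ← h5]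
        ring
    choose! y hy using h3
    refine ⟨∑ k ∈ Finset.range (d + 1), y k, ?_⟩
    rw [h1, Finset.mul_sum, Finset.sum_congr rfl hy]
    push_cast
    rfl
  intro i
  cases i with
  | some l => exact hsome l
  | none =>
    choose z hz using hsome
    refine ⟨-∑ l, z l, ?_⟩
    rw [Fintype.sum_option] at hsum
    rw [eq_neg_of_add_eq_zero_left hsum, mul_neg, Finset.mul_sum, Finset.sum_congr rfl fun l _ => hz l]
    push_cast
    rfl

theorem one_le_natDegree_optPoly_sub {s : ℕ} {p : Fin s → ℤ[X]} (hp0 : ∀ i, (p i).coeff 0 = 0)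
    (hpind : LinearIndependent ℚ fun i => (p i).map (Int.castRingHom ℚ)) (i j : Option (Fin s))
    (hij : i ≠ j) : 1 ≤ (optPoly p i - optPoly p j).natDegree := by
  have h0 : ∀ i, (optPoly p i).coeff 0 = 0 := by
    rintro (_ | i)
    · rfl
    · exact hp0 i
  have hne : optPoly p i ≠ optPoly p j := by
    have hnz : ∀ i, p i ≠ 0 := fun i h => hpind.ne_zero i (by simp [h])
    rcases i with _ | i <;> rcases j with _ | j
    · exact absurd rfl hij
    · exact fun h => hnz j h.symm
    · exact hnz i
    · intro h
      exact hij (congrArg some (hpind.injective (congrArg (Polynomial.map (Int.castRingHom ℚ)) h)))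
  by_contra! hlt
  have h1 := eq_C_of_natDegree_eq_zero (Nat.lt_one_iff.1 hlt)
  rw [coeff_sub, h0, h0, sub_self, map_zero] at h1
  exact hne (sub_eq_zero.1 h1)

end Weyl

/-! ### Frequencies of stationary sequences in a Hilbert space -/

theorem ee_nat_mul (k : ℕ) (x : ℝ) : ee (k * x) = ee x ^ k := by
  induction k with
  | zero => simp
  | succ k ih => rw [pow_succ, ← ih, ← ee_add]; push_cast; ring_nf

theorem sum_range_ee {Q : ℕ} (hQ : 0 < Q) (m : ℤ) :
    ∑ t ∈ Finset.range Q, ee (m * (t / Q : ℝ)) = if (Q : ℤ) ∣ m then (Q : ℂ) else 0 := by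
  have hQ' : (Q : ℝ) ≠ 0 := by exact_mod_cast hQ.ne'
  have h1 : ∀ t : ℕ, ee (m * (t / Q : ℝ)) = ee (m / Q) ^ t := by
    intro t
    rw [← ee_nat_mul]
    congr 1
    ring
  simp_rw [h1]
  have h2 : ee ((m : ℝ) / Q) = 1 ↔ (Q : ℤ) ∣ m := by
    rw [ee_eq_one_iff]
    constructor
    · rintro ⟨z, hz⟩
      refine ⟨z, ?_⟩
      rw [div_eq_iff hQ'] at hz
      rw [mul_comm]
      exact_mod_cast hz
    · rintro ⟨z, rfl⟩
      refine ⟨z, ?_⟩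
      push_cast
      field_simp
  split_ifs with h
  · rw [h2.2 h]
    simp
  · have h3 : ee ((m : ℝ) / Q) ≠ 1 := fun h' => h (h2.1 h')
    have h4 := geom_sum_mul (ee ((m : ℝ) / Q)) Q
    rw [← ee_nat_mul, mul_div_cancel₀ _ hQ', ee_int, sub_self] at h4
    exact (mul_eq_zero.1 h4).resolve_right (sub_ne_zero.2 h3)

section Hilbert

variable {H : Type*} [NormedAddCommGroup H] [InnerProductSpace ℂ H]

/-- The exponential sum along a sequence of vectors. -/
noncomputable def expSum (v : ℕ → H) (L : ℕ) (α : ℝ) : H :=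
  ∑ k ∈ Finset.range L, ee (-(k * α)) • v k

theorem expSum_norm_sq (v : ℕ → H) (L : ℕ) (α : ℝ) :
    ((‖expSum v L α‖ ^ 2 : ℝ) : ℂ) = ∑ k ∈ Finset.range L, ∑ l ∈ Finset.range L,
      ee (((k : ℤ) - l : ℤ) * α) * inner ℂ (v k) (v l) := by
  rw [Complex.ofReal_pow, ← Complex.coe_algebraMap, ← inner_self_eq_norm_sq_to_K (𝕜 := ℂ), expSum,
    sum_inner]
  refine Finset.sum_congr rfl fun k _ => ?_
  rw [inner_sum]
  refine Finset.sum_congr rfl fun l _ => ?_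
  rw [inner_smul_left, inner_smul_right, ← mul_assoc, ← Complex.star_def, star_ee, ← ee_add]
  congr 2
  push_cast
  ring

theorem exists_expSum_large {v : ℕ → H}
    (hst : ∀ k l, inner ℂ (v (k + 1)) (v (l + 1)) = inner ℂ (v k) (v l)) (h0 : ‖v 0‖ ≤ 1)
    {L : ℕ} (hL : 0 < L) :
    ∃ α ∈ Set.Icc (0 : ℝ) 1, (∑ k ∈ Finset.range L, ∑ l ∈ Finset.range L,
      ‖inner ℂ (v k) (v l)‖ ^ 2) / 2 ≤ ‖expSum v L α‖ ^ 2 := by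
  have hst' : ∀ t k l, inner ℂ (v (k + t)) (v (l + t)) = inner ℂ (v k) (v l) := by
    intro t
    induction t with
    | zero => simp
    | succ t ih => intro k l; rw [← add_assoc, ← add_assoc, hst, ih]
  have hst2 : ∀ k l i j : ℕ, (k : ℤ) - l = i - j → inner ℂ (v k) (v l) = inner ℂ (v i) (v j) := by
    intro k l i j h
    rcases le_total i k with hik | hik
    · obtain ⟨t, rfl⟩ := Nat.exists_eq_add_of_le hik
      obtain rfl : l = j + t := by push_cast at h; omega
      exact hst' t i j
    · obtain ⟨t, rfl⟩ := Nat.exists_eq_add_of_le hik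
      obtain rfl : j = l + t := by push_cast at h; omega
      exact (hst' t k l).symm
  set Q := 4 * L with hQ
  have hQ0 : 0 < Q := by omega
  have hQr : (0 : ℝ) < Q := by exact_mod_cast hQ0
  obtain ⟨t₀, ht₀, hmax⟩ := Finset.exists_max_image (Finset.range Q)
    (fun t : ℕ => ‖expSum v L (t / Q)‖ ^ 2) ⟨0, Finset.mem_range.2 hQ0⟩
  refine ⟨t₀ / Q, ⟨by positivity, ?_⟩, ?_⟩
  · rw [div_le_one hQr]
    exact_mod_cast (Finset.mem_range.1 ht₀).le
  set Y := ‖expSum v L (t₀ / Q)‖ ^ 2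
  set S := ∑ k ∈ Finset.range L, ∑ l ∈ Finset.range L, ‖inner ℂ (v k) (v l)‖ ^ 2 with hS
  have hW : ∑ t ∈ Finset.range Q, ‖expSum v (2 * L) (t / Q)‖ ^ 2 ≤ Q * (2 * L) := by
    have h1 : ((∑ t ∈ Finset.range Q, ‖expSum v (2 * L) (t / Q)‖ ^ 2 : ℝ) : ℂ) =
        ((Q * (2 * L) * ‖v 0‖ ^ 2 : ℝ) : ℂ) := by
      rw [Complex.ofReal_sum]
      simp_rw [expSum_norm_sq]
      rw [Finset.sum_comm]
      have h2 : ∀ k ∈ Finset.range (2 * L), ∑ t ∈ Finset.range Q, ∑ l ∈ Finset.range (2 * L),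
          ee (((k : ℤ) - l : ℤ) * (t / Q : ℝ)) * inner ℂ (v k) (v l) =
          Q * inner ℂ (v 0) (v 0) := by
        intro k hk
        rw [Finset.sum_comm, Finset.sum_eq_single k]
        · rw [← Finset.sum_mul, sum_range_ee hQ0, if_pos (by simp), hst2 k k 0 0 (by simp)]
        · intro l hl hlk
          rw [← Finset.sum_mul, sum_range_ee hQ0, if_neg, zero_mul]
          intro hd
          simp only [Finset.mem_range] at hk hl
          have := Int.eq_zero_of_abs_lt_dvd hd (by rw [abs_lt]; constructor <;> omega)
          omega
        · exact fun h => absurd hk h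
      rw [Finset.sum_congr rfl h2, inner_self_eq_norm_sq_to_K]
      simp
      ring
    rw [Complex.ofReal_inj.1 h1]
    have : ‖v 0‖ ^ 2 ≤ 1 := pow_le_one₀ (norm_nonneg _) h0
    exact mul_le_of_le_one_right (by positivity) this
  have hWY : Q * L * S ≤ ∑ t ∈ Finset.range Q, ‖expSum v (2 * L) (t / Q)‖ ^ 2 *
      ‖expSum v L (t / Q)‖ ^ 2 := by
    have h1 : ((∑ t ∈ Finset.range Q, ‖expSum v (2 * L) (t / Q)‖ ^ 2 *
        ‖expSum v L (t / Q)‖ ^ 2 : ℝ) : ℂ) = ((∑ i ∈ Finset.range L, ∑ j ∈ Finset.range L,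
        ∑ k ∈ Finset.range (2 * L), ∑ l ∈ Finset.range (2 * L),
          if (k : ℤ) - l = i - j then Q * ‖inner ℂ (v i) (v j)‖ ^ 2 else 0 : ℝ) : ℂ) := by
      have h2 : ∀ t : ℕ, ((‖expSum v L (t / Q)‖ ^ 2 : ℝ) : ℂ) =
          ∑ i ∈ Finset.range L, ∑ j ∈ Finset.range L,
          ee (-(((i : ℤ) - j : ℤ) * (t / Q : ℝ))) * star (inner ℂ (v i) (v j)) := by
        intro t
        have := congrArg star (expSum_norm_sq v L (t / Q))
        rw [Complex.star_def, Complex.conj_ofReal] at this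
        rw [this, map_sum]
        refine Finset.sum_congr rfl fun i _ => ?_
        rw [map_sum]
        refine Finset.sum_congr rfl fun j _ => ?_
        rw [← Complex.star_def, star_mul', star_ee]
      rw [Complex.ofReal_sum]
      simp_rw [Complex.ofReal_mul, h2, expSum_norm_sq]
      push_cast
      simp_rw [Finset.mul_sum, Finset.sum_mul]
      rw [Finset.sum_comm]
      refine Finset.sum_congr rfl fun i hi => ?_
      rw [Finset.sum_comm]
      refine Finset.sum_congr rfl fun j hj => ?_
      rw [Finset.sum_comm]
      refine Finset.sum_congr rfl fun k hk => ?_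
      rw [Finset.sum_comm]
      refine Finset.sum_congr rfl fun l hl => ?_
      have h3 : ∀ t : ℕ, ee (((k : ℤ) - l : ℤ) * (t / Q : ℝ)) * inner ℂ (v k) (v l) *
          (ee (-(((i : ℤ) - j : ℤ) * (t / Q : ℝ))) * star (inner ℂ (v i) (v j))) =
          ee (((k - l) - (i - j) : ℤ) * (t / Q : ℝ)) *
            (inner ℂ (v k) (v l) * star (inner ℂ (v i) (v j))) := by
        intro t
        have : (((k - l) - (i - j) : ℤ) * (t / Q : ℝ)) = ((k : ℤ) - l : ℤ) * (t / Q : ℝ) +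
          (-(((i : ℤ) - j : ℤ) * (t / Q : ℝ))) := by push_cast; ring
        rw [this, ee_add]
        ring
      push_cast at h3
      rw [Finset.sum_congr rfl fun t _ => h3 t, ← Finset.sum_mul]
      have h4 := sum_range_ee hQ0 ((k - l) - (i - j) : ℤ)
      push_cast at h4
      rw [h4]
      simp only [Finset.mem_range] at hi hj hk hl
      split_ifs with hd heq heq
      · rw [hst2 k l i j heq, Complex.star_def, Complex.mul_conj, Complex.normSq_eq_norm_sq]
        push_cast
        rfl
      · exfalso
        have := Int.eq_zero_of_abs_lt_dvd hd (by rw [abs_lt]; constructor <;> omega)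
        omega
      · exfalso
        rw [heq] at hd
        simp at hd
      · simp
    rw [Complex.ofReal_inj.1 h1, hS, Finset.mul_sum]
    refine Finset.sum_le_sum fun i hi => ?_
    rw [Finset.mul_sum]
    refine Finset.sum_le_sum fun j hj => ?_
    simp only [Finset.mem_range] at hi hj
    rw [← Finset.sum_product']
    calc (Q * L * ‖inner ℂ (v i) (v j)‖ ^ 2 : ℝ)
        = ∑ t ∈ Finset.range L, Q * ‖inner ℂ (v i) (v j)‖ ^ 2 := by
          rw [Finset.sum_const, Finset.card_range, nsmul_eq_mul]; ring
      _ = ∑ x ∈ (Finset.range L).image (fun t => (i + t, j + t)),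
          (if ((x.1 : ℕ) : ℤ) - (x.2 : ℕ) = i - j then
            (Q * ‖inner ℂ (v i) (v j)‖ ^ 2 : ℝ) else 0) := by
          rw [Finset.sum_image (by intro a _ b _ hab; simpa using hab)]
          refine Finset.sum_congr rfl fun t _ => ?_
          rw [if_pos]
          push_cast
          ring
      _ ≤ _ := by
          refine Finset.sum_le_sum_of_subset_of_nonneg ?_ ?_
          · intro x hx
            simp only [Finset.mem_image, Finset.mem_range, Finset.mem_product] at hx ⊢
            obtain ⟨t, ht, rfl⟩ := hx
            constructor <;> simp only <;> omega
          · intro x _ _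
            split_ifs <;> positivity
  have hfin : (Q : ℝ) * L * S ≤ Q * (2 * L) * Y := by
    refine hWY.trans (le_trans (Finset.sum_le_sum (g := fun t : ℕ =>
      ‖expSum v (2 * L) (t / Q)‖ ^ 2 * Y) fun t ht =>
        mul_le_mul_of_nonneg_left (hmax t ht) (by positivity)) ?_)
    rw [← Finset.sum_mul]
    exact mul_le_mul_of_nonneg_right hW (by positivity)
  have hLr : (0 : ℝ) < L := by exact_mod_cast hL
  have : (Q : ℝ) * L * S ≤ (Q * L) * (2 * Y) := by linarith
  have := le_of_mul_le_mul_left this (by positivity)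
  linarith

end Hilbert

section Hilbert

variable {H : Type*} [NormedAddCommGroup H] [InnerProductSpace ℂ H]

theorem norm_expSum_mul_le (U : H →ₗᵢ[ℂ] H) (v : H) (K M : ℕ) (α : ℝ) :
    ‖expSum (fun k => U^[k] v) (K * M) α‖ ≤ M * ‖expSum (fun k => U^[k] v) K α‖ := by
  induction M with
  | zero => simp [expSum]
  | succ M ih =>
    have h1 : expSum (fun k => U^[k] v) (K * (M + 1)) α = expSum (fun k => U^[k] v) (K * M) α +
        ee (-((K * M : ℕ) * α)) • U^[K * M] (expSum (fun k => U^[k] v) K α) := by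
      simp only [expSum]
      rw [Nat.mul_succ, Finset.sum_range_add]
      congr 1
      have h2 : ∀ n (z : ℕ → H), U^[n] (∑ k ∈ Finset.range K, z k) =
          ∑ k ∈ Finset.range K, U^[n] (z k) := by
        intro n z
        induction n with
        | zero => simp
        | succ n ih => simp only [Function.iterate_succ_apply', ih, map_sum]
      have h3 : ∀ n (c : ℂ) (z : H), U^[n] (c • z) = c • U^[n] z := by
        intro n c z
        induction n with
        | zero => simp
        | succ n ih => simp only [Function.iterate_succ_apply', ih, map_smul]
      rw [h2, Finset.smul_sum]
      refine Finset.sum_congr rfl fun k _ => ?_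
      rw [h3, smul_smul, ← ee_add, ← Function.iterate_add_apply]
      congr 2
      push_cast
      ring
    have h4 : ∀ n (z : H), ‖U^[n] z‖ = ‖z‖ := by
      intro n z
      induction n with
      | zero => simp
      | succ n ih => rw [Function.iterate_succ_apply', U.norm_map, ih]
    rw [h1]
    refine (norm_add_le _ _).trans ?_
    rw [norm_smul, norm_ee, one_mul, h4]
    push_cast
    linarith

theorem continuous_expSum (v : ℕ → H) (L : ℕ) : Continuous (expSum v L) := by
  unfold expSum ee
  fun_prop

theorem exists_freq_large (U : H →ₗᵢ[ℂ] H) {v : H} (hv : ‖v‖ ≤ 1) {δ : ℝ} (hδ : 0 < δ)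
    (h : ∀ L : ℕ, 0 < L → δ * L ^ 2 ≤ ∑ k ∈ Finset.range L, ∑ l ∈ Finset.range L,
      ‖inner ℂ (U^[k] v) (U^[l] v)‖ ^ 2) :
    ∃ α : ℝ, ∀ K : ℕ, 0 < K → √(δ / 2) * K ≤ ‖expSum (fun k => U^[k] v) K α‖ := by
  have h1 : ∀ n : ℕ, ∃ α ∈ Set.Icc (0 : ℝ) 1, δ / 2 * (n.factorial : ℝ) ^ 2 ≤
      ‖expSum (fun k => U^[k] v) n.factorial α‖ ^ 2 := by
    intro n
    obtain ⟨α, hα, hle⟩ := exists_expSum_large (v := fun k => U^[k] v) (fun k l => by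
      simp only [Function.iterate_succ_apply', U.inner_map_map]) hv n.factorial_pos
    exact ⟨α, hα, by linarith [h _ n.factorial_pos]⟩
  choose α hα hle using h1
  obtain ⟨a, -, φ, hφ, hlim⟩ := isCompact_Icc.tendsto_subseq hα
  refine ⟨a, fun K hK => ?_⟩
  refine ge_of_tendsto ((((continuous_expSum (fun k => U^[k] v) K).norm).tendsto a).comp hlim) ?_
  filter_upwards [eventually_ge_atTop K] with n hn
  obtain ⟨M, hM⟩ := Nat.dvd_factorial hK (hn.trans (hφ.id_le n))
  have hMpos : 0 < M := Nat.pos_of_ne_zero fun h0 => (φ n).factorial_ne_zero (by simp [hM, h0])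
  have h2 := hle (φ n)
  have h3 := norm_expSum_mul_le U v K M (α (φ n))
  rw [hM] at h2
  have h4 : √(δ / 2) * (K * M : ℕ) ≤ ‖expSum (fun k => U^[k] v) (K * M) (α (φ n))‖ := by
    refine le_of_sq_le_sq ?_ (norm_nonneg _)
    rw [mul_pow, Real.sq_sqrt (by positivity)]
    exact h2
  have hMr : (0 : ℝ) < M := by exact_mod_cast hMpos
  refine le_of_mul_le_mul_left ?_ hMr
  refine le_trans (le_of_eq ?_) (h4.trans h3)
  push_cast
  ring

theorem exists_eigenvector [CompleteSpace H] (U : H →ₗᵢ[ℂ] H) {v : H} (hv : ‖v‖ ≤ 1) {δ : ℝ}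
    (hδ : 0 < δ) (h : ∀ L : ℕ, 0 < L → δ * L ^ 2 ≤ ∑ k ∈ Finset.range L, ∑ l ∈ Finset.range L,
      ‖inner ℂ (U^[k] v) (U^[l] v)‖ ^ 2) :
    ∃ (α : ℝ) (w : H), U w = ee α • w ∧ √(δ / 2) ≤ ‖w‖ ∧ inner ℂ v w = ‖w‖ ^ 2 ∧
      Tendsto (fun N : ℕ => (N : ℂ)⁻¹ • expSum (fun k => U^[k] v) N α) atTop (nhds w) := by
  obtain ⟨α, hα⟩ := exists_freq_large U hv hδ h
  have hUn : ‖(ee (-α)) • U.toContinuousLinearMap‖ ≤ 1 := by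
    rw [norm_smul, norm_ee, one_mul]
    exact U.norm_toContinuousLinearMap_le
  have hlim := ContinuousLinearMap.tendsto_birkhoffAverage_orthogonalProjection _ hUn v
  set p := ((ee (-α)) • U.toContinuousLinearMap).eqLocus (1 : H →L[ℂ] H) with hp
  set w : H := (p.orthogonalProjectionOnto v : H) with hw
  have hexp : ∀ N : ℕ, birkhoffAverage ℂ ((ee (-α)) • U.toContinuousLinearMap) id N v =
      (N : ℂ)⁻¹ • expSum (fun k => U^[k] v) N α := by
    intro N
    rw [birkhoffAverage, birkhoffSum, expSum]
    congr 1
    refine Finset.sum_congr rfl fun k hk => ?_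
    clear hk
    induction k with
    | zero => simp
    | succ k ih =>
      rw [id, Function.iterate_succ_apply', Function.iterate_succ_apply']
      rw [id] at ih
      rw [ih]
      simp only [smul_apply, map_smul, LinearIsometry.coe_toContinuousLinearMap]
      rw [smul_smul, ← ee_add]
      congr 2
      push_cast
      ring
  simp_rw [hexp] at hlim
  have hwp : (ee (-α)) • U w = w := (p.orthogonalProjectionOnto v).2
  refine ⟨α, w, ?_, ?_, ?_, hlim⟩
  · conv_rhs => rw [← hwp]
    rw [smul_smul, ← ee_add]
    simp
  · refine ge_of_tendsto hlim.norm ?_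
    filter_upwards [eventually_gt_atTop 0] with N hN
    have hNr : (0 : ℝ) < N := by exact_mod_cast hN
    rw [norm_smul, norm_inv, Complex.norm_natCast, inv_mul_eq_div, le_div_iff₀ hNr]
    exact hα N hN
  · have h1 : inner ℂ (v - w) w = 0 :=
      p.starProjection_inner_eq_zero v w (p.orthogonalProjectionOnto v).2
    rw [inner_sub_left, sub_eq_zero] at h1
    rw [h1, inner_self_eq_norm_sq_to_K]
    rfl

theorem sq_sum_inner_le {v : ℕ → H} {u : H} (hu : ‖u‖ ≤ 1) (L : ℕ) :
    (∑ k ∈ Finset.range L, ‖inner ℂ (v k) u‖ ^ 2) ^ 2 ≤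
      ∑ k ∈ Finset.range L, ∑ l ∈ Finset.range L, ‖inner ℂ (v k) (v l)‖ ^ 2 := by
  set s := ∑ k ∈ Finset.range L, ‖inner ℂ (v k) u‖ ^ 2 with hs
  set A := ∑ k ∈ Finset.range L, ∑ l ∈ Finset.range L, ‖inner ℂ (v k) (v l)‖ ^ 2 with hA
  have hs0 : 0 ≤ s := Finset.sum_nonneg fun _ _ => by positivity
  have hA0 : 0 ≤ A := Finset.sum_nonneg fun _ _ => Finset.sum_nonneg fun _ _ => by positivity
  set y := ∑ k ∈ Finset.range L, inner ℂ (v k) u • v k with hy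
  have h1 : s ≤ ‖y‖ := by
    have : (s : ℂ) = inner ℂ y u := by
      rw [hy, sum_inner, hs]
      push_cast
      refine Finset.sum_congr rfl fun k _ => ?_
      rw [inner_smul_left, mul_comm, Complex.mul_conj, Complex.normSq_eq_norm_sq]
      push_cast
      rfl
    calc s = ‖(s : ℂ)‖ := by rw [Complex.norm_real, Real.norm_of_nonneg hs0]
      _ ≤ ‖y‖ * ‖u‖ := by rw [this]; exact norm_inner_le_norm _ _
      _ ≤ ‖y‖ := mul_le_of_le_one_right (norm_nonneg _) hu
  have h2 : ‖y‖ ^ 2 ≤ ∑ x ∈ Finset.range L ×ˢ Finset.range L,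
      (‖inner ℂ (v x.1) u‖ * ‖inner ℂ (v x.2) u‖) * ‖inner ℂ (v x.1) (v x.2)‖ := by
    have : ((‖y‖ ^ 2 : ℝ) : ℂ) = inner ℂ y y := by
      rw [inner_self_eq_norm_sq_to_K]
      push_cast
      rfl
    have h3 : ‖y‖ ^ 2 = ‖(inner ℂ y y : ℂ)‖ := by
      rw [← this, Complex.norm_real, Real.norm_of_nonneg (by positivity)]
    rw [h3, hy, sum_inner, Finset.sum_product]
    refine (norm_sum_le _ _).trans (Finset.sum_le_sum fun k _ => ?_)
    rw [inner_sum]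
    refine (norm_sum_le _ _).trans (Finset.sum_le_sum fun l _ => ?_)
    rw [inner_smul_left, inner_smul_right, norm_mul, norm_mul, RCLike.norm_conj, mul_assoc]
  have h4 : (∑ x ∈ Finset.range L ×ˢ Finset.range L,
      (‖inner ℂ (v x.1) u‖ * ‖inner ℂ (v x.2) u‖) * ‖inner ℂ (v x.1) (v x.2)‖) ^ 2 ≤ s ^ 2 * A := by
    refine (Finset.sum_mul_sq_le_sq_mul_sq _ _ _).trans (le_of_eq ?_)
    rw [Finset.sum_product, Finset.sum_product, ← hA]
    congr 1
    rw [sq s, hs, Finset.sum_mul_sum]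
    simp_rw [mul_pow]
  rcases hs0.eq_or_lt with h0 | h0
  · rw [← h0]
    simpa using hA0
  · have h5 : s ^ 2 ≤ ‖y‖ ^ 2 := pow_le_pow_left₀ hs0 h1 2
    have h6 : (s ^ 2) ^ 2 ≤ s ^ 2 * A :=
      (pow_le_pow_left₀ (by positivity) (h5.trans h2) 2).trans h4
    rw [sq (s ^ 2)] at h6
    exact le_of_mul_le_mul_left h6 (by positivity)

theorem exists_eigenvector_of_mean [CompleteSpace H] (U : H →ₗᵢ[ℂ] H) {v : ℤ → H}
    (hU : ∀ n, U (v n) = v (n + 1)) (hv : ‖v 0‖ ≤ 1) {δ : ℝ} (hδ : 0 < δ) (Λ : Mean)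
    (h : δ ≤ Λ.R fun n => ‖inner ℂ (v n) (v 0)‖ ^ 2) :
    ∃ (α : ℝ) (w : H), U w = ee α • w ∧ √(δ ^ 2 / 2) ≤ ‖w‖ ∧ inner ℂ (v 0) w = ‖w‖ ^ 2 ∧
      Tendsto (fun N : ℕ => (N : ℂ)⁻¹ • expSum (fun k => U^[k] (v 0)) N α) atTop (nhds w) := by
  have hst1 : ∀ m n, inner ℂ (v (m + 1)) (v (n + 1)) = inner ℂ (v m) (v n) := fun m n => by
    rw [← hU, ← hU, U.inner_map_map]
  have hst : ∀ k m n, inner ℂ (v (m + k)) (v (n + k)) = inner ℂ (v m) (v n) := by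
    intro k
    induction k using Int.induction_on with
    | zero => simp
    | succ k ih => intro m n; rw [← add_assoc, ← add_assoc, hst1, ih]
    | pred k ih =>
      intro m n
      rw [← hst1, ← ih m n]
      congr 2 <;> ring
  have hit : ∀ k : ℕ, U^[k] (v 0) = v k := by
    intro k
    induction k with
    | zero => rfl
    | succ k ih => rw [Function.iterate_succ_apply', ih, hU]; push_cast; rfl
  have hn1 : ∀ n, ‖v n‖ ≤ 1 := by
    intro n
    have h1 := hst n 0 0
    simp only [zero_add, inner_self_eq_norm_sq_to_K] at h1
    have h2 : ‖v n‖ ^ 2 = ‖v 0‖ ^ 2 := by exact_mod_cast h1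
    rwa [(sq_eq_sq₀ (norm_nonneg _) (norm_nonneg _)).1 h2]
  have hb : Bd fun n => ‖inner ℂ (v n) (v 0)‖ ^ 2 := by
    refine Bd.of_le (c := 1) (fun n => by positivity) fun n => ?_
    refine pow_le_one₀ (norm_nonneg _) ((norm_inner_le_norm _ _).trans ?_)
    exact mul_le_one₀ (hn1 n) (norm_nonneg _) hv
  refine exists_eigenvector U hv (δ := δ ^ 2) (by positivity) fun L hL => ?_
  have hLr : (0 : ℝ) < L := by exact_mod_cast hL
  simp_rw [hit]
  set A := ∑ k ∈ Finset.range L, ∑ l ∈ Finset.range L, ‖inner ℂ (v k) (v l)‖ ^ 2 with hA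
  have hA0 : 0 ≤ A := Finset.sum_nonneg fun _ _ => Finset.sum_nonneg fun _ _ => by positivity
  have h1 : L * Λ.R (fun n => ‖inner ℂ (v n) (v 0)‖ ^ 2) =
      Λ.R fun n => ∑ k ∈ Finset.range L, ‖inner ℂ (v k) (v (-n))‖ ^ 2 := by
    rw [St.R_sum]
    have : ∀ k ∈ Finset.range L, Λ.R (fun n => ‖inner ℂ (v k) (v (-n))‖ ^ 2) =
        Λ.R (fun n => ‖inner ℂ (v n) (v 0)‖ ^ 2) := by
      intro k _
      rw [← Λ.inv hb k]
      congr 1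
      ext n
      rw [← hst n k (-n)]
      congr 4 <;> ring
    rw [Finset.sum_congr rfl this]
    simp
  have h2 : ∀ n, ∑ k ∈ Finset.range L, ‖inner ℂ (v k) (v (-n))‖ ^ 2 ≤ √A := fun n =>
    Real.le_sqrt_of_sq_le (sq_sum_inner_le (v := fun k : ℕ => v k) (hn1 _) L)
  have h3 : L * δ ≤ √A := by
    refine (mul_le_mul_of_nonneg_left h hLr.le).trans (h1.le.trans (Λ.R_le (Bd.of_le
      (fun n => Finset.sum_nonneg fun _ _ => by positivity) h2) h2))
  calc δ ^ 2 * L ^ 2 = (L * δ) ^ 2 := by ring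
    _ ≤ √A ^ 2 := pow_le_pow_left₀ (by positivity) h3 2
    _ = A := Real.sq_sqrt hA0

end Hilbert

/-! ### Invariant means from averages -/

theorem Mean.exists_of_ultrafilter (𝒰 : Ultrafilter ℕ) (M : ℕ → St ℤ)
    (hM : ∀ φ, Bd φ → Tendsto (fun N => (M N).R (fun n => φ (n + 1)) - (M N).R φ) 𝒰 (nhds 0)) :
    ∃ Λ : Mean, ∀ φ, Bd φ → Tendsto (fun N => (M N).R φ) 𝒰 (nhds (Λ.R φ)) := by
  obtain ⟨S, hS⟩ := St.exists_ultralimit 𝒰 M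
  refine ⟨⟨S, fun φ hφ => ?_⟩, hS⟩
  have h := (hS _ (hφ.comp (fun n => n + 1))).sub (hS _ hφ)
  exact sub_eq_zero.1 (tendsto_nhds_unique h (hM φ hφ))

theorem tendsto_R_zero (M : ℕ → St ℤ)
    (hM : ∀ φ, Bd φ → Tendsto (fun N => (M N).R (fun n => φ (n + 1)) - (M N).R φ) atTop (nhds 0))
    {φ : ℤ → ℝ} (hφ : Bd φ) (h : ∀ Λ : Mean, Λ.R φ = 0) :
    Tendsto (fun N => (M N).R φ) atTop (nhds 0) := by
  rw [tendsto_iff_ultrafilter]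
  intro 𝒰 h𝒰
  obtain ⟨Λ, hΛ⟩ := Mean.exists_of_ultrafilter 𝒰 M fun ψ hψ => (hM ψ hψ).mono_left h𝒰
  have := hΛ φ hφ
  rwa [h Λ] at this

/-- The average over the `N + 1` integers from `c` on. -/
noncomputable def ces (N : ℕ) (c : ℤ) : St ℤ :=
  St.avg (Finset.range (N + 1)) (by simp) fun k => St.dirac (k + c)

theorem ces_R (N : ℕ) (c : ℤ) (φ : ℤ → ℝ) :
    (ces N c).R φ = ((N + 1 : ℕ) : ℝ)⁻¹ * ∑ k ∈ Finset.range (N + 1), φ (k + c) := by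
  rw [ces, St.avg_R, Finset.card_range]
  rfl

theorem ces_shift (N : ℕ) (c : ℤ) (φ : ℤ → ℝ) {C : ℝ} (hC : ∀ n, |φ n| ≤ C) :
    |(ces N c).R (fun n => φ (n + 1)) - (ces N c).R φ| ≤ ((N + 1 : ℕ) : ℝ)⁻¹ * (2 * C) := by
  rw [ces_R, ces_R, ← mul_sub, abs_mul, abs_of_nonneg (by positivity), ← Finset.sum_sub_distrib]
  have : ∀ k ∈ Finset.range (N + 1), φ (k + c + 1) - φ (k + c)
      = (fun j : ℕ => φ (j + c)) (k + 1) - (fun j : ℕ => φ (j + c)) k := fun k _ => by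
    simp only [Nat.cast_add, Nat.cast_one]
    congr 2
    ring
  rw [Finset.sum_congr rfl this, Finset.sum_range_sub (fun j : ℕ => φ (j + c))]
  refine mul_le_mul_of_nonneg_left ?_ (by positivity)
  have h1 := hC ((N + 1 : ℕ) + c)
  have h2 := hC ((0 : ℕ) + c)
  exact (abs_sub _ _).trans (by linarith)

theorem tendsto_avg_ces_shift (s : ℕ → Finset ℤ) (hs : ∀ N, (s N).Nonempty) (φ : ℤ → ℝ)
    (hφ : Bd φ) : Tendsto (fun N => (St.avg (s N) (hs N) (ces N)).R (fun n => φ (n + 1))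
      - (St.avg (s N) (hs N) (ces N)).R φ) atTop (nhds 0) := by
  obtain ⟨C, hC⟩ := hφ
  refine squeeze_zero_norm (a := fun N : ℕ => ((N + 1 : ℕ) : ℝ)⁻¹ * (2 * C)) (fun N => ?_) ?_
  · rw [St.avg_R, St.avg_R, ← mul_sub, ← Finset.sum_sub_distrib, norm_mul, norm_inv,
      RCLike.norm_natCast]
    have hc : (0 : ℝ) < (s N).card := by exact_mod_cast (hs N).card_pos
    rw [inv_mul_le_iff₀ hc, ← nsmul_eq_mul]
    refine (norm_sum_le _ _).trans (Finset.sum_le_card_nsmul _ _ _ fun c _ => ?_)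
    exact ces_shift N c φ hC
  · have := (tendsto_inv_atTop_nhds_zero_nat (𝕜 := ℝ)).comp (tendsto_add_atTop_nat 1)
    simpa using this.mul_const (2 * C)

theorem Mean.nonempty : Nonempty Mean := by
  obtain ⟨𝒰, h𝒰⟩ : ∃ 𝒰 : Ultrafilter ℕ, (𝒰 : Filter ℕ) ≤ atTop := Ultrafilter.exists_le atTop
  obtain ⟨Λ, -⟩ := Mean.exists_of_ultrafilter 𝒰 (fun N => St.avg {1} (by simp) (ces N))
    fun φ hφ => (tendsto_avg_ces_shift (fun _ => {1}) (by simp) φ hφ).mono_left h𝒰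
  exact ⟨Λ⟩

/-- A bounded sequence annihilated by all invariant means has vanishing Cesàro averages. -/
theorem tendsto_cesaro_zero {u : ℤ → ℂ} (hu : Bd fun n => ‖u n‖) (h : ∀ Λ : Mean, Λ.C u = 0) :
    Tendsto (fun N : ℕ => (N : ℂ)⁻¹ * ∑ n ∈ Finset.Icc 1 N, u n) atTop (nhds 0) := by
  have key : ∀ φ : ℤ → ℝ, Bd φ → (∀ Λ : Mean, Λ.R φ = 0) →
      Tendsto (fun N : ℕ => (N : ℝ)⁻¹ * ∑ n ∈ Finset.Icc 1 N, φ n) atTop (nhds 0) := by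
    intro φ hφ h
    have := tendsto_R_zero _ (tendsto_avg_ces_shift (fun _ => {1}) (by simp)) hφ h
    rw [← tendsto_add_atTop_iff_nat 1]
    refine this.congr fun N => ?_
    rw [St.avg_R, Finset.sum_singleton, ces_R, Finset.card_singleton, Nat.cast_one, inv_one,
      one_mul]
    congr 1
    rw [Finset.range_eq_Ico, ← Finset.Ico_add_one_right_eq_Icc,
      Finset.sum_Ico_eq_sum_range, Finset.sum_Ico_eq_sum_range]
    refine Finset.sum_congr (by simp) fun k _ => ?_
    congr 1
    push_cast
    ring
  have him : Bd (fun n => (u n).im) := by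
    obtain ⟨c, hc⟩ := hu
    exact ⟨c, fun x => (Complex.abs_im_le_norm _).trans ((le_abs_self _).trans (hc x))⟩
  have h1 := key _ (St.bd_re hu) fun Λ => by rw [← St.C_re, h Λ]; rfl
  have h2 := key _ him fun Λ => by rw [← St.C_im, h Λ]; rfl
  have h3 := ((Complex.continuous_ofReal.tendsto 0).comp h1).add
    (((Complex.continuous_ofReal.tendsto 0).comp h2).mul_const Complex.I)
  simp only [Complex.ofReal_zero, zero_mul, add_zero] at h3
  refine h3.congr fun N => ?_
  simp only [Function.comp_apply, Complex.ofReal_mul, Complex.ofReal_inv, Complex.ofReal_natCast,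
    Complex.ofReal_sum]
  rw [mul_assoc, ← mul_add, Finset.sum_mul, ← Finset.sum_add_distrib]
  simp [Complex.re_add_im]

theorem tendsto_double_average_zero {φ : ℤ → ℝ} (hφ : Bd φ) (h : ∀ Λ : Mean, Λ.R φ = 0) :
    Tendsto (fun N : ℕ => ((N + 1 : ℕ) : ℝ)⁻¹ * (((N + 1 : ℕ) : ℝ)⁻¹ *
      ∑ l ∈ Finset.range (N + 1), ∑ k ∈ Finset.range (N + 1), φ (k - l))) atTop (nhds 0) := by
  have hinj : Function.Injective fun l : ℕ => -(l : ℤ) := fun a b hab => by simpa using hab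
  have := tendsto_R_zero _ (tendsto_avg_ces_shift
    (fun N => (Finset.range (N + 1)).map ⟨fun l : ℕ => -(l : ℤ), hinj⟩) (by simp)) hφ h
  refine this.congr fun N => ?_
  rw [St.avg_R, Finset.sum_map, Finset.card_map, Finset.card_range]
  congr 1
  rw [Finset.mul_sum]
  refine Finset.sum_congr rfl fun l _ => ?_
  rw [ces_R]
  rfl

/-! ### Measure preserving systems -/

/-- A measure preserving system, together with an invariant extension of the integral to all
bounded functions. -/
structure Sys (X : Type) [MeasurableSpace X] extends Dyn X where
  /-- the measure -/
  μ : Measure X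
  prob : IsProbabilityMeasure μ
  mp : ∀ k : ℤ, MeasurePreserving ⇑(T ^ k) μ μ
  int : ∀ φ : X → ℝ, Measurable φ → Bd φ → E.R φ = ∫ x, φ x ∂μ

attribute [instance] Sys.prob

theorem measurePreserving_zpow {X : Type} [MeasurableSpace X] {μ : Measure X} (T : X ≃ᵐ X)
    (hT : MeasurePreserving T μ μ) (k : ℤ) : MeasurePreserving ⇑(T.toEquiv ^ k) μ μ := by
  have hn : ∀ n : ℕ, MeasurePreserving ⇑(T.toEquiv ^ n) μ μ := fun n => by
    induction n with
    | zero => exact MeasurePreserving.id μ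
    | succ n ih =>
      rw [pow_succ]
      exact ih.comp hT
  have hn' : ∀ n : ℕ, MeasurePreserving ⇑((T.toEquiv ^ n)⁻¹) μ μ := fun n => by
    induction n with
    | zero => exact MeasurePreserving.id μ
    | succ n ih =>
      rw [pow_succ, mul_inv_rev]
      exact (hT.symm T).comp ih
  cases k with
  | ofNat n => exact hn n
  | negSucc n => exact hn' (n + 1)

theorem integrable_of_bd {X : Type} [MeasurableSpace X] {μ : Measure X} [IsFiniteMeasure μ]
    {φ : X → ℝ} (hφ : Measurable φ) (hb : Bd φ) : Integrable φ μ := by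
  obtain ⟨C, hC⟩ := hb
  exact Integrable.of_bound hφ.aestronglyMeasurable C (Eventually.of_forall hC)

theorem integrable_of_bd1 {X : Type} [MeasurableSpace X] {μ : Measure X} [IsFiniteMeasure μ]
    {u : X → ℂ} (hu : Measurable u) (hb : Bd1 u) : Integrable u μ :=
  Integrable.of_bound hu.aestronglyMeasurable 1 (Eventually.of_forall hb)

/-- Every invertible measure preserving transformation gives rise to a system. -/
theorem exists_sys {X : Type} [MeasurableSpace X] (μ : Measure X) [IsProbabilityMeasure μ]
    (T : X ≃ᵐ X) (hT : MeasurePreserving T μ μ) : ∃ S : Sys X, S.μ = μ ∧ S.T = T.toEquiv := by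
  let V : Submodule ℝ (X → ℝ) :=
    { carrier := {φ | Measurable φ ∧ Bd φ}
      add_mem' := fun {a b} ha hb => ⟨ha.1.add hb.1, ha.2.add hb.2⟩
      zero_mem' := ⟨measurable_zero, Bd.const 0⟩
      smul_mem' := fun c a ha => ⟨ha.1.const_smul c, (bddSub X).smul_mem c ha.2⟩ }
  have hintegral : ∀ φ : V, Integrable φ μ := fun φ => integrable_of_bd φ.2.1 φ.2.2
  let f : V →ₗ[ℝ] ℝ :=
    { toFun := fun φ => ∫ x, (φ : X → ℝ) x ∂μ
      map_add' := fun φ ψ => integral_add (hintegral φ) (hintegral ψ)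
      map_smul' := fun c φ => integral_const_mul c _ }
  obtain ⟨M, hM⟩ := St.exists_extend V (fun φ hφ => hφ.2) ⟨measurable_const, Bd.const 1⟩ f
    (fun φ hφ => integral_nonneg hφ) (by simp [f])
  have hmp := measurePreserving_zpow T hT
  obtain ⟨Λ⟩ := Mean.nonempty
  refine ⟨⟨⟨(Λ.toSt.prod M).map fun q => (T.toEquiv ^ q.1) q.2, T.toEquiv, fun φ hφ => ?_⟩, μ,
    inferInstance, hmp, fun φ hφ hb => ?_⟩, rfl, rfl⟩
  · obtain ⟨C, hC⟩ := hφ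
    have h1 := Λ.inv1 (fun n => M.R fun x => φ ((T.toEquiv ^ n) x))
      (M.bd_R (c := C) fun a x => hC _)
    refine Eq.trans ?_ h1
    change Λ.R (fun n => M.R fun x => φ (T.toEquiv ((T.toEquiv ^ n) x))) = _
    congr 1
    ext n
    congr 1
    ext x
    rw [add_comm, zpow_add, zpow_one, Equiv.Perm.mul_apply]
  · change Λ.R (fun n => M.R fun x => φ ((T.toEquiv ^ n) x)) = _
    have : (fun n : ℤ => M.R fun x => φ ((T.toEquiv ^ n) x)) = fun _ => ∫ x, φ x ∂μ := by
      ext n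
      rw [hM ⟨fun x => φ ((T.toEquiv ^ n) x), hφ.comp (hmp n).measurable, hb.comp _⟩]
      change ∫ x, φ ((T.toEquiv ^ n) x) ∂μ = _
      rw [← integral_map (hmp n).measurable.aemeasurable
        (by rw [(hmp n).map_eq]; exact hφ.aestronglyMeasurable), (hmp n).map_eq]
    rw [this, St.R_const]

namespace Sys
variable {X : Type} [MeasurableSpace X] (S : Sys X)

theorem meas (k : ℤ) : Measurable ⇑(S.T ^ k) := (S.mp k).measurable

theorem C_eq {u : X → ℂ} (hu : Measurable u) (hb : Bd1 u) : S.E.C u = ∫ x, u x ∂S.μ := by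
  have h1 : Bd (fun x => (u x).re) := St.bd_re hb.norm
  have h2 : Bd (fun x => (u x).im) := ⟨1, fun x => (Complex.abs_im_le_norm _).trans (hb x)⟩
  have hi : Integrable u S.μ := integrable_of_bd1 hu hb
  apply Complex.ext
  · exact (S.int _ (Complex.measurable_re.comp hu) h1).trans (integral_re hi)
  · exact (S.int _ (Complex.measurable_im.comp hu) h2).trans (integral_im hi)

theorem C_congr_ae {u v : X → ℂ} (hu : Bd1 u) (hv : Bd1 v) (h : ∀ᵐ x ∂S.μ, u x = v x) :
    S.E.C u = S.E.C v := by
  set A := toMeasurable S.μ {x | ¬ u x = v x} with hA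
  have hA0 : S.μ A = 0 := by rw [hA, measure_toMeasurable]; exact h
  have hAm : MeasurableSet A := measurableSet_toMeasurable _ _
  have h2 : ∀ x, ‖(u - v) x‖ ≤ 2 := fun x =>
    (norm_sub_le _ _).trans (by have := hu x; have := hv x; linarith)
  have hi : Bd (A.indicator fun _ => (2 : ℝ)) :=
    Bd.of_le (c := 2) (fun x => Set.indicator_nonneg (fun _ _ => by norm_num) x)
      (fun x => Set.indicator_le_self' (fun _ _ => by norm_num) x)
  have hb : Bd (fun x => ‖(u - v) x‖) := Bd.of_le (fun _ => norm_nonneg _) h2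
  have h3 : ‖S.E.C (u - v)‖ ≤ 0 := by
    refine (S.E.norm_C_le_R hb).trans ((S.E.mono hb hi fun x => ?_).trans ?_)
    · by_cases hx : x ∈ A
      · simpa [hx] using h2 x
      · have : u x = v x := by
          by_contra hne
          exact hx (subset_toMeasurable _ _ hne)
        simp [hx, this]
    · rw [S.int _ (measurable_const.indicator hAm) hi, integral_indicator hAm]
      simp [Measure.real, hA0]
  rw [map_sub] at h3
  exact sub_eq_zero.1 (norm_le_zero_iff.1 h3)

/-- Everywhere equivariant bounded eigenfunctions. -/
structure Eig (a : ℝ) (χ : X → ℂ) : Prop where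
  meas : Measurable χ
  bd : Bd1 χ
  eq : ∀ x, χ (S.T x) = ee a * χ x

variable {S}

theorem Eig.sh_eq {a : ℝ} {χ : X → ℂ} (h : S.Eig a χ) (k : ℤ) (x : X) :
    sh S.T k χ x = ee (k * a) * χ x := by
  have hs : ∀ k : ℤ, sh S.T (k + 1) χ x = ee a * sh S.T k χ x := fun k => by
    rw [sh, add_comm, zpow_add, zpow_one, Equiv.Perm.mul_apply, h.eq, sh]
  induction k using Int.induction_on with
  | zero => simp
  | succ k ih =>
    rw [hs, ih, ← mul_assoc, ← ee_add]
    push_cast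
    ring_nf
  | pred k ih =>
    have h1 := hs (-k - 1)
    rw [sub_add_cancel, ih] at h1
    have h2 : sh S.T (-k - 1) χ x = ee (-a) * (ee a * sh S.T (-k - 1) χ x) := by
      rw [← mul_assoc, ← ee_add]
      simp
    rw [h2, ← h1, ← mul_assoc, ← ee_add]
    push_cast
    ring_nf

theorem Eig.one : S.Eig 0 1 := ⟨measurable_const, Bd1.one, fun x => by simp⟩

theorem Eig.mul {a b : ℝ} {χ ψ : X → ℂ} (h : S.Eig a χ) (k : S.Eig b ψ) : S.Eig (a + b) (χ * ψ) :=
  ⟨h.meas.mul k.meas, h.bd.mul k.bd, fun x => by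
    rw [Pi.mul_apply, h.eq, k.eq, ee_add, Pi.mul_apply]
    ring⟩

theorem Eig.star {a : ℝ} {χ : X → ℂ} (h : S.Eig a χ) : S.Eig (-a) (star χ) :=
  ⟨measurable_star_comp h.meas, h.bd.star, fun x => by
    rw [Pi.star_apply, h.eq, star_mul', star_ee, Pi.star_apply]⟩

end Sys

/-! ### Existence of eigenfunctions and dual functions -/

theorem memLp_of_bd1 {X : Type} [MeasurableSpace X] {μ : Measure X} [IsFiniteMeasure μ]
    {u : X → ℂ} (hu : Measurable u) (hb : Bd1 u) : MemLp u 2 μ :=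
  MemLp.of_bound hu.aestronglyMeasurable 1 (Eventually.of_forall hb)

theorem inner_toLp_left {X : Type} [MeasurableSpace X] {μ : Measure X} [IsFiniteMeasure μ]
    {u : X → ℂ} (hu : MemLp u 2 μ) (w : Lp ℂ 2 μ) :
    inner ℂ (hu.toLp u) w = ∫ x, star (u x) * w x ∂μ := by
  rw [L2.inner_def]
  refine integral_congr_ae ?_
  filter_upwards [hu.coeFn_toLp] with x hx
  rw [RCLike.inner_apply, hx, mul_comm]
  rfl

theorem integral_norm_sq_Lp {X : Type} [MeasurableSpace X] {μ : Measure X} (w : Lp ℂ 2 μ) :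
    ∫ x, ‖w x‖ ^ 2 ∂μ = ‖w‖ ^ 2 := by
  have h1 : (inner ℂ w w : ℂ) = ((∫ x, ‖w x‖ ^ 2 ∂μ : ℝ) : ℂ) := by
    rw [L2.inner_def, ← integral_complex_ofReal]
    refine integral_congr_ae (Eventually.of_forall fun x => ?_)
    simp only [inner_self_eq_norm_sq_to_K]
    simp
  rw [inner_self_eq_norm_sq_to_K] at h1
  exact (Complex.ofReal_injective (by simpa using h1)).symm

namespace Sys
variable {X : Type} [MeasurableSpace X] (S : Sys X)

theorem mpT : MeasurePreserving ⇑S.T S.μ S.μ := by simpa using S.mp 1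

/-- An almost everywhere eigenfunction in `L²` can be cut off to an eigenfunction. -/
theorem exists_eig_of_ae {w : X → ℂ} (hw : Measurable w) {a K : ℝ} (hK : 0 < K)
    (h : ∀ᵐ x ∂S.μ, w (S.T x) = ee a * w x) :
    ∃ χ, S.Eig a χ ∧ ∀ᵐ x ∂S.μ, χ x = if ‖w x‖ ≤ K then w x / K else 0 := by
  classical
  let G : Set X := {x | ∀ n : ℤ, w ((S.T ^ (n + 1)) x) = ee a * w ((S.T ^ n) x)}
  have hGm : MeasurableSet G := by
    simp only [G, Set.ofPred_forall]
    exact MeasurableSet.iInter fun n =>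
      measurableSet_eq_fun (hw.comp (S.meas _)) ((hw.comp (S.meas _)).const_mul _)
  have hG : ∀ᵐ x ∂S.μ, x ∈ G := by
    simp only [G, Set.mem_ofPred_eq]
    rw [ae_all_iff]
    intro n
    filter_upwards [(S.mp n).quasiMeasurePreserving.ae h] with x hx
    rw [← hx, add_comm, zpow_add, zpow_one, Equiv.Perm.mul_apply]
  have hGT : ∀ x, S.T x ∈ G ↔ x ∈ G := fun x => by
    have e : ∀ n : ℤ, (S.T ^ n) (S.T x) = (S.T ^ (n + 1)) x := fun n => by
      rw [zpow_add, zpow_one, Equiv.Perm.mul_apply]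
    simp only [G, Set.mem_ofPred_eq, e]
    refine ⟨fun h n => ?_, fun h n => h _⟩
    simpa using h (n - 1)
  refine ⟨fun x => if x ∈ G ∧ ‖w x‖ ≤ K then w x / K else 0, ⟨?_, fun x => ?_, fun x => ?_⟩, ?_⟩
  · exact Measurable.ite (hGm.inter (measurableSet_le hw.norm measurable_const))
      (hw.div_const _) measurable_const
  · split_ifs with hx
    · rw [norm_div, Complex.norm_real, Real.norm_of_nonneg hK.le, div_le_one hK]
      exact hx.2
    · simp
  · simp only [hGT]
    by_cases hx : x ∈ G
    · have h1 : w (S.T x) = ee a * w x := by simpa using hx 0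
      simp only [hx, h1, true_and, norm_mul, norm_ee, one_mul]
      split_ifs
      · ring
      · simp
    · simp [hx]
  · filter_upwards [hG] with x hx
    simp [hx]

theorem exists_eig {f : X → ℂ} (hf : Measurable f) (hb : Bd1 f) {δ : ℝ} (hδ : 0 < δ) (Λ : Mean)
    (h : δ ≤ Λ.R fun n => ‖S.E.C (sh S.T n f * star f)‖ ^ 2) :
    ∃ a χ, S.Eig a χ ∧ δ ^ 4 / 16 ≤ ‖S.E.C (f * star χ)‖ := by
  have hm : ∀ n, Measurable (sh S.T n f) := measurable_sh S.meas hf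
  have hL : ∀ n, MemLp (sh S.T n f) 2 S.μ := fun n => memLp_of_bd1 (hm n) (hb.sh n)
  let v : ℤ → Lp ℂ 2 S.μ := fun n => (hL n).toLp _
  let U := Lp.compMeasurePreservingₗᵢ (E := ℂ) (p := 2) ℂ S.T S.mpT
  have hU : ∀ n, U (v n) = v (n + 1) := fun n => by
    change Lp.compMeasurePreserving S.T S.mpT (v n) = _
    rw [Lp.toLp_compMeasurePreserving]
    refine MemLp.toLp_congr _ _ (Eventually.of_forall fun x => ?_)
    simp only [Function.comp_apply, sh]
    rw [zpow_add, zpow_one, Equiv.Perm.mul_apply]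
  have hv : ‖v 0‖ ≤ 1 := by
    rw [← sq_le_one_iff₀ (norm_nonneg _), ← integral_norm_sq_Lp]
    have h1 : ∀ᵐ x ∂S.μ, ‖v 0 x‖ ^ 2 ≤ 1 := by
      filter_upwards [(hL 0).coeFn_toLp] with x hx
      rw [hx]
      exact pow_le_one₀ (norm_nonneg _) (hb _)
    refine (integral_mono_of_nonneg (Eventually.of_forall fun x => by positivity)
      (integrable_const 1) h1).trans (by simp)
  have hin : ∀ n, ‖inner ℂ (v n) (v 0)‖ = ‖S.E.C (sh S.T n f * star f)‖ := fun n => by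
    rw [← norm_star (S.E.C _), ← St.C_star,
      S.C_eq (measurable_star_comp ((hm n).mul (measurable_star_comp hf)))
        ((hb.sh n).mul hb.star).star]
    rw [inner_toLp_left]
    congr 1
    refine integral_congr_ae ?_
    filter_upwards [(hL 0).coeFn_toLp] with x hx
    change _ * ((hL 0).toLp _) x = _
    rw [hx]
    simp
  obtain ⟨a, w, hw, hw1, hw2, -⟩ := exists_eigenvector_of_mean U hU hv hδ Λ (by simpa only [hin])
  have hwn : ‖w‖ ≤ 1 := by
    by_contra! hlt
    have h1 := norm_inner_le_norm (𝕜 := ℂ) (v 0) w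
    rw [hw2, norm_pow, Complex.norm_real, norm_norm] at h1
    nlinarith [norm_nonneg (v 0)]
  have hw1' : δ ^ 2 / 2 ≤ ‖w‖ ^ 2 := by
    rwa [Real.sqrt_le_left (norm_nonneg _)] at hw1
  set w' : X → ℂ := fun x => w x with hw'
  have hwm : Measurable w' := (Lp.stronglyMeasurable w).measurable
  have hwT : ∀ᵐ x ∂S.μ, w' (S.T x) = ee a * w' x := by
    have h1 : (U w : X → ℂ) =ᵐ[S.μ] w ∘ S.T := Lp.coeFn_compMeasurePreserving w S.mpT
    rw [hw] at h1
    filter_upwards [h1, Lp.coeFn_smul (ee a) w] with x hx hx'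
    rw [← smul_eq_mul]
    exact hx.symm.trans hx'
  set K : ℝ := 4 / δ ^ 2 with hKdef
  have hK : 0 < K := by positivity
  obtain ⟨χ, hχ, hχw⟩ := S.exists_eig_of_ae hwm hK hwT
  refine ⟨a, χ, hχ, ?_⟩
  have hwi : Integrable w' S.μ := (Lp.memLp w).integrable (by norm_num)
  have hwi2 : Integrable (fun x => ‖w' x‖ ^ 2) S.μ := (Lp.memLp w).integrable_norm_pow (by norm_num)
  have e1 : (‖w‖ ^ 2 : ℂ) = ∫ x, star (f x) * w' x ∂S.μ := by
    rw [← hw2]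
    exact inner_toLp_left _ _
  have hb1 : ‖∫ x, star (f x) * w' x ∂S.μ - ∫ x, star (f x) * (K * χ x) ∂S.μ‖ ≤ δ ^ 2 / 4 := by
    have hi1 : Integrable (fun x => star (f x) * w' x) S.μ :=
      hwi.bdd_mul (c := 1) (measurable_star_comp hf).aestronglyMeasurable
        (Eventually.of_forall fun x => by simpa using hb x)
    have hi2 : Integrable (fun x => star (f x) * (K * χ x)) S.μ :=
      ((integrable_of_bd1 hχ.meas hχ.bd).const_mul (K : ℂ)).bdd_mul (c := 1)
        (measurable_star_comp hf).aestronglyMeasurable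
        (Eventually.of_forall fun x => by simpa using hb x)
    rw [← integral_sub hi1 hi2]
    have h1 : ∀ᵐ x ∂S.μ, ‖star (f x) * w' x - star (f x) * (K * χ x)‖ ≤ K⁻¹ * ‖w' x‖ ^ 2 := by
      filter_upwards [hχw] with x hx
      rw [← mul_sub, norm_mul, norm_star]
      refine (mul_le_of_le_one_left (norm_nonneg _) (hb x)).trans ?_
      rw [hx]
      split_ifs with hc
      · have hK' : (K : ℂ) ≠ 0 := by exact_mod_cast hK.ne'
        rw [mul_div_cancel₀ _ hK', sub_self, norm_zero]
        positivity
      · rw [mul_zero, sub_zero, le_inv_mul_iff₀ hK, sq]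
        exact mul_le_mul_of_nonneg_right (not_le.1 hc).le (norm_nonneg _)
    refine (norm_integral_le_of_norm_le (hwi2.const_mul _) h1).trans ?_
    rw [integral_const_mul, integral_norm_sq_Lp, hKdef, inv_div]
    exact mul_le_of_le_one_right (by positivity) (pow_le_one₀ (norm_nonneg _) hwn)
  have e2 : ‖∫ x, star (f x) * (K * χ x) ∂S.μ‖ = K * ‖S.E.C (f * star χ)‖ := by
    rw [← norm_star (S.E.C _), ← St.C_star,
      S.C_eq (measurable_star_comp (hf.mul hχ.star.meas)) (hb.mul hχ.bd.star).star]
    rw [← Real.norm_of_nonneg hK.le, ← Complex.norm_real, ← norm_mul, ← integral_const_mul,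
      Complex.norm_real, Real.norm_of_nonneg hK.le]
    congr 2
    ext x
    simp
    ring
  rw [← e1] at hb1
  have h3 := norm_sub_norm_le ((‖w‖ : ℂ) ^ 2) (∫ x, star (f x) * (K * χ x) ∂S.μ)
  rw [e2, norm_pow, Complex.norm_real, norm_norm] at h3
  have h4 : δ ^ 2 / 4 ≤ K * ‖S.E.C (f * star χ)‖ := by linarith
  rw [hKdef, div_mul_eq_mul_div, le_div_iff₀ (by positivity)] at h4
  nlinarith

end Sys

namespace Sys
variable {X : Type} [MeasurableSpace X] {S : Sys X}

/-- Eigenfunctions of almost everywhere unit modulus. -/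
structure UEig (S : Sys X) (a : ℝ) (χ : X → ℂ) : Prop extends S.Eig a χ where
  unit : ∀ᵐ x ∂S.μ, ‖χ x‖ = 1

theorem UEig.mul {a b : ℝ} {χ ψ : X → ℂ} (h : S.UEig a χ) (k : S.UEig b ψ) :
    S.UEig (a + b) (χ * ψ) :=
  ⟨h.toEig.mul k.toEig, by filter_upwards [h.unit, k.unit] with x hx hx'; simp [hx, hx']⟩

theorem UEig.star {a : ℝ} {χ : X → ℂ} (h : S.UEig a χ) : S.UEig (-a) (star χ) :=
  ⟨h.toEig.star, by filter_upwards [h.unit] with x hx; simpa using hx⟩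

theorem Eig.add_int {a : ℝ} {χ : X → ℂ} (h : S.Eig a χ) (z : ℤ) : S.Eig (a + z) χ :=
  ⟨h.meas, h.bd, fun x => by rw [h.eq, ee_add, ee_int, mul_one]⟩

theorem exists_uEig (herg : Ergodic S.T S.μ) {f : X → ℂ} (hf : Measurable f) (hb : Bd1 f) {δ : ℝ}
    (hδ : 0 < δ) (Λ : Mean) (h : δ ≤ Λ.R fun n => ‖S.E.C (sh S.T n f * star f)‖ ^ 2) :
    ∃ a χ, S.UEig a χ ∧ δ ^ 4 / 16 ≤ ‖S.E.C (f * star χ)‖ := by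
  classical
  obtain ⟨a, χ, hχ, hc⟩ := S.exists_eig hf hb hδ Λ h
  obtain ⟨ρ, hρ⟩ := herg.ae_eq_const_of_ae_eq_comp₀ (g := fun x => ‖χ x‖)
    hχ.meas.norm.nullMeasurable (Eventually.of_forall fun x => by simp [hχ.eq])
  obtain ⟨x₀, hx₀⟩ := hρ.exists
  have hx₀ : ‖χ x₀‖ = ρ := hx₀
  have hρ1 : ρ ≤ 1 := hx₀ ▸ hχ.bd x₀
  have hρ0 : 0 < ρ := by
    rcases (hx₀ ▸ norm_nonneg (χ x₀) : 0 ≤ ρ).eq_or_lt with h0 | h0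
    · exfalso
      have : S.E.C (f * star χ) = S.E.C 0 :=
        S.C_congr_ae (hb.mul hχ.bd.star) (fun x => by simp) (by
          filter_upwards [hρ] with x hx
          have hx : ‖χ x‖ = ρ := hx
          rw [← h0, norm_eq_zero] at hx
          simp [hx])
      rw [this, map_zero, norm_zero] at hc
      have : 0 < δ ^ 4 / 16 := by positivity
      linarith
    · exact h0
  have hρ' : (ρ : ℂ) ≠ 0 := by exact_mod_cast hρ0.ne'
  let χ' : X → ℂ := fun x => if ‖χ x‖ = ρ then χ x / ρ else 0
  have hb' : Bd1 χ' := fun x => by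
    simp only [χ']
    split_ifs with hx
    · rw [norm_div, hx, Complex.norm_real, Real.norm_of_nonneg hρ0.le, div_self hρ0.ne']
    · simp
  refine ⟨a, χ', ⟨⟨?_, hb', fun x => ?_⟩, ?_⟩, ?_⟩
  · exact Measurable.ite (measurableSet_eq_fun hχ.meas.norm measurable_const)
      (hχ.meas.div_const _) measurable_const
  · simp only [χ', hχ.eq, norm_mul, norm_ee, one_mul]
    split_ifs <;> ring
  · filter_upwards [hρ] with x hx
    have hx : ‖χ x‖ = ρ := hx
    simp [χ', hx, abs_of_pos hρ0, hρ0.ne']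
  · have h1 : S.E.C (f * star χ) = S.E.C (fun x => ρ * (f * star χ') x) := by
      refine S.C_congr_ae (hb.mul hχ.bd.star) (fun x => ?_) ?_
      · rw [norm_mul, Complex.norm_real, Real.norm_of_nonneg hρ0.le]
        exact mul_le_one₀ hρ1 (norm_nonneg _) (hb.mul hb'.star x)
      · filter_upwards [hρ] with x hx
        have hx : ‖χ x‖ = ρ := hx
        simp only [Pi.mul_apply, Pi.star_apply, χ', hx, if_true, star_div₀, Complex.star_def,
          Complex.conj_ofReal]
        field_simp
    rw [h1, St.C_mul, norm_mul, Complex.norm_real, Real.norm_of_nonneg hρ0.le] at hc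
    exact hc.trans (mul_le_of_le_one_left (norm_nonneg _) hρ1)

theorem Eig.eq_const_mul (herg : Ergodic S.T S.μ) {a : ℝ} {ψ φ : X → ℂ} (h : S.Eig a ψ)
    (k : S.UEig a φ) : ∃ c : ℂ, ‖c‖ ≤ 1 ∧ ∀ᵐ x ∂S.μ, ψ x = c * φ x := by
  have h1 := h.mul k.toEig.star
  rw [add_neg_cancel] at h1
  obtain ⟨c, hc⟩ := herg.ae_eq_const_of_ae_eq_comp₀ h1.meas.nullMeasurable
    (Eventually.of_forall fun x => by simp [h1.eq])
  obtain ⟨x₀, hx₀⟩ := hc.exists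
  have hx₀ : (ψ * Star.star φ) x₀ = c := hx₀
  refine ⟨c, hx₀ ▸ h1.bd x₀, ?_⟩
  filter_upwards [hc, k.unit] with x hx hu
  have hx : ψ x * starRingEnd ℂ (φ x) = c := hx
  rw [← hx, mul_assoc, Complex.conj_mul', hu]
  simp

/-- The dual function: an invariant mean of bounded functions, taken weakly. -/
theorem exists_dual (S : Sys X) (Λ : Mean) {F : ℤ → X → ℂ} (hF : ∀ n, Measurable (F n))
    (hb : ∀ n, Bd1 (F n)) : ∃ G : X → ℂ, Measurable G ∧ Bd1 G ∧ ∀ g : X → ℂ, Measurable g → Bd1 g →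
      S.E.C (G * g) = Λ.C fun n => S.E.C (F n * g) := by
  classical
  have hL : ∀ n, MemLp (star (F n)) 2 S.μ := fun n =>
    memLp_of_bd1 (measurable_star_comp (hF n)) (hb n).star
  have hn : ∀ n, ‖(hL n).toLp _‖ ≤ 1 := fun n => by
    rw [← sq_le_one_iff₀ (norm_nonneg _), ← integral_norm_sq_Lp]
    have h1 : ∀ᵐ x ∂S.μ, ‖(hL n).toLp _ x‖ ^ 2 ≤ 1 := by
      filter_upwards [(hL n).coeFn_toLp] with x hx
      rw [hx]
      exact pow_le_one₀ (norm_nonneg _) ((hb n).star _)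
    refine (integral_mono_of_nonneg (Eventually.of_forall fun x => by positivity)
      (integrable_const 1) h1).trans (by simp)
  let L : Lp ℂ 2 S.μ →ₗ[ℂ] ℂ :=
    { toFun := fun w => Λ.C fun n => inner ℂ ((hL n).toLp _) w
      map_add' := fun w w' => by
        rw [← map_add]
        refine St.C_congr _ fun n => ?_
        rw [inner_add_right]
        rfl
      map_smul' := fun c w => by
        rw [RingHom.id_apply, smul_eq_mul, ← St.C_mul]
        refine St.C_congr _ fun n => ?_
        rw [inner_smul_right] }
  let L' : StrongDual ℂ (Lp ℂ 2 S.μ) := L.mkContinuous 1 fun w => by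
    rw [one_mul]
    refine Λ.norm_C_le fun n => (norm_inner_le_norm _ _).trans ?_
    exact mul_le_of_le_one_left (norm_nonneg _) (hn n)
  let y : Lp ℂ 2 S.μ := (InnerProductSpace.toDual ℂ _).symm L'
  have hy : ∀ g : X → ℂ, Measurable g → Bd1 g →
      ∫ x, star (y x) * g x ∂S.μ = Λ.C fun n => S.E.C (F n * g) := by
    intro g hg hgb
    have hgL := memLp_of_bd1 (μ := S.μ) hg hgb
    have h1 : inner ℂ y (hgL.toLp g) = L (hgL.toLp g) := by
      exact InnerProductSpace.toDual_symm_apply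
    have h2 : inner ℂ y (hgL.toLp g) = ∫ x, star (y x) * g x ∂S.μ := by
      rw [L2.inner_def]
      refine integral_congr_ae ?_
      filter_upwards [hgL.coeFn_toLp] with x hx
      rw [RCLike.inner_apply, hx, mul_comm]
      rfl
    rw [← h2, h1]
    refine St.C_congr _ fun n => ?_
    rw [inner_toLp_left, S.C_eq ((hF n).mul hg) ((hb n).mul hgb)]
    refine integral_congr_ae ?_
    filter_upwards [hgL.coeFn_toLp] with x hx
    rw [hx]
    simp
  have hym : Measurable fun x => y x := (Lp.stronglyMeasurable y).measurable
  have hyi : Integrable (fun x => ‖y x‖) S.μ := ((Lp.memLp y).integrable (by norm_num)).norm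
  have hle : ∀ᵐ x ∂S.μ, ‖y x‖ ≤ 1 := by
    let A : Set X := {x | 1 < ‖y x‖}
    have hA : MeasurableSet A := measurableSet_lt measurable_const hym.norm
    let g : X → ℂ := fun x => if x ∈ A then y x / ‖y x‖ else 0
    have hgA : ∀ x, ‖g x‖ = A.indicator (fun _ => (1 : ℝ)) x := fun x => by
      by_cases hx : x ∈ A
      · have h1 : ‖y x‖ ≠ 0 := (zero_lt_one.trans hx).ne'
        simp [g, hx, h1]
      · simp [g, hx]
    have hgm : Measurable g := Measurable.ite hA
      (hym.div (Complex.measurable_ofReal.comp hym.norm)) measurable_const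
    have hgb : Bd1 g := fun x => by
      rw [hgA]
      exact Set.indicator_le_self' (fun _ _ => zero_le_one) x
    have h1 := hy g hgm hgb
    have h2 : ∀ x, star (y x) * g x = ((A.indicator (fun x => ‖y x‖) x : ℝ) : ℂ) := fun x => by
      by_cases hx : x ∈ A
      · have h1 : (‖y x‖ : ℂ) ≠ 0 := by exact_mod_cast (zero_lt_one.trans hx).ne'
        simp only [g, hx, if_true, Set.indicator_of_mem]
        rw [mul_div_assoc', div_eq_iff h1, Complex.star_def, Complex.conj_mul', sq]
      · simp [g, hx]
    simp_rw [h2] at h1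
    rw [integral_complex_ofReal] at h1
    have hb2 : ‖Λ.C fun n => S.E.C (F n * g)‖ ≤ ∫ x, A.indicator (fun _ => (1 : ℝ)) x ∂S.μ := by
      refine Λ.norm_C_le fun n => ?_
      rw [S.C_eq ((hF n).mul hgm) ((hb n).mul hgb)]
      refine norm_integral_le_of_norm_le ((integrable_const (1 : ℝ)).indicator hA)
        (Eventually.of_forall fun x => ?_)
      rw [← hgA, Pi.mul_apply, norm_mul]
      exact mul_le_of_le_one_left (norm_nonneg _) (hb n x)
    rw [← h1, Complex.norm_real] at hb2
    have hb3 := (le_abs_self _).trans hb2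
    rw [← sub_nonpos, ← integral_sub (hyi.indicator hA)
      ((integrable_const (1 : ℝ)).indicator hA)] at hb3
    have hnn : ∀ x, 0 ≤ A.indicator (fun x => ‖y x‖) x - A.indicator (fun _ => (1 : ℝ)) x :=
      fun x => by
        by_cases hx : x ∈ A
        · have : 1 < ‖y x‖ := hx
          simp only [hx, Set.indicator_of_mem]
          linarith
        · simp [hx]
    have hz := (integral_eq_zero_iff_of_nonneg hnn ((hyi.indicator hA).sub
      ((integrable_const (1 : ℝ)).indicator hA))).1 (le_antisymm hb3 (integral_nonneg hnn))
    filter_upwards [hz] with x hx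
    by_contra! hlt
    have hxA : x ∈ A := hlt
    simp only [hxA, Set.indicator_of_mem, Pi.zero_apply] at hx
    linarith
  let G : X → ℂ := fun x => if ‖y x‖ ≤ 1 then star (y x) else 0
  have hG : Measurable G := Measurable.ite (measurableSet_le hym.norm measurable_const)
    (measurable_star_comp hym) measurable_const
  have hGb : Bd1 G := fun x => by
    simp only [G]
    split_ifs with hx
    · rwa [norm_star]
    · simp
  refine ⟨G, hG, hGb, fun g hg hgb => ?_⟩
  rw [← hy g hg hgb, S.C_eq (hG.mul hg) (hGb.mul hgb)]
  refine integral_congr_ae ?_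
  filter_upwards [hle] with x hx
  simp [G, hx]

end Sys

open Polynomial

/-! ### Degree lowering -/

theorem IM_mono (Ls : List Mean) {φ ψ : List ℤ → ℝ} (hφ : Bd φ) (hψ : Bd ψ)
    (h : ∀ s, s.length = Ls.length → φ s ≤ ψ s) : (IM Ls).R φ ≤ (IM Ls).R ψ := by
  have h1 : (IM Ls).R φ = (IM Ls).R fun s => min (φ s) (ψ s) :=
    IM_congr Ls fun s hs => (min_eq_left (h s hs)).symm
  rw [h1]
  refine (IM Ls).mono ?_ hψ fun s => min_le_right _ _
  obtain ⟨C, hC⟩ := hφ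
  obtain ⟨D, hD⟩ := hψ
  exact ⟨max C D, fun s => abs_min_le_max_abs_abs.trans (max_le_max (hC s) (hD s))⟩

section Cube
variable {Ω : Type*}

theorem cube_comp {Ω' : Type*} (A : List ℤ → Ω → ℂ) (g : Ω' → Ω) (ps : List (ℤ × ℤ)) :
    cube ps (fun s x => A s (g x)) = fun x => cube ps A (g x) := by
  induction ps generalizing A with
  | nil => rfl
  | cons q t ih => exact ih fun s => A (q.2 :: s) * star (A (q.1 :: s))

theorem cube_one (ps : List (ℤ × ℤ)) : cube ps (fun _ => (1 : Ω → ℂ)) = 1 := by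
  induction ps with
  | nil => rfl
  | cons q t ih => simpa [cube] using ih

theorem cube_prod {ι : Type*} (I : Finset ι) (A : ι → List ℤ → Ω → ℂ) (ps : List (ℤ × ℤ)) :
    cube ps (fun s => ∏ i ∈ I, A i s) = ∏ i ∈ I, cube ps (A i) := by
  classical
  induction I using Finset.induction_on with
  | empty => simpa using cube_one ps
  | insert i I hi ih =>
    simp only [Finset.prod_insert hi]
    rw [← ih, ← cube_mul]

theorem measurable_cube [MeasurableSpace Ω] {A : List ℤ → Ω → ℂ} (hA : ∀ s, Measurable (A s))
    (ps : List (ℤ × ℤ)) : Measurable (cube ps A) := by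
  induction ps generalizing A with
  | nil => exact hA []
  | cons q t ih => exact ih fun s => (hA _).mul (measurable_star_comp (hA _))

end Cube

theorem Dyn.IM₂_cube_sh {X : Type} (D : Dyn X) (Ls : List Mean) {F : X → ℂ} (hF : Bd1 F) :
    (IM₂ Ls).R (fun ps => ‖D.E.C (cube ps fun s => sh D.T s.sum F)‖)
      = (IM Ls).R fun s => ‖D.E.C (Δ D.T s F)‖ := by
  induction Ls generalizing F with
  | nil => rfl
  | cons Λ Ls ih =>
    rw [IM₂_cons, IM_cons]
    have h1 : ∀ h' h : ℤ, (IM₂ Ls).R (fun t => ‖D.E.C (cube ((h', h) :: t)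
        fun s => sh D.T s.sum F)‖) = (IM Ls).R (fun t => ‖D.E.C (Δ D.T ((h - h') :: t) F)‖) := by
      intro h' h
      have hd : Bd1 (sh D.T (h - h') F * star F) := (hF.sh _).mul hF.star
      have e : ∀ t, cube ((h', h) :: t) (fun s => sh D.T s.sum F)
          = cube t fun s => sh D.T s.sum (sh D.T h' (sh D.T (h - h') F * star F)) := fun t => by
        simp only [cube, List.sum_cons]
        congr 1
        ext s : 1
        rw [sh_mul, sh_sh, sh_mul, sh_sh, sh_star, sh_star, sh_sh, add_comm h s.sum,
          add_comm h' s.sum]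
        congr 3
        ring
      simp_rw [e]
      rw [ih (hd.sh h')]
      congr 1
      ext t
      rw [Δ_sh, D.C_sh (hd.Δ t)]
      rfl
    simp_rw [h1]
    have h2 : ∀ h' : ℤ, Λ.R (fun h => (IM Ls).R (fun t => ‖D.E.C (Δ D.T ((h - h') :: t) F)‖))
        = Λ.R (fun h => (IM Ls).R (fun t => ‖D.E.C (Δ D.T (h :: t) F)‖)) := fun h' => by
      refine Λ.inv (φ := fun h => (IM Ls).R (fun t => ‖D.E.C (Δ D.T (h :: t) F)‖)) ?_ (-h')
      refine St.bd_R _ (c := 1) fun h t => ?_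
      rw [abs_norm]
      exact D.E.norm_C_le_one (hF.Δ _)
    simp_rw [h2]
    exact St.R_const _ _

namespace Sys
variable {X : Type} [MeasurableSpace X]

theorem Eig.sh {S : Sys X} {a : ℝ} {χ : X → ℂ} (h : S.Eig a χ) (k : ℤ) :
    S.Eig a (sh S.T k χ) := by
  refine ⟨measurable_sh S.meas h.meas k, h.bd.sh k, fun x => ?_⟩
  rw [h.sh_eq, h.sh_eq, h.eq]
  ring

theorem exists_eig_cube {S : Sys X} {A : List ℤ → X → ℂ} {a : List ℤ → ℝ}
    (hA : ∀ s, S.Eig (a s) (A s)) (ps : List (ℤ × ℤ)) : ∃ b, S.Eig b (cube ps A) := by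
  induction ps generalizing A a with
  | nil => exact ⟨a [], hA []⟩
  | cons q t ih => exact ih fun s => (hA _).mul (hA _).star

theorem exists_uEig_cube {S : Sys X} {A : List ℤ → X → ℂ} {a : List ℤ → ℝ}
    (hA : ∀ s, A s = 0 ∨ S.UEig (a s) (A s)) (ps : List (ℤ × ℤ)) :
    cube ps A = 0 ∨ ∃ b, S.UEig b (cube ps A) := by
  induction ps generalizing A a with
  | nil => exact (hA []).imp id fun h => ⟨_, h⟩
  | cons q t ih =>
    refine ih (A := fun s => A (q.2 :: s) * Star.star (A (q.1 :: s)))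
      (a := fun s => a (q.2 :: s) + -a (q.1 :: s)) fun s => ?_
    rcases hA (q.2 :: s) with h | h
    · left; simp [h]
    rcases hA (q.1 :: s) with h' | h'
    · left; simp [h']
    · exact Or.inr (h.mul h'.star)

/-- Mean over `n` of the correlations of the functions `f i` shifted by `P i n`. -/
noncomputable def Av {ι : Type} [Fintype ι] (P : ι → ℤ[X]) (S : Sys X) (Λ : Mean)
    (f : ι → X → ℂ) : ℂ :=
  Λ.C fun n => S.E.C (∏ i, PolyAvg.sh S.T ((P i).eval n) (f i))

end Sys

namespace Sys

section
variable {X : Type} [MeasurableSpace X] {S : Sys X}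

theorem exists_uEig_or_zero (herg : Ergodic S.T S.μ) {D : X → ℂ} (hD : Measurable D) (hb : Bd1 D)
    {δ : ℝ} (hδ : 0 < δ) (Λ : Mean) : ∃ a η, (η = 0 ∨ S.UEig a η) ∧
      (η = 0 ∨ δ ^ 4 / 16 ≤ ‖S.E.C (D * η)‖) ∧
      δ ^ 4 / 16 * ((Λ.R fun n => ‖S.E.C (sh S.T n D * star D)‖ ^ 2) - δ) ≤ ‖S.E.C (D * η)‖ := by
  have hc : 0 ≤ δ ^ 4 / 16 := by positivity
  have hbd : ∀ n, ‖S.E.C (sh S.T n D * star D)‖ ^ 2 ≤ 1 := fun n =>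
    pow_le_one₀ (norm_nonneg _) (S.E.norm_C_le_one ((hb.sh _).mul hb.star))
  have hR : (Λ.R fun n => ‖S.E.C (sh S.T n D * star D)‖ ^ 2) ≤ 1 :=
    Λ.R_le (Bd.of_le (fun _ => by positivity) hbd) hbd
  rcases lt_or_ge (Λ.R fun n => ‖S.E.C (sh S.T n D * star D)‖ ^ 2) δ with h | h
  · exact ⟨0, 0, Or.inl rfl, Or.inl rfl,
      (mul_nonpos_of_nonneg_of_nonpos hc (by linarith)).trans (norm_nonneg _)⟩
  · obtain ⟨a, χ, hχ, hle⟩ := exists_uEig herg hD hb hδ Λ h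
    exact ⟨-a, star χ, Or.inr hχ.star, Or.inr hle,
      (mul_le_of_le_one_right hc (by linarith)).trans hle⟩

variable {ι : Type} [Fintype ι] {P : ι → ℤ[X]} {Λ : Mean}

theorem sh_dual [DecidableEq ι] {f : ι → X → ℂ} (hfb : ∀ i, Bd1 (f i)) {m : ι} {F : X → ℂ} (hFb : Bd1 F)
    (hF : ∀ g, Measurable g → Bd1 g → S.E.C (F * g) = Av P S Λ (Function.update f m g)) (k : ℤ)
    {u : X → ℂ} (hu : Measurable u) (hub : Bd1 u) : S.E.C (sh S.T k F * u)
      = Av P S Λ (Function.update (fun i => sh S.T k (f i)) m u) := by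
  have e1 : sh S.T k F * u = sh S.T k (F * sh S.T (-k) u) := by rw [sh_mul, sh_sh]; simp
  rw [e1, S.C_sh (hFb.mul (hub.sh _)), hF _ (measurable_sh S.meas hu _) (hub.sh _), Av, Av]
  refine St.C_congr _ fun n => ?_
  rw [← S.C_sh (Bd1.prod _ fun i _ => Bd1.sh (?_ : Bd1 _) _) k]
  · congr 1
    have e2 : ∀ i, sh S.T k (Function.update f m (sh S.T (-k) u) i)
        = Function.update (fun i => sh S.T k (f i)) m u i := fun i => by
      by_cases hi : i = m
      · subst hi
        simp [sh_sh]
      · simp [hi]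
    have e3 : ∀ g : ι → X → ℂ, sh S.T k (∏ i, g i) = ∏ i, sh S.T k (g i) := fun g => by
      ext x
      simp [sh]
    rw [e3]
    refine Finset.prod_congr rfl fun i _ => ?_
    rw [← e2, sh_sh, sh_sh, add_comm]
  · by_cases hi : i = m
    · subst hi
      simpa using hub.sh _
    · simpa [hi] using hfb i

theorem Av_update_mul [DecidableEq ι] (g : ι → X → ℂ) (m : ι) (η b : X → ℂ) :
    Av P S Λ (Function.update g m (η * b)) = (Λ.toSt.prod S.E).C
      ((fun q => (∏ i, sh S.T ((P i).eval q.1) (Function.update g m η i)) q.2)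
        * fun q => b ((S.T ^ ((P m).eval q.1)) q.2)) := by
  rw [St.prod_C, Av]
  refine St.C_congr _ fun n => St.C_congr _ fun x => ?_
  simp only [Finset.prod_apply, Pi.mul_apply]
  rw [← Finset.mul_prod_erase _ _ (Finset.mem_univ m), ← Finset.mul_prod_erase (a := m) _
    (fun i => sh S.T ((P i).eval n) (Function.update g m η i) x) (Finset.mem_univ m)]
  simp only [Function.update_self]
  have : ∀ i ∈ Finset.univ.erase m, sh S.T ((P i).eval n) (Function.update g m (η * b) i) x
      = sh S.T ((P i).eval n) (Function.update g m η i) x := fun i hi => by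
    simp [Finset.ne_of_mem_erase hi]
  rw [Finset.prod_congr rfl this]
  simp only [sh, Pi.mul_apply]
  ring

theorem cube_Av (g : List ℤ → ι → X → ℂ) (ps : List (ℤ × ℤ)) :
    (Λ.toSt.prod S.E).C (cube ps fun s q => (∏ i, sh S.T ((P i).eval q.1) (g s i)) q.2)
      = Av P S Λ fun i => cube ps fun s => g s i := by
  rw [St.prod_C, Av]
  refine St.C_congr _ fun n => ?_
  congr 1
  have h1 := cube_comp (fun s (q : ℤ × X) => (∏ i, sh S.T ((P i).eval q.1) (g s i)) q.2)
    (fun x => (n, x)) ps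
  have h2 := cube_prod Finset.univ (fun i s => sh S.T ((P i).eval n) (g s i)) ps
  refine (h1.symm.trans h2).trans (Finset.prod_congr rfl fun i _ => ?_)
  exact cube_comp (fun s => g s i) (fun x => (S.T ^ ((P i).eval n)) x) ps

/-- If the derivatives of `F` correlate with products of a function from a fixed finite family and
lower order functions, then `F` has large averaged derivatives. -/
theorem le_V_of_le_sum {Ls : List Mean} {F : X → ℂ} (hF : Bd1 F) {R : ℕ} (hR : 0 < R)
    {B : ℕ → List ℤ → X → ℂ} (hB : ∀ j, Lower Ls.length (B j)) {c : ℝ} (hc : 0 ≤ c)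
    (h : c ≤ (IM Ls).R fun s => ∑ j ∈ Finset.range R, ‖S.E.C (sh S.T s.sum F * B j s)‖) :
    ((c / R) ^ 2 ^ Ls.length) ^ 2 ≤ S.V Ls F := by
  have hR' : (0 : ℝ) < R := by exact_mod_cast hR
  rw [St.R_sum] at h
  obtain ⟨j, -, hj⟩ : ∃ j ∈ Finset.range R,
      c / R ≤ (IM Ls).R fun s => ‖S.E.C (sh S.T s.sum F * B j s)‖ := by
    refine Finset.exists_le_of_sum_le (by simpa using hR.ne') ?_
    rw [Finset.sum_const, Finset.card_range, nsmul_eq_mul, mul_div_cancel₀ _ hR'.ne']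
    exact h
  have h1 := box_inequality Ls S.E (A := fun s => sh S.T s.sum F) (fun s => hF.sh _) (hB j)
  rw [S.IM₂_cube_sh Ls hF] at h1
  have h2 := (pow_le_pow_left₀ (by positivity) hj (2 ^ Ls.length)).trans h1
  refine (pow_le_pow_left₀ (by positivity) h2 2).trans (St.sq_R_le _ ?_)
  exact Bd.of_le (fun _ => norm_nonneg _) fun s => S.E.norm_C_le_one (hF.Δ s)

end

/-- Eigenvalues of the `m`-th function are rational with bounded denominator as soon as the average
is large, provided that all functions with index outside `J` are eigenfunctions. -/
def RatEig {ι : Type} [Fintype ι] (P : ι → ℤ[X]) (J : Finset ι) (m : ι) : Prop :=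
  ∀ ε > (0 : ℝ), ∃ R : ℕ, 0 < R ∧ ∀ (X : Type) [MeasurableSpace X] (S : Sys X) (Λ : Mean)
    (f : ι → X → ℂ) (a : ℝ), Ergodic S.T S.μ → (∀ i, Measurable (f i)) → (∀ i, Bd1 (f i)) →
    (∀ i, i ∉ J → i ≠ m → ∃ b, S.Eig b (f i)) → S.Eig a (f m) → ε ≤ ‖Av P S Λ f‖ →
    ∃ z : ℤ, R * a = z

theorem degree_lowering {ι : Type} [Fintype ι] [DecidableEq ι] {P : ι → ℤ[X]} {J : Finset ι}
    {m : ι} (hU : RatEig P J m) {r : ℕ} (hr : 0 < r) {δ : ℝ} (hδ : 0 < δ) : ∃ δ' > 0,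
    ∀ (X : Type) [MeasurableSpace X] (S : Sys X) (Λ : Mean) (f : ι → X → ℂ) (F : X → ℂ),
    Ergodic S.T S.μ → (∀ i, Measurable (f i)) → (∀ i, Bd1 (f i)) →
    (∀ i, i ∉ J → i ≠ m → ∃ b, S.Eig b (f i)) → Measurable F → Bd1 F →
    (∀ g, Measurable g → Bd1 g → S.E.C (F * g) = Av P S Λ (Function.update f m g)) →
    ∀ (Ls : List Mean) (Λ' : Mean), Ls.length = r → δ ≤ S.V (Ls ++ [Λ']) F → δ' ≤ S.V Ls F := by
  classical
  set c₁ : ℝ := (δ / 2) ^ 4 / 16 with hc₁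
  have hc₁0 : 0 < c₁ := by positivity
  set c₃ : ℝ := (1 / 2) ^ r * (c₁ * (δ / 2)) ^ 2 ^ r with hc₃
  have hc₃0 : 0 < c₃ := by positivity
  obtain ⟨R, hR, hUR⟩ := hU (c₃ / 2) (by positivity)
  have hR' : (0 : ℝ) < R := by exact_mod_cast hR
  refine ⟨((c₁ * (c₃ / 2) / R) ^ 2 ^ r) ^ 2, by positivity, ?_⟩
  intro X _ S Λ f F herg hfm hfb hfe hFm hFb hF Ls Λ' hLs hV
  choose! a η hη hη' hηg using fun s : List ℤ => exists_uEig_or_zero herg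
    (measurable_Δ S.meas hFm s) (hFb.Δ (T := S.T) s) (half_pos hδ) Λ'
  have hηe : ∀ s, S.Eig (a s) (η s) := fun s => by
    rcases hη s with h | h
    · rw [h]
      exact ⟨measurable_const, fun x => by simp, fun x => by simp⟩
    · exact h.toEig
  obtain ⟨B, hB, hBm, hBΔ⟩ := exists_lower_Δ S.T S.meas r hFb hFm
  -- the functions of the cube construction
  set g : List ℤ → ι → X → ℂ := fun s => Function.update (fun i => sh S.T s.sum (f i)) m (η s)
    with hg
  have hgb : ∀ s i, Bd1 (g s i) := fun s i => by
    by_cases hi : i = m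
    · subst hi
      simpa [hg] using (hηe s).bd
    · simpa [hg, hi] using (hfb i).sh _
  have hgm : ∀ s i, Measurable (g s i) := fun s i => by
    by_cases hi : i = m
    · subst hi
      simpa [hg] using (hηe s).meas
    · simpa [hg, hi] using measurable_sh S.meas (hfm i) _
  set A : List ℤ → ℤ × X → ℂ := fun s q => (∏ i, sh S.T ((P i).eval q.1) (g s i)) q.2 with hA
  have hAb : ∀ s, Bd1 (A s) := fun s q => Bd1.prod _ (fun i _ => (hgb s i).sh _) q.2
  have key₁ : ∀ s, s.length = r → S.E.C (Δ S.T s F * η s)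
      = (Λ.toSt.prod S.E).C (A s * fun q => B s ((S.T ^ ((P m).eval q.1)) q.2)) := fun s hs => by
    rw [hBΔ s hs, mul_assoc, mul_comm (B s), sh_dual hfb hFb hF _ ((hηe s).meas.mul (hBm s))
      ((hηe s).bd.mul (hB.bd s)), Av_update_mul]
  have hbd₁ : ∀ s, ‖S.E.C (Δ S.T s F * η s)‖ ≤ 1 := fun s =>
    S.E.norm_C_le_one ((hFb.Δ s).mul (hηe s).bd)
  -- first lower bound
  have key₂ : c₁ * (δ / 2) ≤ (IM Ls).R fun s => ‖S.E.C (Δ S.T s F * η s)‖ := by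
    rw [Dyn.V, IM_append] at hV
    simp_rw [Δ_append] at hV
    have hin : ∀ s n, ‖S.E.C (sh S.T n (Δ S.T s F) * star (Δ S.T s F))‖ ^ 2 ≤ 1 := fun s n =>
      pow_le_one₀ (norm_nonneg _) (S.E.norm_C_le_one (((hFb.Δ s).sh _).mul (hFb.Δ s).star))
    have hbd : Bd fun s => Λ'.R fun n => ‖S.E.C (sh S.T n (Δ S.T s F) * star (Δ S.T s F))‖ ^ 2 :=
      Λ'.bd_R (c := 1) fun s n => by
        rw [abs_of_nonneg (by positivity)]
        exact hin s n
    have h1 := (IM Ls).mono ((Bd.const c₁).mul (hbd.sub (Bd.const (δ / 2))))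
      (Bd.of_le (fun _ => norm_nonneg _) hbd₁) hηg
    rw [St.R_mul, St.R_sub, St.R_const] at h1
    refine le_trans ?_ h1
    exact mul_le_mul_of_nonneg_left (by linarith) hc₁0.le
  rw [IM_congr Ls (ψ := fun s => ‖(Λ.toSt.prod S.E).C (A s * fun q =>
    B s ((S.T ^ ((P m).eval q.1)) q.2))‖) fun s hs => by rw [key₁ s (hs.trans hLs)]] at key₂
  have key₃ := (pow_le_pow_left₀ (by positivity) key₂ (2 ^ Ls.length)).trans
    (box_inequality Ls (Λ.toSt.prod S.E) hAb
      ((hLs ▸ hB).comp fun q : ℤ × X => (S.T ^ ((P m).eval q.1)) q.2))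
  set Φ : List (ℤ × ℤ) → ℝ := fun ps => ‖Av P S Λ fun i => cube ps fun s => g s i‖ with hΦ
  have hΦA : ∀ ps, ‖(Λ.toSt.prod S.E).C (cube ps A)‖ = Φ ps := fun ps => by
    rw [hΦ, hA, cube_Av]
  simp_rw [hΦA] at key₃
  have hΦ1 : ∀ ps, Φ ps ≤ 1 := fun ps => by
    rw [← hΦA]
    exact St.norm_C_le_one _ (cube_bd hAb ps)
  have hΦb : Bd Φ := Bd.of_le (fun _ => norm_nonneg _) hΦ1
  obtain ⟨π, hπ, hle⟩ := exists_sel Ls hΦb fun ps => norm_nonneg _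
  have key₄ : c₃ ≤ (IM Ls).R fun s => Φ (π s) := by
    refine le_trans ?_ hle
    rw [hLs] at key₃ ⊢
    exact mul_le_mul_of_nonneg_left key₃ (by positivity)
  obtain ⟨B', hB', hBπ⟩ := cube_sel (hLs ▸ hπ : Sel r π) fun s => (hηe s).bd
  -- finitely many eigenfunctions with rational eigenvalues
  have hφ : ∀ j : ℕ, ∃ φ : X → ℂ, Bd1 φ ∧
      ((∃ ψ, S.UEig (j / R) ψ) → S.UEig (j / R) φ) := fun j => by
    by_cases h : ∃ ψ, S.UEig (j / R) ψ
    · obtain ⟨ψ, hψ⟩ := h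
      exact ⟨ψ, hψ.bd, fun _ => hψ⟩
    · exact ⟨1, Bd1.one, fun h' => absurd h' h⟩
  choose φ hφb hφe using hφ
  have hlow : ∀ j, Lower r fun s => B s * (φ j * star (B' s)) := fun j =>
    hB.mul ((Lower.const hr (hφb j)).mul hB'.star)
  have hlowb : ∀ j s, ‖S.E.C (sh S.T s.sum F * (B s * (φ j * star (B' s))))‖ ≤ 1 := fun j s =>
    S.E.norm_C_le_one ((hFb.sh _).mul ((hlow j).bd s))
  have key₅ : ∀ s, s.length = Ls.length → c₁ * (Φ (π s) - c₃ / 2)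
      ≤ ∑ j ∈ Finset.range R, ‖S.E.C (sh S.T s.sum F * (B s * (φ j * star (B' s))))‖ := by
    intro s hs
    rw [hLs] at hs
    have hnn : ∀ j ∈ Finset.range R,
        0 ≤ ‖S.E.C (sh S.T s.sum F * (B s * (φ j * star (B' s))))‖ := fun j _ => norm_nonneg _
    rcases lt_or_ge (Φ (π s)) (c₃ / 2) with hlt | hge
    · exact (mul_nonpos_of_nonneg_of_nonpos hc₁0.le (by linarith)).trans (Finset.sum_nonneg hnn)
    -- the cube of eigenfunctions does not vanish
    have hgm' : (cube (π s) fun s => g s m) = cube (π s) η := by simp [hg]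
    have hψ0 : cube (π s) η ≠ 0 := fun h0 => by
      have hz : Φ (π s) = 0 := by
        rw [hΦ]
        simp only [norm_eq_zero]
        have : ∀ n, S.E.C (∏ i, sh S.T ((P i).eval n) (cube (π s) fun s => g s i)) = 0 := fun n => by
          rw [Finset.prod_eq_zero (Finset.mem_univ m), map_zero]
          rw [hgm', h0]
          rfl
        rw [Av]
        simp_rw [this]
        exact Λ.C_const 0
      linarith
    obtain ⟨b, hb⟩ := (exists_uEig_cube hη (π s)).resolve_left hψ0
    obtain ⟨z, hz⟩ := hUR X S Λ (fun i => cube (π s) fun s => g s i) b herg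
      (fun i => measurable_cube (fun s => hgm s i) _) (fun i => cube_bd (fun s => hgb s i) _)
      (fun i hi him => by
        obtain ⟨b, hb⟩ := hfe i hi him
        refine exists_eig_cube (a := fun _ => b) (fun s => ?_) (π s)
        simpa [hg, him] using hb.sh s.sum)
      (by rw [hgm']; exact hb.toEig) hge
    obtain ⟨j, hj, w, hw⟩ : ∃ j : ℕ, j < R ∧ ∃ w : ℤ, b + w = j / R := by
      have hR0 : (0 : ℤ) < R := by exact_mod_cast hR
      refine ⟨(z % R).toNat, ?_, -(z / R), ?_⟩
      · have := Int.emod_lt_of_pos z hR0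
        have := Int.emod_nonneg z hR0.ne'
        omega
      · have h1 : (((z % R).toNat : ℤ) : ℝ) = (z : ℝ) - R * ((z / R : ℤ) : ℝ) := by
          rw [Int.toNat_of_nonneg (Int.emod_nonneg z hR0.ne'), Int.emod_def]
          push_cast
          ring
        rw [Int.cast_natCast] at h1
        rw [h1, ← hz, Int.cast_neg]
        field_simp
        ring
    have hb' : S.UEig (j / R) (cube (π s) η) := ⟨hw ▸ hb.toEig.add_int w, hb.unit⟩
    obtain ⟨c, hc, hcφ⟩ := hb'.toEig.eq_const_mul herg (hφe j ⟨_, hb'⟩)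
    have hηs : η s ≠ 0 := fun h0 => hψ0 (by rw [hBπ s hs, h0, zero_mul])
    have hunit := ((hη s).resolve_left hηs).unit
    have hae : ∀ᵐ x ∂S.μ, (Δ S.T s F * η s) x
        = c * (sh S.T s.sum F * (B s * (φ j * star (B' s)))) x := by
      filter_upwards [hcφ, hb.unit, hunit] with x h1 h2 h3
      rw [hBπ s hs] at h1 h2
      simp only [Pi.mul_apply] at h1 h2
      rw [norm_mul, h3, one_mul] at h2
      have h4 : η s x = c * φ j x * star (B' s x) := by
        rw [← h1, mul_assoc, Complex.star_def, Complex.mul_conj', h2]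
        simp
      rw [hBΔ s hs]
      simp only [Pi.mul_apply, Pi.star_apply]
      rw [h4]
      ring
    have h5 : c₁ ≤ ‖S.E.C (sh S.T s.sum F * (B s * (φ j * star (B' s))))‖ := by
      refine ((hη' s).resolve_left hηs).trans ?_
      rw [S.C_congr_ae ((hFb.Δ s).mul (hηe s).bd) (fun x => ?_) hae, St.C_mul, norm_mul]
      · exact mul_le_of_le_one_left (norm_nonneg _) hc
      · rw [norm_mul]
        exact mul_le_one₀ hc (norm_nonneg _) (((hFb.sh _).mul ((hlow j).bd s)) x)
    refine le_trans ?_ (Finset.single_le_sum hnn (Finset.mem_range.2 hj))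
    exact (mul_le_of_le_one_right hc₁0.le (by linarith [hΦ1 (π s)])).trans h5
  have key₆ := IM_mono Ls ((Bd.const c₁).mul ((hΦb.comp π).sub (Bd.const (c₃ / 2))))
    (Bd.sum _ fun j _ => Bd.of_le (fun _ => norm_nonneg _) (hlowb j)) key₅
  rw [St.R_mul, St.R_sub, St.R_const] at key₆
  have key₇ := le_V_of_le_sum hFb hR (fun j => hLs.symm ▸ hlow j) (c := c₁ * (c₃ / 2))
    (by positivity) ((mul_le_mul_of_nonneg_left (by linarith) hc₁0.le).trans key₆)
  rwa [hLs] at key₇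

end Sys

namespace Sys

section
variable {X : Type} [MeasurableSpace X] {S : Sys X}

theorem Eig.prod {ι : Type} (I : Finset ι) {a : ι → ℝ} {χ : ι → X → ℂ}
    (h : ∀ i ∈ I, S.Eig (a i) (χ i)) : S.Eig (∑ i ∈ I, a i) (∏ i ∈ I, χ i) := by
  classical
  induction I using Finset.induction_on with
  | empty => simpa using Eig.one
  | insert i I hi ih =>
    rw [Finset.sum_insert hi, Finset.prod_insert hi]
    exact (h i (Finset.mem_insert_self i I)).mul
      (ih fun j hj => h j (Finset.mem_insert_of_mem hj))

theorem Eig.C_eq_zero {a : ℝ} {χ : X → ℂ} (h : S.Eig a χ) (ha : ¬ ∃ z : ℤ, a = z) :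
    S.E.C χ = 0 := by
  have h1 := S.C_sh h.bd 1
  have h2 : S.E.C (PolyAvg.sh S.T 1 χ) = ee a * S.E.C χ := by
    rw [← St.C_mul]
    exact St.C_congr _ fun x => by simpa using h.sh_eq 1 x
  rw [h1] at h2
  have h3 : ee a ≠ 1 := fun h0 => ha (ee_eq_one_iff.1 h0)
  have h4 : (ee a - 1) * S.E.C χ = 0 := by rw [sub_mul, one_mul, ← h2, sub_self]
  exact (mul_eq_zero.1 h4).resolve_left (sub_ne_zero.2 h3)

variable {ι : Type} [Fintype ι] {P : ι → ℤ[X]} {Λ : Mean}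

theorem exists_dual_Av [DecidableEq ι] (S : Sys X) (P : ι → ℤ[X]) (Λ : Mean) {f : ι → X → ℂ}
    (hfm : ∀ i, Measurable (f i)) (hfb : ∀ i, Bd1 (f i)) (m : ι) : ∃ F : X → ℂ, Measurable F ∧
      Bd1 F ∧ ∀ g, Measurable g → Bd1 g → S.E.C (F * g) = Av P S Λ (Function.update f m g) := by
  obtain ⟨F, hF, hFb, h⟩ := S.exists_dual Λ
    (F := fun n => ∏ i ∈ Finset.univ.erase m, sh S.T ((P i).eval n - (P m).eval n) (f i))
    (fun n => by
      rw [Finset.prod_fn]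
      exact Finset.measurable_prod _ fun i _ => measurable_sh S.meas (hfm i) _)
    (fun n => Bd1.prod _ fun i _ => (hfb i).sh _)
  refine ⟨F, hF, hFb, fun g hg hgb => ?_⟩
  rw [h g hg hgb, Av]
  refine St.C_congr _ fun n => ?_
  rw [← S.C_sh ((Bd1.prod _ fun i _ => (hfb i).sh _).mul hgb) ((P m).eval n)]
  refine St.C_congr _ fun x => ?_
  rw [← Finset.mul_prod_erase _ _ (Finset.mem_univ m), mul_comm]
  simp only [Pi.mul_apply, Function.update_self, Finset.prod_apply, sh]
  congr 1
  refine Finset.prod_congr rfl fun i hi => ?_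
  rw [Function.update_of_ne (Finset.ne_of_mem_erase hi), ← Equiv.Perm.mul_apply, ← zpow_add,
    sub_add_cancel]

end

/-- The average is small when all functions with index outside `J` are eigenfunctions and the `j`-th
function is orthogonal to the eigenfunctions whose eigenvalue is rational with a fixed
denominator. -/
def RatChar {ι : Type} [Fintype ι] (P : ι → ℤ[X]) (J : Finset ι) (j : ι) : Prop :=
  ∀ ε > (0 : ℝ), ∃ R : ℕ, 0 < R ∧ ∀ (X : Type) [MeasurableSpace X] (S : Sys X) (Λ : Mean)
    (f : ι → X → ℂ), Ergodic S.T S.μ → (∀ i, Measurable (f i)) → (∀ i, Bd1 (f i)) →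
    (∀ i, i ∉ J → ∃ b, S.Eig b (f i)) →
    (∀ b χ, S.Eig b χ → (∃ z : ℤ, R * b = z) → S.E.C (f j * star χ) = 0) → ‖Av P S Λ f‖ < ε

variable {ι : Type} [Fintype ι] {P : ι → ℤ[X]}

theorem RatChar.ratEig {J : Finset ι} {m : ι} (h : RatChar P J m) : RatEig P J m := by
  intro ε hε
  obtain ⟨R, hR, hU⟩ := h ε hε
  refine ⟨R, hR, fun X _ S Λ f a herg hfm hfb hfe ha hle => ?_⟩
  by_contra hz
  refine absurd hle (not_le.2 (hU X S Λ f herg hfm hfb (fun i hi => ?_) ?_))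
  · by_cases him : i = m
    · exact ⟨a, him ▸ ha⟩
    · exact hfe i hi him
  · rintro b χ hχ ⟨w, hw⟩
    refine (ha.mul hχ.star).C_eq_zero ?_
    rintro ⟨z, hz'⟩
    refine hz ⟨R * z + w, ?_⟩
    push_cast
    rw [← hw, ← hz']
    ring

variable [DecidableEq ι]

theorem ratChar_of_subset (hW : WeylGood P) {J : Finset ι} {j : ι} (hJ : ∀ i ∈ J, i = j) :
    RatChar P J j := by
  intro ε hε
  obtain ⟨R, hR, hU⟩ := hW ε hε
  refine ⟨R, hR, fun X _ S Λ f herg hfm hfb hfe horth => ?_⟩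
  have hb : ∀ i, ∃ b, i ≠ j → S.Eig b (f i) := fun i => by
    by_cases hi : i = j
    · exact ⟨0, fun h => absurd hi h⟩
    · obtain ⟨b, hb⟩ := hfe i fun h => hi (hJ i h)
      exact ⟨b, fun _ => hb⟩
  choose b hb using hb
  set g : X → ℂ := ∏ i ∈ Finset.univ.erase j, f i with hg
  set β : ℝ := ∑ i ∈ Finset.univ.erase j, b i with hβ
  have hge : S.Eig β g := Eig.prod _ fun i hi => hb i (Finset.ne_of_mem_erase hi)
  set α : ι → ℝ := Function.update b j (-β) with hα
  have hαi : ∀ i ∈ Finset.univ.erase j, α i = b i := fun i hi => by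
    rw [hα, Function.update_of_ne (Finset.ne_of_mem_erase hi)]
  have hsum : ∑ i, α i = 0 := by
    rw [← Finset.add_sum_erase _ _ (Finset.mem_univ j), Finset.sum_congr rfl hαi]
    simp [hα, hβ]
  have hAv : Av P S Λ f
      = S.E.C (f j * g) * Λ.C fun n => ee (∑ i, α i * ((P i).eval n : ℤ)) := by
    rw [Av, ← St.C_mul]
    refine St.C_congr _ fun n => ?_
    set k := (P j).eval n with hk
    have e1 : S.E.C (sh S.T k (f j * sh S.T (-k) g)) = S.E.C (f j * sh S.T (-k) g) :=
      S.C_sh ((hfb j).mul (hge.bd.sh _)) k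
    have e2 : S.E.C (f j * sh S.T (-k) g) = ee (-k * β) * S.E.C (f j * g) := by
      rw [← St.C_mul]
      refine St.C_congr _ fun x => ?_
      rw [Pi.mul_apply, hge.sh_eq, Pi.mul_apply]
      push_cast
      ring
    have e3 : S.E.C (∏ i, sh S.T ((P i).eval n) (f i))
        = ee (∑ i ∈ Finset.univ.erase j, α i * ((P i).eval n : ℤ))
          * S.E.C (sh S.T k (f j * sh S.T (-k) g)) := by
      rw [← St.C_mul]
      refine St.C_congr _ fun x => ?_
      rw [← Finset.mul_prod_erase _ _ (Finset.mem_univ j), sh_mul, sh_sh, add_neg_cancel, sh_zero,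
        ee_sum, Pi.mul_apply, Pi.mul_apply, Finset.prod_apply, hg, Finset.prod_apply,
        mul_left_comm, ← Finset.prod_mul_distrib]
      congr 1
      refine Finset.prod_congr rfl fun i hi => ?_
      rw [(hb i (Finset.ne_of_mem_erase hi)).sh_eq, hαi i hi, mul_comm (b i)]
    rw [e3, e1, e2, ← Finset.add_sum_erase _ _ (Finset.mem_univ j), ee_add, hα,
      Function.update_self, neg_mul, neg_mul, mul_comm β]
    ring
  by_contra! hle
  have hle' : ε ≤ ‖Λ.C fun n => ee (∑ i, α i * ((P i).eval n : ℤ))‖ := by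
    refine hle.trans ?_
    rw [hAv, norm_mul]
    exact mul_le_of_le_one_left (norm_nonneg _) (S.E.norm_C_le_one ((hfb j).mul hge.bd))
  obtain ⟨z, hz⟩ := hU α Λ hsum hle' j
  have h0 := horth _ _ hge.star ⟨z, by simpa [hα] using hz⟩
  rw [star_star] at h0
  rw [hAv, h0, zero_mul, norm_zero] at hle
  exact absurd hε (not_lt.2 hle)

/-- Iterated degree lowering. -/
theorem exists_singleton_of_le_V {J : Finset ι} {m : ι} (hU : RatEig P J m) (n : ℕ) {δ : ℝ}
    (hδ : 0 < δ) : ∃ δ' > 0,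
    ∀ (X : Type) [MeasurableSpace X] (S : Sys X) (Λ : Mean) (f : ι → X → ℂ) (F : X → ℂ),
    Ergodic S.T S.μ → (∀ i, Measurable (f i)) → (∀ i, Bd1 (f i)) →
    (∀ i, i ∉ J → i ≠ m → ∃ b, S.Eig b (f i)) → Measurable F → Bd1 F →
    (∀ g, Measurable g → Bd1 g → S.E.C (F * g) = Av P S Λ (Function.update f m g)) →
    ∀ Ls : List Mean, 1 ≤ Ls.length → Ls.length ≤ n + 1 → δ ≤ S.V Ls F →
    ∃ Λ' : Mean, δ' ≤ S.V [Λ'] F := by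
  induction n generalizing δ with
  | zero =>
    refine ⟨δ, hδ, fun X _ S Λ f F _ _ _ _ _ _ _ Ls h1 h2 hV => ?_⟩
    obtain ⟨Λ', rfl⟩ := List.length_eq_one_iff.1 (le_antisymm h2 h1)
    exact ⟨Λ', hV⟩
  | succ n ih =>
    obtain ⟨δ₁, hδ₁, h₁⟩ := degree_lowering hU (r := n + 1) (by omega) hδ
    obtain ⟨δ₂, hδ₂, h₂⟩ := ih (lt_min hδ hδ₁)
    refine ⟨δ₂, hδ₂, fun X _ S Λ f F herg hfm hfb hfe hFm hFb hF Ls hl1 hl2 hV => ?_⟩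
    have hrec := h₂ X S Λ f F herg hfm hfb hfe hFm hFb hF
    rcases hl2.lt_or_eq with hlt | heq
    · exact hrec Ls hl1 (by omega) ((min_le_left _ _).trans hV)
    · obtain ⟨L, Λ', rfl⟩ := (List.eq_nil_or_concat' Ls).resolve_left (by
        rintro rfl
        simp at hl1)
      have hL : L.length = n + 1 := by simpa using heq
      exact hrec L (by omega) (by omega) ((min_le_right _ _).trans
        (h₁ X S Λ f F herg hfm hfb hfe hFm hFb hF L Λ' hL hV))

theorem RatChar.step (hP : ∀ i j, i ≠ j → 1 ≤ (P i - P j).natDegree) {J : Finset ι} {j m : ι}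
    (hm : m ∈ J) (hmj : m ≠ j) (hj : RatChar P (J.erase m) j) (hmm : RatChar P (J.erase m) m) :
    RatChar P J j := by
  have : Nontrivial ι := ⟨m, j, hmj⟩
  intro ε hε
  obtain ⟨c, hc, N, hctrl⟩ := exists_ctrl P hP m (δ := ε ^ 2) (by positivity)
  obtain ⟨δ, hδ, hlow⟩ :=
    exists_singleton_of_le_V hmm.ratEig N hc
  obtain ⟨R, hR, hU⟩ := hj (δ ^ 4 / 16) (by positivity)
  refine ⟨R, hR, fun X _ S Λ f herg hfm hfb hfe horth => ?_⟩
  by_contra! hle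
  obtain ⟨F, hFm, hFb, hF⟩ := exists_dual_Av S P Λ hfm hfb m
  have hAv : Av P S Λ f = S.E.C (F * f m) := by
    rw [hF _ (hfm m) (hfb m), Function.update_eq_self]
  have hFs := hF (star F) (measurable_star_comp hFm) hFb.star
  have hbig : ε ^ 2 ≤ ‖Av P S Λ (Function.update f m (star F))‖ := by
    rw [← hFs]
    have h1 : ‖S.E.C (F * f m)‖ ^ 2 ≤ S.E.R fun x => ‖F x‖ ^ 2 :=
      (S.E.norm_C_sq_le (hFb.mul (hfb m)).norm).trans (S.E.mono
        ((hFb.mul (hfb m)).norm.pow 2) (hFb.norm.pow 2) fun x => by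
          rw [Pi.mul_apply, norm_mul]
          exact pow_le_pow_left₀ (by positivity)
            (mul_le_of_le_one_right (norm_nonneg _) (hfb m x)) 2)
    have h2 : S.E.C (F * star F) = ((S.E.R fun x => ‖F x‖ ^ 2 : ℝ) : ℂ) := by
      rw [← St.C_ofReal]
      refine St.C_congr _ fun x => ?_
      rw [Pi.mul_apply, Pi.star_apply, Complex.star_def, Complex.mul_conj']
      push_cast
      rfl
    rw [h2, Complex.norm_real]
    rw [hAv] at hle
    exact ((pow_le_pow_left₀ hε.le hle 2).trans h1).trans (le_abs_self _)
  have hub : ∀ g, Bd1 g → ∀ i, Bd1 (Function.update f m g i) := fun g hg i => by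
    by_cases hi : i = m
    · subst hi
      simpa using hg
    · simpa [hi] using hfb i
  have hum : ∀ g, Measurable g → ∀ i, Measurable (Function.update f m g i) := fun g hg i => by
    by_cases hi : i = m
    · subst hi
      simpa using hg
    · simpa [hi] using hfm i
  obtain ⟨Ls, hL1, hLN, hV⟩ := hctrl X S.toDyn Λ _ (hub _ hFb.star) hbig
  have hVs : S.V Ls (star F) = S.V Ls F := by
    simp only [Dyn.V, Δ_star, St.C_star, norm_star]
  rw [Function.update_self, hVs] at hV
  obtain ⟨Λ', hΛ'⟩ := hlow X S Λ f F herg hfm hfb (fun i hi him => hfe i fun h =>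
    hi (Finset.mem_erase.2 ⟨him, h⟩)) hFm hFb hF Ls hL1 (by omega) hV
  obtain ⟨a, χ, hχ, hχF⟩ := S.exists_eig hFm hFb hδ Λ' hΛ'
  rw [hF _ hχ.star.meas hχ.star.bd] at hχF
  refine absurd hχF (not_le.2 (hU X S Λ _ herg (hum _ hχ.star.meas) (hub _ hχ.star.bd)
    (fun i hi => ?_) ?_))
  · by_cases him : i = m
    · subst him
      exact ⟨_, by simpa using hχ.star⟩
    · obtain ⟨b, hb⟩ := hfe i fun h => hi (Finset.mem_erase.2 ⟨him, h⟩)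
      exact ⟨b, by simpa [him] using hb⟩
  · rw [Function.update_of_ne hmj.symm]
    exact horth

theorem ratChar (hW : WeylGood P) (hP : ∀ i j, i ≠ j → 1 ≤ (P i - P j).natDegree)
    (J : Finset ι) (j : ι) : RatChar P J j := by
  induction J using Finset.strongInduction generalizing j with
  | H J ih =>
    by_cases h : ∀ i ∈ J, i = j
    · exact ratChar_of_subset hW h
    · push Not at h
      obtain ⟨m, hm, hmj⟩ := h
      exact RatChar.step hP hm hmj (ih _ (Finset.erase_ssubset hm) j)
        (ih _ (Finset.erase_ssubset hm) m)

/-- In an ergodic system the averages vanish as soon as one of the functions is orthogonal to the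
eigenfunctions with rational eigenvalue. -/
theorem Av_eq_zero (hW : WeylGood P) (hP : ∀ i j, i ≠ j → 1 ≤ (P i - P j).natDegree)
    {X : Type} [MeasurableSpace X] (S : Sys X) (Λ : Mean) {f : ι → X → ℂ}
    (herg : Ergodic S.T S.μ) (hfm : ∀ i, Measurable (f i)) (hfb : ∀ i, Bd1 (f i)) {j : ι}
    (horth : ∀ R : ℕ, 0 < R → ∀ b χ, S.Eig b χ → (∃ z : ℤ, R * b = z) →
      S.E.C (f j * star χ) = 0) : Av P S Λ f = 0 := by
  by_contra h
  obtain ⟨R, hR, hU⟩ := ratChar hW hP Finset.univ j ‖Av P S Λ f‖ (norm_pos_iff.2 h)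
  exact (hU X S Λ f herg hfm hfb (fun i hi => absurd (Finset.mem_univ i) hi) (horth R hR)).false

end Sys

/-! ### Ergodic decomposition -/

section
variable {Y : Type} [mY : MeasurableSpace Y] {ρ : Measure Y} {T : Y → Y}

variable (T ρ) in
/-- The `σ`-algebra of almost everywhere invariant sets. -/
@[reducible]
def aeInv : MeasurableSpace Y where
  MeasurableSet' A := MeasurableSet A ∧ T ⁻¹' A =ᵐ[ρ] A
  measurableSet_empty := ⟨MeasurableSet.empty, by simp⟩
  measurableSet_compl A h := ⟨h.1.compl, by rw [Set.preimage_compl]; exact h.2.compl⟩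
  measurableSet_iUnion A h := ⟨MeasurableSet.iUnion fun n => (h n).1, by
    rw [Set.preimage_iUnion]
    exact Filter.EventuallyEq.countable_iUnion fun n => (h n).2⟩

theorem aeInv_le : aeInv ρ T ≤ mY := fun _ h => h.1

theorem measurable_aeInv {g : Y → ℂ} (hg : Measurable g)
    (hgT : g ∘ T =ᵐ[ρ] g) : Measurable[aeInv ρ T] g := fun C hC =>
  ⟨hg hC, by
    rw [← Set.preimage_comp]
    filter_upwards [hgT] with y hy
    have h1 : (y ∈ (g ∘ T) ⁻¹' C) = (y ∈ g ⁻¹' C) := by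
      simp only [Set.mem_preimage, hy]
    exact h1⟩

theorem coeFn_finset_sum (s : Finset ℕ) (g : ℕ → Lp ℂ 2 ρ) :
    ∀ᵐ y ∂ρ, (∑ n ∈ s, g n : Lp ℂ 2 ρ) y = ∑ n ∈ s, g n y := by
  induction s using Finset.induction_on with
  | empty =>
    filter_upwards [Lp.coeFn_zero ℂ 2 ρ] with y hy
    simpa using hy
  | insert i s hi ih =>
    rw [Finset.sum_insert hi]
    filter_upwards [Lp.coeFn_add (g i) (∑ n ∈ s, g n), ih] with y h1 h2
    rw [h1, Pi.add_apply, h2, Finset.sum_insert hi]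

theorem measurable_birkhoffAverage (hT : Measurable T) {u : Y → ℂ} (hu : Measurable u) (N : ℕ) :
    Measurable (birkhoffAverage ℂ T u N) := by
  have : birkhoffAverage ℂ T u N = fun y => (N : ℂ)⁻¹ * ∑ n ∈ Finset.range N, u (T^[n] y) := rfl
  rw [this]
  exact (Finset.measurable_sum _ fun n _ => hu.comp (hT.iterate n)).const_mul _

variable [IsProbabilityMeasure ρ]

/-- The mean ergodic theorem for bounded functions. -/
theorem exists_mean_limit (hT : MeasurePreserving T ρ ρ) {u : Y → ℂ} (hu : Measurable u)
    (hb : Bd1 u) : ∃ g : Y → ℂ, Measurable g ∧ g ∘ T =ᵐ[ρ] g ∧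
      Tendsto (fun N : ℕ => ∫⁻ y, ‖birkhoffAverage ℂ T u (N + 1) y - g y‖ₑ ∂ρ) atTop (nhds 0) := by
  have hL : MemLp u 2 ρ := memLp_of_bd1 hu hb
  let U : Lp ℂ 2 ρ →L[ℂ] Lp ℂ 2 ρ := (Lp.compMeasurePreservingₗᵢ ℂ T hT).toContinuousLinearMap
  have hU : ‖U‖ ≤ 1 := LinearIsometry.norm_toContinuousLinearMap_le _
  have hlim := U.tendsto_birkhoffAverage_orthogonalProjection hU (hL.toLp u)
  set G := (U.eqLocus (1 : Lp ℂ 2 ρ →L[ℂ] Lp ℂ 2 ρ)).orthogonalProjectionOnto (hL.toLp u) with hG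
  have hGU : Lp.compMeasurePreserving T hT (G : Lp ℂ 2 ρ) = G := G.2
  refine ⟨(G : Lp ℂ 2 ρ), (Lp.stronglyMeasurable _).measurable, ?_, ?_⟩
  · have := Lp.coeFn_compMeasurePreserving (G : Lp ℂ 2 ρ) hT
    rw [hGU] at this
    exact this.symm
  · have hiter : ∀ n, U^[n] (hL.toLp u) = (hL.comp_measurePreserving (hT.iterate n)).toLp _ :=
      fun n => congrFun (Lp.compMeasurePreserving_iterate (E := ℂ) (p := 2) hT n) (hL.toLp u)
    have hco : ∀ N, (birkhoffAverage ℂ U id N (hL.toLp u) : Lp ℂ 2 ρ)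
        =ᵐ[ρ] birkhoffAverage ℂ T u N := fun N => by
      have h1 : (birkhoffAverage ℂ U id N (hL.toLp u) : Lp ℂ 2 ρ)
          = (N : ℂ)⁻¹ • ∑ n ∈ Finset.range N, (hL.comp_measurePreserving (hT.iterate n)).toLp _ := by
        simp only [birkhoffAverage, birkhoffSum, id, hiter]
      have h2 : ∀ᵐ y ∂ρ, ∀ n : ℕ, ((hL.comp_measurePreserving (hT.iterate n)).toLp _ : Lp ℂ 2 ρ) y
          = u (T^[n] y) := ae_all_iff.2 fun n => MemLp.coeFn_toLp _
      rw [h1]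
      filter_upwards [Lp.coeFn_smul (N : ℂ)⁻¹ (∑ n ∈ Finset.range N,
        (hL.comp_measurePreserving (hT.iterate n)).toLp _), coeFn_finset_sum (Finset.range N)
        (fun n => (hL.comp_measurePreserving (hT.iterate n)).toLp _), h2] with y h3 h4 h5
      rw [h3, Pi.smul_apply, h4, Finset.sum_congr rfl fun n _ => h5 n]
      rfl
    have h1 : Tendsto (fun N : ℕ => eLpNorm (fun y => birkhoffAverage ℂ T u (N + 1) y
        - (G : Lp ℂ 2 ρ) y) 2 ρ) atTop (nhds 0) := by
      have h2 := (Lp.tendsto_Lp_iff_tendsto_eLpNorm' _ _).1 (hlim.comp (tendsto_add_atTop_nat 1))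
      refine h2.congr fun N => eLpNorm_congr_ae ?_
      filter_upwards [hco (N + 1)] with y hy
      simp only [Function.comp_apply, Pi.sub_apply]
      rw [hy]
    refine tendsto_of_tendsto_of_tendsto_of_le_of_le tendsto_const_nhds h1 (fun _ => zero_le)
      fun N => ?_
    rw [← eLpNorm_one_eq_lintegral_enorm]
    exact eLpNorm_le_eLpNorm_of_exponent_le (by norm_num)
      ((measurable_birkhoffAverage hT.measurable hu _).sub
        (Lp.stronglyMeasurable _).measurable).aestronglyMeasurable

variable [StandardBorelSpace Y]

theorem measurable_enorm_sub_prod {A B : Type} [MeasurableSpace A] [MeasurableSpace B] {u : B → ℂ}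
    {g : A → ℂ} (hu : Measurable u) (hg : Measurable g) :
    Measurable fun q : A × B => ‖u q.2 - g q.1‖ₑ :=
  ((hu.comp measurable_snd).sub (hg.comp measurable_fst)).enorm

open ProbabilityTheory in
theorem ae_exists_lintegral_lt {Y : Type} {m : MeasurableSpace Y} [mY : MeasurableSpace Y]
    [StandardBorelSpace Y] {ρ : Measure Y} [IsProbabilityMeasure ρ] (hm : m ≤ mY) {u : ℕ → Y → ℂ}
    (hu : ∀ N, Measurable (u N)) {g : Y → ℂ} (hg : Measurable[m] g)
    (h : Tendsto (fun N => ∫⁻ y, ‖u N y - g y‖ₑ ∂ρ) atTop (nhds 0)) :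
    ∀ᵐ ω ∂ρ, ∀ ε > 0, ∃ N, ∫⁻ y, ‖u N y - g ω‖ₑ ∂(condExpKernel ρ m ω) < ε := by
  have hmeas : ∀ N, Measurable[m.prod mY] fun q : Y × Y => ‖u N q.2 - g q.1‖ₑ := fun N =>
    @measurable_enorm_sub_prod Y Y m mY _ _ (hu N) hg
  have hk : ∀ N, Measurable[m] fun ω => ∫⁻ y, ‖u N y - g ω‖ₑ ∂(condExpKernel ρ m ω) := fun N =>
    @Measurable.lintegral_kernel_prod_right' Y Y m mY (condExpKernel ρ m) _ _ (hmeas N)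
  have hintegral : ∀ N, ∫⁻ ω, ∫⁻ y, ‖u N y - g ω‖ₑ ∂(condExpKernel ρ m ω) ∂ρ
      = ∫⁻ y, ‖u N y - g y‖ₑ ∂ρ := fun N => by
    rw [← lintegral_trim hm (hk N), ← Measure.lintegral_compProd (hmeas N),
      compProd_trim_condExpKernel hm]
    exact @lintegral_map Y (Y × Y) mY (m.prod mY) ρ _ _ (hmeas N)
      (@Measurable.prodMk Y mY Y Y m mY _ _ (measurable_id'' hm) measurable_id)
  have h0 : ∫⁻ ω, ⨅ N, ∫⁻ y, ‖u N y - g ω‖ₑ ∂(condExpKernel ρ m ω) ∂ρ = 0 := by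
    refine le_antisymm (ge_of_tendsto h (Eventually.of_forall fun N => ?_)) zero_le
    rw [← hintegral N]
    exact lintegral_mono fun ω => iInf_le _ N
  rw [lintegral_eq_zero_iff (Measurable.iInf fun N => (hk N).mono hm le_rfl)] at h0
  filter_upwards [h0] with ω hω ε hε
  rw [Pi.zero_apply] at hω
  exact iInf_lt_iff.1 (hω ▸ hε)

variable (Y) in
theorem exists_countable_piSystem : ∃ C : Set (Set Y), C.Countable ∧ IsPiSystem C ∧
    mY = MeasurableSpace.generateFrom C := by
  refine ⟨generateSetAlgebra (MeasurableSpace.countableGeneratingSet Y),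
    countable_generateSetAlgebra MeasurableSpace.countable_countableGeneratingSet,
    fun s hs t ht _ => isSetAlgebra_generateSetAlgebra.inter_mem hs ht, ?_⟩
  rw [generateFrom_generateSetAlgebra_eq, MeasurableSpace.generateFrom_countableGeneratingSet]

open ProbabilityTheory in
theorem ae_measurePreserving (hT : MeasurePreserving T ρ ρ) :
    ∀ᵐ ω ∂ρ, MeasurePreserving T (condExpKernel ρ (aeInv ρ T) ω)
      (condExpKernel ρ (aeInv ρ T) ω) := by
  obtain ⟨C, hC, hCπ, hCg⟩ := exists_countable_piSystem Y
  have hCm : ∀ A ∈ C, MeasurableSet A := fun A hA => by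
    rw [hCg]
    exact MeasurableSpace.measurableSet_generateFrom hA
  have hm : aeInv ρ T ≤ mY := aeInv_le
  have key : ∀ A ∈ C, ∀ᵐ ω ∂ρ,
      condExpKernel ρ (aeInv ρ T) ω (T ⁻¹' A) = condExpKernel ρ (aeInv ρ T) ω A := fun A hA => by
    have hAm := hCm A hA
    have hTA := hT.measurable hAm
    have h1 := condExpKernel_ae_eq_condExp (μ := ρ) hm hAm
    have h2 := condExpKernel_ae_eq_condExp (μ := ρ) hm hTA
    have h3 : ρ⟦A | aeInv ρ T⟧ =ᵐ[ρ] ρ⟦T ⁻¹' A | aeInv ρ T⟧ := by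
      refine ae_eq_condExp_of_forall_setIntegral_eq hm
        ((integrable_const _).indicator hTA) (fun s _ _ => integrable_condExp.integrableOn)
        (fun s hs _ => ?_) stronglyMeasurable_condExp.aestronglyMeasurable
      rw [setIntegral_condExp hm ((integrable_const _).indicator hAm) hs,
        integral_indicator_const _ hAm, integral_indicator_const _ hTA,
        measureReal_restrict_apply hAm, measureReal_restrict_apply hTA]
      congr 1
      have h4 : (T ⁻¹' A ∩ s : Set Y) =ᵐ[ρ] T ⁻¹' (A ∩ s) := by
        rw [Set.preimage_inter]
        exact EventuallyEq.rfl.inter hs.2.symm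
      rw [measureReal_congr h4, measureReal_def, measureReal_def,
        hT.measure_preimage (hAm.inter (hm s hs)).nullMeasurableSet]
    filter_upwards [h1, h2, h3] with ω e1 e2 e3
    have : (condExpKernel ρ (aeInv ρ T) ω).real (T ⁻¹' A) = (condExpKernel ρ (aeInv ρ T) ω).real A := by
      rw [e2, e1, e3]
    exact (measureReal_eq_measureReal_iff).1 this
  filter_upwards [(ae_ball_iff hC).2 key] with ω hω
  refine ⟨hT.measurable, ext_of_generate_finite C hCg hCπ (fun A hA => ?_) ?_⟩
  · rw [Measure.map_apply hT.measurable (hCm A hA), hω A hA]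
  · rw [Measure.map_apply hT.measurable MeasurableSet.univ, Set.preimage_univ]

/-- The components of the ergodic decomposition are ergodic. -/
theorem ae_ergodic (hT : MeasurePreserving T ρ ρ) :
    ∀ᵐ ω ∂ρ, Ergodic T (ProbabilityTheory.condExpKernel ρ (aeInv ρ T) ω) := by
  obtain ⟨C, hC, hCπ, hCg⟩ := exists_countable_piSystem Y
  have hCm : ∀ A ∈ C, MeasurableSet A := fun A hA => by
    rw [hCg]
    exact MeasurableSpace.measurableSet_generateFrom hA
  have hm : aeInv ρ T ≤ mY := aeInv_le
  have key : ∀ A ∈ C, ∀ᵐ ω ∂ρ, ∃ c : ℂ, ∀ ε > 0, ∃ N : ℕ,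
      ∫⁻ y, ‖birkhoffAverage ℂ T (A.indicator 1) (N + 1) y - c‖ₑ
        ∂(ProbabilityTheory.condExpKernel ρ (aeInv ρ T) ω) < ε := fun A hA => by
    have hAm : Measurable (A.indicator (1 : Y → ℂ)) := measurable_one.indicator (hCm A hA)
    obtain ⟨g, hg, hgT, hlim⟩ := exists_mean_limit hT hAm fun y => by
      by_cases hy : y ∈ A <;> simp [hy]
    filter_upwards [ae_exists_lintegral_lt hm
      (fun N => measurable_birkhoffAverage hT.measurable hAm (N + 1))
      (measurable_aeInv hg hgT) hlim] with ω hω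
    exact ⟨g ω, hω⟩
  filter_upwards [ae_measurePreserving hT, (ae_ball_iff hC).2 key] with ω hmp hω
  set κ := ProbabilityTheory.condExpKernel ρ (aeInv ρ T) ω with hκ
  refine ⟨hmp, ⟨fun B hB hBT => ?_⟩⟩
  -- invariant sets are independent of the generating sets
  have hfac : ∀ A ∈ C, ∃ c : ℂ, ∀ B : Set Y, MeasurableSet B → T ⁻¹' B = B →
      (κ.real (A ∩ B) : ℂ) = c * κ.real B := fun A hA => by
    obtain ⟨c, hc⟩ := hω A hA
    refine ⟨c, fun B hB hBT => ?_⟩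
    have hBn : ∀ n, T^[n] ⁻¹' B = B := fun n => by
      rw [Set.preimage_iterate_eq, Function.iterate_fixed hBT]
    have hAm : Measurable (A.indicator (1 : Y → ℂ)) := measurable_one.indicator (hCm A hA)
    have hi : ∀ n, Integrable (fun y => A.indicator (1 : Y → ℂ) (T^[n] y)) (κ.restrict B) :=
      fun n => integrable_of_bd1 (hAm.comp (hT.measurable.iterate n)) fun y => by
        by_cases hy : T^[n] y ∈ A <;> simp [hy]
    have hterm : ∀ n, ∫ y in B, A.indicator (1 : Y → ℂ) (T^[n] y) ∂κ = κ.real (A ∩ B) := fun n => by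
      have e1 : (fun y => A.indicator (1 : Y → ℂ) (T^[n] y))
          = (T^[n] ⁻¹' A).indicator fun _ => 1 := rfl
      have hTA := hT.measurable.iterate n (hCm A hA)
      rw [e1, integral_indicator_const _ hTA, measureReal_restrict_apply hTA,
        Complex.real_smul, mul_one]
      congr 1
      nth_rewrite 1 [← hBn n]
      rw [← Set.preimage_inter, measureReal_def, measureReal_def,
        (hmp.iterate n).measure_preimage ((hCm A hA).inter hB).nullMeasurableSet]
    have hav : ∀ N : ℕ, ∫ y in B, (birkhoffAverage ℂ T (A.indicator 1) (N + 1) y - c) ∂κ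
        = κ.real (A ∩ B) - c * κ.real B := fun N => by
      have e2 : ∀ y, birkhoffAverage ℂ T (A.indicator 1) (N + 1) y - c = ((N + 1 : ℕ) : ℂ)⁻¹ *
        ∑ n ∈ Finset.range (N + 1), A.indicator (1 : Y → ℂ) (T^[n] y) - c := fun y => rfl
      simp_rw [e2]
      rw [integral_sub ((integrable_finsetSum _ fun n _ => hi n).const_mul _)
        (integrable_const _), integral_const_mul, integral_finsetSum _ fun n _ => hi n,
        Finset.sum_congr rfl fun n _ => hterm n, Finset.sum_const, Finset.card_range,
        nsmul_eq_mul, inv_mul_cancel_left₀ (by exact_mod_cast Nat.succ_ne_zero N), integral_const]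
      simp [mul_comm]
    rw [← sub_eq_zero, ← enorm_eq_zero, ← nonpos_iff_eq_zero]
    refine le_of_forall_gt fun ε hε => ?_
    obtain ⟨N, hN⟩ := hc ε hε
    rw [← hav N]
    exact ((enorm_integral_le_lintegral_enorm _).trans
      (lintegral_mono' Measure.restrict_le_self le_rfl)).trans_lt hN
  have hprod : ∀ A ∈ C, κ (A ∩ B) = κ B * κ A := fun A hA => by
    obtain ⟨c, hc⟩ := hfac A hA
    have h1 := hc B hB hBT
    have h2 := hc Set.univ MeasurableSet.univ Set.preimage_univ
    rw [Set.inter_univ, probReal_univ, Complex.ofReal_one, mul_one] at h2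
    rw [← h2] at h1
    have h3 : κ.real (A ∩ B) = κ.real A * κ.real B := by exact_mod_cast h1
    rw [measureReal_def, measureReal_def, measureReal_def, ← ENNReal.toReal_mul, mul_comm,
      ENNReal.toReal_eq_toReal_iff' (measure_ne_top _ _)
        (ENNReal.mul_ne_top (measure_ne_top _ _) (measure_ne_top _ _))] at h3
    exact h3
  have hrestr : κ.restrict B = κ B • κ := by
    refine ext_of_generate_finite C hCg hCπ (fun A hA => ?_) ?_
    · rw [Measure.restrict_apply (hCm A hA), hprod A hA, Measure.smul_apply, smul_eq_mul]
    · simp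
  have hBB : κ B = κ B * κ B := by
    have := congrArg (fun ν : Measure Y => ν B) hrestr
    simpa [Measure.restrict_apply hB] using this
  rw [eventuallyConst_set']
  rcases eq_or_ne (κ B) 0 with h0 | h0
  · exact Or.inl (ae_eq_empty.2 h0)
  · refine Or.inr ((ae_eq_univ_iff_measure_eq hB.nullMeasurableSet).2 ?_)
    rw [measure_univ]
    exact ((ENNReal.mul_eq_left h0 (measure_ne_top _ _)).1 hBB.symm)

end

/-! ### Vanishing of averages on standard Borel systems -/

section
variable {ι : Type} [Fintype ι] {P : ι → ℤ[X]} {Y : Type}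

theorem norm_prod_apply_le_one {f : ι → Y → ℂ} (hfb : ∀ i, Bd1 (f i)) (y : ι → Y) :
    ‖∏ i, f i (y i)‖ ≤ 1 := by
  rw [norm_prod]
  exact Finset.prod_le_one (fun _ _ => norm_nonneg _) fun i _ => hfb i _

variable [MeasurableSpace Y]

theorem Sys.measurable_prod_sh (S : Sys Y) {f : ι → Y → ℂ} (hfm : ∀ i, Measurable (f i))
    (q : ι → ℤ) : Measurable (∏ i, sh S.T (q i) (f i)) := by
  rw [Finset.prod_fn]
  exact Finset.measurable_prod _ fun i _ => measurable_sh S.meas (hfm i) _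

/-- The average of a function along multiples of `r` has the same correlation with an
eigenfunction whose eigenvalue is an `r`-th root of unity as the function itself. -/
theorem Sys.C_mul_star_eig (S : Sys Y) {u : Y → ℂ} (hu : Measurable u) (hub : Bd1 u) {r : ℕ}
    {b : ℝ} {χ : Y → ℂ} (hχ : S.Eig b χ) {z : ℤ} (hz : r * b = z) (N : ℕ) :
    S.E.C (u * star χ) = ∫ x, (((N + 1 : ℕ) : ℂ)⁻¹ * ∑ k ∈ Finset.range (N + 1),
      u ((S.T ^ (r * k : ℤ)) x)) * star (χ x) ∂S.μ := by
  have hinv : ∀ k : ℕ, S.E.C (sh S.T (r * k : ℤ) u * star χ) = S.E.C (u * star χ) := fun k => by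
    have h1 : sh S.T (r * k : ℤ) χ = χ := by
      ext x
      rw [hχ.sh_eq]
      have : (((r * k : ℤ) : ℝ) * b) = ((k * z : ℤ) : ℝ) := by
        push_cast
        rw [← hz]
        ring
      rw [this, ee_int, one_mul]
    have h2 := S.toDyn.C_sh (hub.mul hχ.bd.star) (r * k : ℤ)
    rw [sh_mul, sh_star, h1] at h2
    exact h2
  have hi : ∀ k : ℕ, Integrable (fun x => u ((S.T ^ (r * k : ℤ)) x) * star (χ x)) S.μ := fun k =>
    integrable_of_bd1 ((measurable_sh S.meas hu _).mul (measurable_star_comp hχ.meas))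
      ((hub.sh _).mul hχ.bd.star)
  have hk : ∀ k : ℕ, ∫ x, u ((S.T ^ (r * k : ℤ)) x) * star (χ x) ∂S.μ = S.E.C (u * star χ) :=
    fun k => by
      rw [← hinv k, S.C_eq ((measurable_sh S.meas hu _).mul (measurable_star_comp hχ.meas))
        ((hub.sh _).mul hχ.bd.star)]
      rfl
  simp_rw [mul_assoc, Finset.sum_mul]
  rw [integral_const_mul, integral_finsetSum _ fun k _ => hi k, Finset.sum_congr rfl fun k _ => hk k,
    Finset.sum_const, Finset.card_range, nsmul_eq_mul,
    inv_mul_cancel_left₀ (by exact_mod_cast Nat.succ_ne_zero N)]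

variable [DecidableEq ι]

theorem tendsto_average_of_ergodic (hW : WeylGood P)
    (hP : ∀ i j, i ≠ j → 1 ≤ (P i - P j).natDegree) {κ : Measure Y} [IsProbabilityMeasure κ]
    {T : Y ≃ᵐ Y} (hT : Ergodic T κ) {f : ι → Y → ℂ} (hfm : ∀ i, Measurable (f i))
    (hfb : ∀ i, Bd1 (f i)) {j : ι}
    (h : ∀ r : ℕ, 0 < r → ∀ ε > 0, ∃ N : ℕ, ∫⁻ x, ‖((N + 1 : ℕ) : ℂ)⁻¹ *
      ∑ k ∈ Finset.range (N + 1), f j ((T.toEquiv ^ (r * k : ℤ)) x)‖ₑ ∂κ < ε) :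
    Tendsto (fun N : ℕ => (N : ℂ)⁻¹ * ∑ n ∈ Finset.Icc 1 N,
      ∫ x, ∏ i, f i ((T.toEquiv ^ (P i).eval (n : ℤ)) x) ∂κ) atTop (nhds 0) := by
  obtain ⟨S, hSμ, hST⟩ := exists_sys κ T hT.toMeasurePreserving
  subst hSμ
  rw [← hST] at h ⊢
  have herg : Ergodic S.T S.μ := by
    rw [hST]
    exact hT
  have horth : ∀ R : ℕ, 0 < R → ∀ b χ, S.Eig b χ → (∃ z : ℤ, R * b = z) →
      S.E.C (f j * star χ) = 0 := by
    rintro r hr b χ hχ ⟨z, hz⟩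
    rw [← enorm_eq_zero, ← nonpos_iff_eq_zero]
    refine le_of_forall_gt fun ε hε => ?_
    obtain ⟨N, hN⟩ := h r hr ε hε
    rw [S.C_mul_star_eig (hfm j) (hfb j) hχ hz N]
    refine ((enorm_integral_le_lintegral_enorm _).trans (lintegral_mono fun x => ?_)).trans_lt hN
    rw [enorm_mul]
    refine mul_le_of_le_one_right' ?_
    rw [← ofReal_norm, ENNReal.ofReal_le_one]
    exact hχ.bd.star x
  have hb : ∀ n : ℤ, Bd1 (∏ i, sh S.T ((P i).eval n) (f i)) := fun n => by
    intro x
    rw [Finset.prod_apply]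
    exact norm_prod_apply_le_one hfb fun i => (S.T ^ (P i).eval n) x
  have hC : ∀ n : ℤ, S.E.C (∏ i, sh S.T ((P i).eval n) (f i))
      = ∫ x, ∏ i, f i ((S.T ^ (P i).eval n) x) ∂S.μ := fun n => by
    rw [S.C_eq (S.measurable_prod_sh hfm _) (hb n), Finset.prod_fn]
    rfl
  have := tendsto_cesaro_zero
    (u := fun n => ∫ x, ∏ i, f i ((S.T ^ (P i).eval n) x) ∂S.μ)
    (Bd.of_le (c := 1) (fun _ => norm_nonneg _) fun n => by
      rw [← hC n]
      exact S.E.norm_C_le_one (hb n)) fun Λ => by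
    rw [← Sys.Av_eq_zero hW hP S Λ herg hfm hfb horth]
    exact congrArg Λ.C (funext fun n => (hC n).symm)
  exact this

open ProbabilityTheory in
theorem tendsto_average_of_standardBorel [StandardBorelSpace Y] (hW : WeylGood P)
    (hP : ∀ i j, i ≠ j → 1 ≤ (P i - P j).natDegree) {ρ : Measure Y} [IsProbabilityMeasure ρ]
    {T : Y ≃ᵐ Y} (hT : MeasurePreserving T ρ ρ) {f : ι → Y → ℂ} (hfm : ∀ i, Measurable (f i))
    (hfb : ∀ i, Bd1 (f i)) {j : ι}
    (h : ∀ r : ℕ, 0 < r → Tendsto (fun N : ℕ => ∫⁻ x, ‖((N + 1 : ℕ) : ℂ)⁻¹ *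
      ∑ k ∈ Finset.range (N + 1), f j ((T.toEquiv ^ (r * k : ℤ)) x)‖ₑ ∂ρ) atTop (nhds 0)) :
    Tendsto (fun N : ℕ => (N : ℂ)⁻¹ * ∑ n ∈ Finset.Icc 1 N,
      ∫ x, ∏ i, f i ((T.toEquiv ^ (P i).eval (n : ℤ)) x) ∂ρ) atTop (nhds 0) := by
  have hm := aeInv_le (ρ := ρ) (T := T)
  have hTm : ∀ k : ℤ, Measurable ⇑(T.toEquiv ^ k) := fun k =>
    (measurePreserving_zpow T hT k).measurable
  have hgm : ∀ n : ℕ, Measurable fun x => ∏ i, f i ((T.toEquiv ^ (P i).eval (n : ℤ)) x) :=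
    fun n => Finset.measurable_prod _ fun i _ => (hfm i).comp (hTm _)
  have hgb : ∀ n : ℕ, Bd1 fun x => ∏ i, f i ((T.toEquiv ^ (P i).eval (n : ℤ)) x) :=
    fun n x => norm_prod_apply_le_one hfb _
  have h1 : ∀ᵐ ω ∂ρ, ∀ r : ℕ, 0 < r → ∀ ε > 0, ∃ N : ℕ, ∫⁻ x, ‖((N + 1 : ℕ) : ℂ)⁻¹ *
      ∑ k ∈ Finset.range (N + 1), f j ((T.toEquiv ^ (r * k : ℤ)) x)‖ₑ
        ∂(condExpKernel ρ (aeInv ρ T) ω) < ε := by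
    refine ae_all_iff.2 fun r => ?_
    rcases Nat.eq_zero_or_pos r with rfl | hr
    · simp
    · filter_upwards [ae_exists_lintegral_lt hm (u := fun N x => ((N + 1 : ℕ) : ℂ)⁻¹ *
        ∑ k ∈ Finset.range (N + 1), f j ((T.toEquiv ^ (r * k : ℤ)) x))
        (fun N => (Finset.measurable_sum _ fun k _ => (hfm j).comp (hTm _)).const_mul _)
        (g := fun _ => 0) measurable_const (by simpa only [sub_zero] using h r hr)] with ω hω _
      simpa only [sub_zero] using hω
  have hlim : ∀ᵐ ω ∂ρ, Tendsto (fun N : ℕ => (N : ℂ)⁻¹ * ∑ n ∈ Finset.Icc 1 N,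
      ∫ x, ∏ i, f i ((T.toEquiv ^ (P i).eval (n : ℤ)) x) ∂(condExpKernel ρ (aeInv ρ T) ω))
      atTop (nhds 0) := by
    filter_upwards [ae_ergodic hT, h1] with ω he hω
    exact tendsto_average_of_ergodic hW hP he hfm hfb hω
  have hki : ∀ n : ℕ, Integrable (fun ω => ∫ x, ∏ i, f i ((T.toEquiv ^ (P i).eval (n : ℤ)) x)
      ∂(condExpKernel ρ (aeInv ρ T) ω)) ρ := fun n =>
    (integrable_of_bd1 (hgm n) (hgb n)).integral_condExpKernel
  have hk : ∀ n : ℕ, ∫ ω, ∫ x, ∏ i, f i ((T.toEquiv ^ (P i).eval (n : ℤ)) x)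
      ∂(condExpKernel ρ (aeInv ρ T) ω) ∂ρ
      = ∫ x, ∏ i, f i ((T.toEquiv ^ (P i).eval (n : ℤ)) x) ∂ρ := fun n => by
    exact (integral_congr_ae (condExp_ae_eq_integral_condExpKernel hm
      (integrable_of_bd1 (hgm n) (hgb n))).symm).trans (integral_condExp hm)
  have hdom := tendsto_integral_of_dominated_convergence (fun _ => (1 : ℝ))
    (fun N : ℕ => ((integrable_finsetSum (Finset.Icc 1 N) fun n _ => hki n).const_mul
      (N : ℂ)⁻¹).aestronglyMeasurable) (integrable_const _)
    (fun N => Eventually.of_forall fun ω => ?_) hlim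
  · rw [integral_zero] at hdom
    refine hdom.congr fun N => ?_
    rw [integral_const_mul, integral_finsetSum _ fun n _ => hki n,
      Finset.sum_congr rfl fun n _ => hk n]
  · rw [norm_mul, norm_inv, Complex.norm_natCast]
    refine inv_mul_le_one_of_le₀ ?_ N.cast_nonneg
    refine (norm_sum_le_of_le _ (f := fun n : ℕ => ∫ x, ∏ i, f i ((T.toEquiv ^ (P i).eval (n : ℤ)) x)
      ∂(condExpKernel ρ (aeInv ρ T) ω)) (n := fun _ => 1) fun n _ => ?_).trans (by simp)
    simpa using norm_integral_le_of_norm_le_const (μ := condExpKernel ρ (aeInv ρ T) ω)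
      (Eventually.of_forall (hgb n))

end

/-! ### Reduction to standard Borel systems -/

/-- The two-sided shift. -/
def shift (A : Type) [MeasurableSpace A] : (ℤ → A) ≃ᵐ (ℤ → A) where
  toFun y n := y (n + 1)
  invFun y n := y (n - 1)
  left_inv y := by simp
  right_inv y := by simp
  measurable_toFun := measurable_pi_lambda _ fun n => measurable_pi_apply (n + 1)
  measurable_invFun := measurable_pi_lambda _ fun n => measurable_pi_apply (n - 1)

theorem shift_zpow_apply {A : Type} [MeasurableSpace A] (k : ℤ) (y : ℤ → A) (n : ℤ) :
    ((shift A).toEquiv ^ k) y n = y (n + k) := by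
  have hs : ∀ (y : ℤ → A) (n : ℤ), (shift A).toEquiv y n = y (n + 1) := fun _ _ => rfl
  induction k using Int.induction_on generalizing y n with
  | zero => simp
  | succ k ih =>
    rw [zpow_add, zpow_one, Equiv.Perm.mul_apply, ih, hs]
    ring_nf
  | pred k ih =>
    rw [zpow_sub, zpow_one, Equiv.Perm.mul_apply, ih]
    change y _ = _
    ring_nf

theorem tendsto_average {ι : Type} [Fintype ι] [DecidableEq ι] {P : ι → ℤ[X]} (hW : WeylGood P)
    (hP : ∀ i j, i ≠ j → 1 ≤ (P i - P j).natDegree) {Z : Type} [MeasurableSpace Z]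
    {ν : Measure Z} [IsProbabilityMeasure ν] {T : Z ≃ᵐ Z} (hT : MeasurePreserving T ν ν)
    {f : ι → Z → ℂ} (hfm : ∀ i, Measurable (f i)) (hfb : ∀ i, Bd1 (f i)) {j : ι}
    (h : ∀ r : ℕ, 0 < r → Tendsto (fun N : ℕ => ∫⁻ x, ‖((N + 1 : ℕ) : ℂ)⁻¹ *
      ∑ k ∈ Finset.range (N + 1), f j ((T.toEquiv ^ (r * k : ℤ)) x)‖ₑ ∂ν) atTop (nhds 0)) :
    Tendsto (fun N : ℕ => (N : ℂ)⁻¹ * ∑ n ∈ Finset.Icc 1 N,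
      ∫ x, ∏ i, f i ((T.toEquiv ^ (P i).eval (n : ℤ)) x) ∂ν) atTop (nhds 0) := by
  have : StandardBorelSpace (Metric.closedBall (0 : ℂ) 1) :=
    Metric.isClosed_closedBall.measurableSet.standardBorel
  let A := ι → Metric.closedBall (0 : ℂ) 1
  let Φ : Z → ℤ → A := fun x n i =>
    ⟨f i ((T.toEquiv ^ n) x), mem_closedBall_zero_iff.2 (hfb i _)⟩
  have hTm : ∀ k : ℤ, Measurable ⇑(T.toEquiv ^ k) := fun k =>
    (measurePreserving_zpow T hT k).measurable
  have hΦ : Measurable Φ := measurable_pi_lambda _ fun n => measurable_pi_lambda _ fun i =>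
    ((hfm i).comp (hTm n)).subtype_mk
  have hΦT : shift A ∘ Φ = Φ ∘ T := by
    ext x n i
    change f i ((T.toEquiv ^ (n + 1)) x) = f i ((T.toEquiv ^ n) (T x))
    rw [zpow_add, zpow_one]
    rfl
  let g : ι → (ℤ → A) → ℂ := fun i y => y 0 i
  have hg : ∀ i, Measurable (g i) := fun i =>
    measurable_subtype_coe.comp ((measurable_pi_apply i).comp (measurable_pi_apply 0))
  have hgb : ∀ i, Bd1 (g i) := fun i y => mem_closedBall_zero_iff.1 (y 0 i).2
  have hgΦ : ∀ i (k : ℤ) x, g i (((shift A).toEquiv ^ k) (Φ x)) = f i ((T.toEquiv ^ k) x) :=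
    fun i k x => by
      change ((((shift A).toEquiv ^ k) (Φ x) 0 i : Metric.closedBall (0 : ℂ) 1) : ℂ) = _
      rw [shift_zpow_apply, zero_add]
  have hS : MeasurePreserving (shift A) (ν.map Φ) (ν.map Φ) := by
    refine ⟨(shift A).measurable, ?_⟩
    rw [Measure.map_map (shift A).measurable hΦ, hΦT, ← Measure.map_map hΦ T.measurable, hT.map_eq]
  have hprob : IsProbabilityMeasure (ν.map Φ) := Measure.isProbabilityMeasure_map hΦ.aemeasurable
  have hgS : ∀ i (k : ℤ), Measurable fun y => g i (((shift A).toEquiv ^ k) y) := fun i k =>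
    (hg i).comp (measurePreserving_zpow _ hS k).measurable
  refine (tendsto_average_of_standardBorel hW hP hS hg hgb (j := j) fun r hr => ?_).congr fun N => ?_
  · refine (h r hr).congr fun N => ?_
    rw [lintegral_map (((Finset.measurable_sum _ fun k _ => hgS j _).const_mul _).enorm)
      hΦ]
    simp_rw [hgΦ]
  · congr 1
    refine Finset.sum_congr rfl fun n _ => ?_
    rw [integral_map hΦ.aemeasurable (Finset.measurable_prod _ fun i _ =>
      hgS i _).aestronglyMeasurable]
    simp_rw [hgΦ]

/-! ### The product system -/

section
variable {X : Type}

/-- The function `(x, y) ↦ u x * conj (u y)`. -/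
def tensorStar (u : X → ℂ) (q : X × X) : ℂ := u q.1 * star (u q.2)

theorem Bd1.tensorStar {u : X → ℂ} (hu : Bd1 u) : Bd1 (tensorStar u) := fun _ =>
  (norm_mul_le _ _).trans (mul_le_one₀ (hu _) (norm_nonneg _) (hu.star _))

variable [MeasurableSpace X]

theorem measurable_tensorStar {u : X → ℂ} (hu : Measurable u) : Measurable (tensorStar u) :=
  (hu.comp measurable_fst).mul ((measurable_star_comp hu).comp measurable_snd)

theorem integral_tensorStar {μ : Measure X} [SFinite μ] (u : X → ℂ) :
    ∫ q, tensorStar u q ∂(μ.prod μ) = ((‖∫ x, u x ∂μ‖ ^ 2 : ℝ) : ℂ) := by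
  have h : ∫ x, star (u x) ∂μ = star (∫ x, u x ∂μ) := integral_conj
  unfold tensorStar
  rw [integral_prod_mul u fun x => star (u x), h, ← starRingEnd_apply,
    Complex.mul_conj', Complex.ofReal_pow]

theorem prodCongr_zpow_apply (T : X ≃ᵐ X) (k : ℤ) (q : X × X) :
    ((T.prodCongr T).toEquiv ^ k) q = ((T.toEquiv ^ k) q.1, (T.toEquiv ^ k) q.2) := by
  induction k using Int.induction_on generalizing q with
  | zero => rfl
  | succ k ih =>
    simp only [zpow_add, zpow_one, Equiv.Perm.mul_apply, ih]
    rfl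
  | pred k ih =>
    simp only [zpow_sub, zpow_one, Equiv.Perm.mul_apply, ih]
    rfl

variable {μ : Measure X} [IsProbabilityMeasure μ] {T : X ≃ᵐ X}

theorem mean_autocorrelation_eq_zero (S : Sys X) {u : X → ℂ} (hu : Measurable u) (hub : Bd1 u)
    (horth : ∀ a χ, S.Eig a χ → S.E.C (u * star χ) = 0) (Λ : Mean) :
    Λ.R (fun n => ‖S.E.C (sh S.T n u * star u)‖ ^ 2) = 0 := by
  by_contra hne
  have hpos : 0 < Λ.R (fun n => ‖S.E.C (sh S.T n u * star u)‖ ^ 2) :=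
    lt_of_le_of_ne (Λ.pos' _ (Bd.of_le (c := 1) (fun _ => by positivity) fun n =>
      pow_le_one₀ (norm_nonneg _) (S.E.norm_C_le_one ((hub.sh n).mul hub.star)))
      fun n => by positivity) (Ne.symm hne)
  obtain ⟨a, χ, hχ, h⟩ := S.exists_eig hu hub hpos Λ le_rfl
  rw [horth a χ hχ, norm_zero] at h
  exact absurd h (not_le.2 (by positivity))

/-- The averages of `u ⊗ conj u` along multiples of `r` tend to zero in mean when `u` is
orthogonal to all eigenfunctions. -/
theorem tendsto_lintegral_average_tensorStar (hT : MeasurePreserving T μ μ) {u : X → ℂ}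
    (hu : Measurable u) (hub : Bd1 u)
    (horth : ∀ a χ, Measurable χ → Bd1 χ → (∀ x, χ (T x) = ee a * χ x) →
      ∫ x, u x * star (χ x) ∂μ = 0) {r : ℕ} (hr : 0 < r) :
    Tendsto (fun N : ℕ => ∫⁻ q, ‖((N + 1 : ℕ) : ℂ)⁻¹ * ∑ k ∈ Finset.range (N + 1),
      tensorStar u (((T.prodCongr T).toEquiv ^ (r * k : ℤ)) q)‖ₑ ∂(μ.prod μ)) atTop (nhds 0) := by
  obtain ⟨S, hSμ, hST⟩ := exists_sys μ T hT
  subst hSμ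
  have hTT : MeasurePreserving (T.prodCongr T) (S.μ.prod S.μ) (S.μ.prod S.μ) := hT.prod hT
  have hTm : ∀ k : ℤ, Measurable ⇑((T.prodCongr T).toEquiv ^ k) := fun k =>
    (measurePreserving_zpow _ hTT k).measurable
  have horthS : ∀ a χ, S.Eig a χ → S.E.C (u * star χ) = 0 := fun a χ hχ => by
    rw [S.C_eq (hu.mul (measurable_star_comp hχ.meas)) (hub.mul hχ.bd.star)]
    refine horth a χ hχ.meas hχ.bd fun x => ?_
    have := hχ.eq x
    rw [hST] at this
    exact this
  let b : ℤ → ℝ := fun n => ‖S.E.C (sh S.T n u * star u)‖ ^ 2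
  have hb1 : ∀ n, b n ≤ 1 := fun n =>
    pow_le_one₀ (norm_nonneg _) (S.E.norm_C_le_one ((hub.sh n).mul hub.star))
  have hb0 : ∀ n, 0 ≤ b n := fun n => by positivity
  have hφ : Bd fun n : ℤ => b (r * n) := Bd.of_le (fun n => hb0 _) fun n => hb1 _
  have hdouble := tendsto_double_average_zero hφ fun Λ => by
    obtain ⟨Λ', hΛ'⟩ := Λ.exists_dilate r (by exact_mod_cast hr.ne')
    refine le_antisymm ((hΛ' b (Bd.of_le hb0 hb1) hb0).trans ?_) (Λ.pos' _ hφ fun n => hb0 _)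
    rw [mean_autocorrelation_eq_zero S hu hub horthS, mul_zero]
  let v : ℤ → X × X → ℂ := fun k q => tensorStar u (((T.prodCongr T).toEquiv ^ (r * k : ℤ)) q)
  have hvm : ∀ k, Measurable (v k) := fun k => (measurable_tensorStar hu).comp (hTm _)
  have hvb : ∀ k, Bd1 (v k) := fun k q => hub.tensorStar _
  have hvv : ∀ k l, ∫ q, v k q * star (v l q) ∂(S.μ.prod S.μ) = (b (r * (k - l)) : ℂ) := by
    intro k l
    have h1 : ∀ q, v k q * star (v l q)
        = tensorStar (sh S.T (r * k) u * star (sh S.T (r * l) u)) q := fun q => by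
      simp only [v, prodCongr_zpow_apply, tensorStar, Pi.mul_apply, Pi.star_apply, sh, hST,
        star_mul', star_star]
      ring
    have h2 : S.E.C (sh S.T (r * k) u * star (sh S.T (r * l) u))
        = S.E.C (sh S.T (r * (k - l)) u * star u) := by
      rw [← S.toDyn.C_sh ((hub.sh (r * (k - l))).mul hub.star) (r * l), sh_mul, sh_sh, sh_star]
      congr 4
      ring
    simp_rw [h1]
    rw [integral_tensorStar, ← S.C_eq ((measurable_sh S.meas hu _).mul (measurable_star_comp
      (measurable_sh S.meas hu _))) ((hub.sh _).mul (hub.sh _).star), h2]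
  let A : ℕ → X × X → ℂ := fun N q => ((N + 1 : ℕ) : ℂ)⁻¹ * ∑ k ∈ Finset.range (N + 1), v k q
  have hAm : ∀ N, Measurable (A N) := fun N =>
    (Finset.measurable_sum _ fun k _ => hvm _).const_mul _
  have hAb : ∀ N, Bd1 (A N) := fun N q => by
    rw [norm_mul, norm_inv, Complex.norm_natCast]
    refine inv_mul_le_one_of_le₀ ?_ (Nat.cast_nonneg _)
    refine (norm_sum_le_of_le (Finset.range (N + 1)) (f := fun k : ℕ => v k q)
      (n := fun _ => 1) fun k _ => hvb k q).trans (by simp)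
  have hAA : ∀ N, ∫ q, ‖A N q‖ ^ 2 ∂(S.μ.prod S.μ) = ((N + 1 : ℕ) : ℝ)⁻¹ * (((N + 1 : ℕ) : ℝ)⁻¹ *
      ∑ l ∈ Finset.range (N + 1), ∑ k ∈ Finset.range (N + 1), b (r * (k - l))) := fun N => by
    have h1 : ∀ q, ((‖A N q‖ ^ 2 : ℝ) : ℂ) = ((N + 1 : ℕ) : ℂ)⁻¹ * (((N + 1 : ℕ) : ℂ)⁻¹ *
        ∑ l ∈ Finset.range (N + 1), ∑ k ∈ Finset.range (N + 1), v k q * star (v l q)) := fun q => by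
      rw [Complex.ofReal_pow, ← Complex.mul_conj', starRingEnd_apply, Finset.sum_comm,
        ← Finset.sum_mul_sum]
      simp only [A, star_mul', star_sum, star_inv₀, star_natCast]
      ring
    have hi : ∀ k l, Integrable (fun q => v k q * star (v l q)) (S.μ.prod S.μ) := fun k l =>
      integrable_of_bd1 ((hvm k).mul (measurable_star_comp (hvm l))) ((hvb k).mul (hvb l).star)
    apply Complex.ofReal_injective
    rw [← integral_complex_ofReal]
    simp_rw [h1]
    rw [integral_const_mul, integral_const_mul,
      integral_finsetSum _ fun (l : ℕ) _ => integrable_finsetSum _ fun (k : ℕ) _ => hi k l]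
    simp_rw [integral_finsetSum _ fun (k : ℕ) _ => hi k _, hvv]
    push_cast
    rfl
  simp_rw [← hAA] at hdouble
  have hsq : ∀ N, ∫ q, ‖A N q‖ ∂(S.μ.prod S.μ) ≤ √(∫ q, ‖A N q‖ ^ 2 ∂(S.μ.prod S.μ)) := fun N => by
    obtain ⟨S₂, h₂, -⟩ := exists_sys _ _ hTT
    rw [← h₂, ← S₂.int _ (hAm N).norm (hAb N).norm,
      ← S₂.int _ ((hAm N).norm.pow_const 2) ((hAb N).norm.pow 2)]
    exact Real.le_sqrt_of_sq_le (S₂.E.sq_R_le (hAb N).norm)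
  have hlim : Tendsto (fun N => ∫ q, ‖A N q‖ ∂(S.μ.prod S.μ)) atTop (nhds 0) := by
    have h0 := hdouble.sqrt
    rw [Real.sqrt_zero] at h0
    exact squeeze_zero (fun N => integral_nonneg fun q => norm_nonneg _) hsq h0
  have hof := ENNReal.tendsto_ofReal hlim
  rw [ENNReal.ofReal_zero] at hof
  refine hof.congr fun N => ?_
  exact ofReal_integral_norm_eq_lintegral_enorm (integrable_of_bd1 (hAm N) (hAb N))

theorem tendsto_average_norm {ι : Type} [Fintype ι] [DecidableEq ι] {P : ι → ℤ[X]}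
    (hW : WeylGood P) (hP : ∀ i j, i ≠ j → 1 ≤ (P i - P j).natDegree)
    (hT : MeasurePreserving T μ μ) {f : ι → X → ℂ} (hfm : ∀ i, Measurable (f i))
    (hfb : ∀ i, Bd1 (f i)) {j : ι}
    (horth : ∀ a χ, Measurable χ → Bd1 χ → (∀ x, χ (T x) = ee a * χ x) →
      ∫ x, f j x * star (χ x) ∂μ = 0) :
    Tendsto (fun N : ℕ => (N : ℝ)⁻¹ * ∑ n ∈ Finset.Icc 1 N,
      ‖∫ x, ∏ i, f i ((T.toEquiv ^ (P i).eval (n : ℤ)) x) ∂μ‖) atTop (nhds 0) := by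
  have hTT : MeasurePreserving (T.prodCongr T) (μ.prod μ) (μ.prod μ) := hT.prod hT
  let c : ℕ → ℝ := fun n => ‖∫ x, ∏ i, f i ((T.toEquiv ^ (P i).eval (n : ℤ)) x) ∂μ‖
  have h1 := tendsto_average hW hP hTT (fun i => measurable_tensorStar (hfm i))
    (fun i => (hfb i).tensorStar) (j := j) fun r hr =>
      tendsto_lintegral_average_tensorStar hT (hfm j) (hfb j) horth hr
  have h2 : ∀ n : ℕ, ∫ q, ∏ i, tensorStar (f i) (((T.prodCongr T).toEquiv ^
      (P i).eval (n : ℤ)) q) ∂(μ.prod μ) = ((c n ^ 2 : ℝ) : ℂ) := fun n => by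
    rw [← integral_tensorStar]
    simp only [prodCongr_zpow_apply, tensorStar, Finset.prod_mul_distrib, star_prod]
  have h3 : Tendsto (fun N : ℕ => (N : ℝ)⁻¹ * ∑ n ∈ Finset.Icc 1 N, c n ^ 2) atTop (nhds 0) := by
    simp_rw [h2] at h1
    have h4 := (Complex.continuous_re.tendsto _).comp h1
    rw [Complex.zero_re] at h4
    refine h4.congr fun N => ?_
    rw [Function.comp_apply, ← Complex.ofReal_re ((N : ℝ)⁻¹ * ∑ n ∈ Finset.Icc 1 N, c n ^ 2)]
    push_cast
    rfl
  have h5 := h3.sqrt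
  rw [Real.sqrt_zero] at h5
  refine squeeze_zero (fun N => by positivity) (fun N => Real.le_sqrt_of_sq_le ?_) h5
  rcases Nat.eq_zero_or_pos N with rfl | hN
  · simp
  have hN' : (0 : ℝ) < N := by exact_mod_cast hN
  have h6 := sq_sum_le_card_mul_sum_sq (s := Finset.Icc 1 N) (f := c)
  rw [Nat.card_Icc, Nat.add_sub_cancel] at h6
  calc ((N : ℝ)⁻¹ * ∑ n ∈ Finset.Icc 1 N, c n) ^ 2
      = (N : ℝ)⁻¹ ^ 2 * (∑ n ∈ Finset.Icc 1 N, c n) ^ 2 := mul_pow _ _ _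
    _ ≤ (N : ℝ)⁻¹ ^ 2 * (N * ∑ n ∈ Finset.Icc 1 N, c n ^ 2) := by gcongr
    _ = (N : ℝ)⁻¹ * ∑ n ∈ Finset.Icc 1 N, c n ^ 2 := by field_simp

end

end PolyAvg

theorem statement14
    {X : Type} [MeasurableSpace X] (μ : Measure X) [IsProbabilityMeasure μ]
    (T : X ≃ᵐ X) (hT : MeasurePreserving (⇑T) μ μ)
    (s : ℕ) (p : Fin s → Polynomial ℤ)
    (hp0 : ∀ i, (p i).coeff 0 = 0)
    (hpind : LinearIndependent ℚ fun i : Fin s => (p i).map (Int.castRingHom ℚ))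
    (f₀ : X → ℂ) (hf₀_meas : Measurable f₀) (hf₀_bd : ∃ C, ∀ x, ‖f₀ x‖ ≤ C)
    (f : Fin s → X → ℂ) (hf_meas : ∀ i, Measurable (f i))
    (hf_bd : ∀ i, ∃ C, ∀ x, ‖f i x‖ ≤ C)
    (horth : (∀ g : X → ℂ, IsEigenfunction μ (⇑T) g →
        ∫ x, f₀ x * (starRingEnd ℂ) (g x) ∂μ = 0) ∨
      ∃ i, ∀ g : X → ℂ, IsEigenfunction μ (⇑T) g →
        ∫ x, f i x * (starRingEnd ℂ) (g x) ∂μ = 0) :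
    Tendsto (fun N : ℕ => (N : ℝ)⁻¹ * ∑ n ∈ Finset.Icc 1 N,
        ‖∫ x, f₀ x * ∏ i, f i (⇑(T.toEquiv ^ ((p i).eval (n : ℤ))) x) ∂μ‖)
      atTop (nhds 0) := by
  let F : Option (Fin s) → X → ℂ := fun i => i.elim f₀ f
  have hFm : ∀ i, Measurable (F i) := by
    rintro (_ | i)
    exacts [hf₀_meas, hf_meas i]
  have hFb : ∀ i, ∃ C, ∀ x, ‖F i x‖ ≤ C := by
    rintro (_ | i)
    exacts [hf₀_bd, hf_bd i]
  obtain ⟨j, hj⟩ : ∃ j, ∀ g : X → ℂ, IsEigenfunction μ (⇑T) g →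
      ∫ x, F j x * (starRingEnd ℂ) (g x) ∂μ = 0 := by
    rcases horth with h | ⟨i, h⟩
    exacts [⟨none, h⟩, ⟨some i, h⟩]
  choose C hC using hFb
  let c : Option (Fin s) → ℝ := fun i => max (C i) 1
  have hc : ∀ i, 0 < c i := fun i => lt_max_of_lt_right one_pos
  have key := PolyAvg.tendsto_average_norm (PolyAvg.weylGood_optPoly hp0 hpind)
    (PolyAvg.one_le_natDegree_optPoly_sub hp0 hpind) hT (f := fun i x => (c i : ℂ)⁻¹ * F i x)
    (fun i => (hFm i).const_mul _) (fun i x => ?_) (j := j) fun a χ hχ hχb hχT => ?_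
  · have hlim := key.const_mul (∏ i, c i)
    rw [mul_zero] at hlim
    refine hlim.congr fun N => ?_
    rw [mul_left_comm, Finset.mul_sum]
    congr 1
    refine Finset.sum_congr rfl fun n _ => ?_
    simp_rw [Finset.prod_mul_distrib]
    rw [integral_const_mul, norm_mul, norm_prod]
    simp_rw [norm_inv, Complex.norm_real, Real.norm_of_nonneg (hc _).le]
    rw [← mul_assoc, ← Finset.prod_mul_distrib,
      Finset.prod_eq_one fun i _ => mul_inv_cancel₀ (hc i).ne', one_mul]
    congr 2
    ext x
    rw [Fintype.prod_option]
    simp [F, PolyAvg.optPoly]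
  · rw [norm_mul, norm_inv, Complex.norm_real, Real.norm_of_nonneg (hc i).le]
    exact inv_mul_le_one_of_le₀ ((hC i x).trans (le_max_left _ _)) (hc i).le
  · simp_rw [mul_assoc]
    rw [integral_const_mul]
    have := hj χ ⟨hχ, ⟨1, hχb⟩, a, Eventually.of_forall hχT⟩
    simp only [starRingEnd_apply] at this
    rw [this, mul_zero]
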